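/- arXiv:2503.04701 — 2 statements merged into one kernel-verified Lean document; each statement's English description precedes it below -/
import Mathlib

section
/- The time-independent Gross–Pitaevskii equation u''(x) + (a − b·cos(2x))·u(x) − c·u(x)³ = 0 with parameters a = 1, b = −1, c = 1 has a soliton solution u : ℝ → ℝ that is even and not identically zero. -/
open Filter Real

/-- A global trajectory of a time-dependent vector field that is bounded by `K‖x‖` on a symmetric
interval, given global Lipschitz continuity. -/
lemma exists_trajectory_Icc {F : ℝ → ℝ × ℝ → ℝ × ℝ} {K : NNReal}
    (hL : ∀ t, LipschitzWith K (F t)) (hc : ∀ x, Continuous fun t => F t x)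
    (h0 : ∀ t, F t 0 = 0) (x₀ : ℝ × ℝ) {T : ℝ} (hT : 0 < T) :
    ∃ γ : ℝ → ℝ × ℝ, γ 0 = x₀ ∧ ∀ t ∈ Set.Ioo (-T) T, HasDerivAt γ (F t (γ t)) t := by
  set R : ℝ := ‖x₀‖ * exp (K * T) with hR
  have hR0 : 0 ≤ R := by positivity
  let c : ℝ → ℝ := fun s => max (-R) (min s R)
  let ρ : ℝ × ℝ → ℝ × ℝ := fun x => (c x.1, c x.2)
  have hcL : LipschitzWith 1 c := (LipschitzWith.id.min_const R).const_max (-R)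
  have hρL : LipschitzWith 1 ρ := by
    have := (hcL.comp LipschitzWith.prod_fst).prodMk (hcL.comp LipschitzWith.prod_snd)
    simpa using this
  have hFL : ∀ t, LipschitzWith K (fun x => F t (ρ x)) := fun t => by
    simpa [Function.comp_def] using (hL t).comp hρL
  have hFb : ∀ t x, ‖F t x‖ ≤ K * ‖x‖ := fun t x => by
    simpa [h0 t] using (hL t).dist_le_mul x 0
  have hρR : ∀ x, ‖ρ x‖ ≤ R := fun x => by
    have : ∀ s, |c s| ≤ R := fun s => by
      simp only [c, abs_le]
      exact ⟨le_max_left _ _, max_le (by linarith) (min_le_right _ _)⟩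
    exact max_le (this x.1) (this x.2)
  have hρn : ∀ x, ‖ρ x‖ ≤ ‖x‖ := fun x => by
    have hρ0 : ρ 0 = 0 := by simp [ρ, c, hR0]
    simpa [hρ0] using hρL.dist_le_mul x 0
  have hρid : ∀ x, ‖x‖ ≤ R → ρ x = x := fun x hx => by
    have : ∀ s, |s| ≤ R → c s = s := fun s hs => by
      obtain ⟨h1, h2⟩ := abs_le.1 hs
      simp only [c]
      rw [min_eq_left h2, max_eq_right h1]
    have h1 : |x.1| ≤ ‖x‖ := norm_fst_le x
    have h2 : |x.2| ≤ ‖x‖ := norm_snd_le x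
    exact Prod.ext (this _ (h1.trans hx)) (this _ (h2.trans hx))
  have h0mem : (0 : ℝ) ∈ Set.Icc (-T) T := ⟨by linarith, by linarith⟩
  have hPL : IsPicardLindelof (fun t x => F t (ρ x)) (⟨0, h0mem⟩ : Set.Icc (-T) T) x₀
      (K * R.toNNReal * T.toNNReal) 0 (K * R.toNNReal) K := by
    refine ⟨fun t _ => (hFL t).lipschitzOnWith, fun x _ => (hc _).continuousOn, ?_, ?_⟩
    · intro t _ x _
      refine (hFb t _).trans ?_
      push_cast
      rw [Real.coe_toNNReal R hR0]
      exact mul_le_mul_of_nonneg_left (hρR x) K.2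
    · push_cast
      rw [Real.coe_toNNReal R hR0, Real.coe_toNNReal T hT.le]
      simp
  obtain ⟨γ, hγ0, hγ⟩ := hPL.exists_eq_forall_mem_Icc_hasDerivWithinAt₀
  have hγ0 : γ 0 = x₀ := hγ0
  have hd : ∀ t ∈ Set.Ioo (-T) T, HasDerivAt γ (F t (ρ (γ t))) t := fun t ht =>
    (hγ t ⟨ht.1.le, ht.2.le⟩).hasDerivAt (Icc_mem_nhds ht.1 ht.2)
  have hb : ∀ t ∈ Set.Ioo (-T) T, ‖F t (ρ (γ t))‖ ≤ K * ‖γ t‖ + 0 := fun t _ => by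
    rw [add_zero]
    exact (hFb _ _).trans (mul_le_mul_of_nonneg_left (hρn _) K.2)
  have hexp : ∀ s, 0 ≤ s → s ≤ T → gronwallBound ‖x₀‖ K 0 s ≤ R := fun s _ hs => by
    rw [gronwallBound_ε0, hR]
    gcongr
  have key : ∀ t ∈ Set.Ioo (-T) T, ‖γ t‖ ≤ R := by
    intro t ht
    rcases le_total 0 t with h | h
    · have := norm_le_gronwallBound_of_norm_deriv_right_le (f := γ)
        (f' := fun t => F t (ρ (γ t))) (δ := ‖x₀‖) (K := K) (ε := 0) (a := 0) (b := t)
        (fun s hs =>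
          (hd s ⟨by linarith [hs.1], by linarith [hs.2, ht.2]⟩).continuousAt.continuousWithinAt)
        (fun s hs => (hd s ⟨by linarith [hs.1], by linarith [hs.2, ht.2]⟩).hasDerivWithinAt)
        (by rw [hγ0])
        (fun s hs => hb s ⟨by linarith [hs.1], by linarith [hs.2, ht.2]⟩) t ⟨h, le_rfl⟩
      exact this.trans (hexp _ (by linarith) (by linarith [ht.2]))
    · have hd' : ∀ s ∈ Set.Ioo (-T) T,
          HasDerivAt (fun s => γ (-s)) (-(F (-s) (ρ (γ (-s))))) s := fun s hs => by
        have := (hd (-s) ⟨by linarith [hs.2], by linarith [hs.1]⟩).scomp s (hasDerivAt_neg s)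
        simpa [Function.comp_def] using this
      have := norm_le_gronwallBound_of_norm_deriv_right_le (f := fun s => γ (-s))
        (f' := fun s => -(F (-s) (ρ (γ (-s))))) (δ := ‖x₀‖) (K := K) (ε := 0) (a := 0) (b := -t)
        (fun s hs =>
          (hd' s ⟨by linarith [hs.1], by linarith [hs.2, ht.1]⟩).continuousAt.continuousWithinAt)
        (fun s hs => (hd' s ⟨by linarith [hs.1], by linarith [hs.2, ht.1]⟩).hasDerivWithinAt)
        (by simp [hγ0])
        (fun s hs => by
          rw [norm_neg]
          exact hb (-s) ⟨by linarith [hs.2, ht.1], by linarith [hs.1]⟩)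
        (-t) ⟨by linarith, le_rfl⟩
      simp only [neg_neg] at this
      exact this.trans (hexp _ (by linarith) (by linarith [ht.1]))
  exact ⟨γ, hγ0, fun t ht => by simpa [hρid _ (key t ht)] using hd t ht⟩

lemma exists_trajectory {F : ℝ → ℝ × ℝ → ℝ × ℝ} {K : NNReal}
    (hL : ∀ t, LipschitzWith K (F t)) (hc : ∀ x, Continuous fun t => F t x)
    (h0 : ∀ t, F t 0 = 0) (x₀ : ℝ × ℝ) :
    ∃ γ : ℝ → ℝ × ℝ, γ 0 = x₀ ∧ ∀ t, HasDerivAt γ (F t (γ t)) t := by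
  choose γ hγ0 hγ using fun n : ℕ =>
    exists_trajectory_Icc hL hc h0 x₀ (T := n + 1) (by positivity)
  have agree : ∀ m n : ℕ, m ≤ n → ∀ t ∈ Set.Ioo (-(m + 1 : ℝ)) (m + 1), γ m t = γ n t := by
    intro m n hmn
    have hmn' : (m : ℝ) ≤ n := by exact_mod_cast hmn
    refine ODE_solution_unique_of_mem_Ioo (v := F) (s := fun _ => Set.univ) (K := K) (t₀ := 0)
      (fun t _ => (hL t).lipschitzOnWith) ⟨by linarith [m.cast_nonneg (α := ℝ)], by positivity⟩
      (fun t ht => ⟨hγ m t ht, trivial⟩)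
      (fun t ht => ⟨hγ n t ⟨by linarith [ht.1], by linarith [ht.2]⟩, trivial⟩) (by rw [hγ0, hγ0])
  refine ⟨fun t => γ ⌈|t|⌉₊ t, by simpa using hγ0 0, fun t => ?_⟩
  have ht := Nat.le_ceil |t|
  obtain ⟨h1, h2⟩ := abs_le.1 ht
  set n := ⌈|t|⌉₊
  refine (hγ n t ⟨by linarith, by linarith⟩).congr_of_eventuallyEq ?_
  filter_upwards [Ioo_mem_nhds (show -(n + 1 : ℝ) < t by linarith) (show t < n + 1 by linarith)]
    with s hs
  rcases le_total n ⌈|s|⌉₊ with h | h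
  · exact (agree _ _ h s hs).symm
  · have := abs_le.1 (Nat.le_ceil |s|)
    exact agree _ _ h s ⟨by linarith [this.1], by linarith [this.2]⟩

/-- `u` solves the second-order equation `u'' = G x u`, with derivative `v`. -/
structure IsSol (G : ℝ → ℝ → ℝ) (u v : ℝ → ℝ) : Prop where
  hasDerivAt_fst : ∀ x, HasDerivAt u (v x) x
  hasDerivAt_snd : ∀ x, HasDerivAt v (G x (u x)) x

namespace IsSol

variable {G : ℝ → ℝ → ℝ} {u v u₁ v₁ : ℝ → ℝ} {K : NNReal}

lemma lipschitzWith_field (hL : ∀ x, LipschitzWith K (G x)) (t : ℝ) :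
    LipschitzWith (max 1 K) (fun z : ℝ × ℝ => (z.2, G t z.1)) := by
  have := LipschitzWith.prod_snd.prodMk ((hL t).comp (LipschitzWith.prod_fst (α := ℝ) (β := ℝ)))
  simpa [Function.comp_def] using this

lemma continuous_fst (h : IsSol G u v) : Continuous u :=
  continuous_iff_continuousAt.2 fun x => (h.hasDerivAt_fst x).continuousAt

lemma exists_sol (hL : ∀ x, LipschitzWith K (G x)) (hc : ∀ y, Continuous fun x => G x y)
    (h0 : ∀ x, G x 0 = 0) (a b : ℝ) : ∃ u v, IsSol G u v ∧ u 0 = a ∧ v 0 = b := by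
  obtain ⟨γ, hγ0, hγ⟩ := exists_trajectory (lipschitzWith_field hL)
    (fun x => continuous_const.prodMk (hc x.1)) (fun t => by simp [h0 t]) (a, b)
  refine ⟨fun t => (γ t).1, fun t => (γ t).2, ⟨fun t => ?_, fun t => ?_⟩, by simp [hγ0],
    by simp [hγ0]⟩
  · exact (hasFDerivAt_fst.comp_hasDerivAt t (hγ t) :)
  · exact (hasFDerivAt_snd.comp_hasDerivAt t (hγ t) :)

lemma unique (hL : ∀ x, LipschitzWith K (G x)) (h : IsSol G u v) (h₁ : IsSol G u₁ v₁) {c : ℝ}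
    (hu : u c = u₁ c) (hv : v c = v₁ c) : u = u₁ ∧ v = v₁ := by
  have := ODE_solution_unique_univ (v := fun t (z : ℝ × ℝ) => (z.2, G t z.1))
    (s := fun _ => Set.univ) (f := fun t => (u t, v t)) (g := fun t => (u₁ t, v₁ t)) (t₀ := c)
    (fun t => (lipschitzWith_field hL t).lipschitzOnWith)
    (fun t => ⟨(h.hasDerivAt_fst t).prodMk (h.hasDerivAt_snd t), trivial⟩)
    (fun t => ⟨(h₁.hasDerivAt_fst t).prodMk (h₁.hasDerivAt_snd t), trivial⟩) (by simp [hu, hv])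
  exact ⟨funext fun t => congrArg Prod.fst (congrFun this t),
    funext fun t => congrArg Prod.snd (congrFun this t)⟩

/-- Grönwall estimate between a solution and an approximate solution. -/
lemma dist_le (hL : ∀ x, LipschitzWith K (G x)) (h : IsSol G u v) {f f' f'' : ℝ → ℝ}
    (hf : ∀ t, HasDerivAt f (f' t) t) (hf' : ∀ t, HasDerivAt f' (f'' t) t) {T δ η : ℝ}
    (hη : ∀ t ∈ Set.Ico 0 T, |f'' t - G t (f t)| ≤ η) (h1 : |f 0 - u 0| ≤ δ)
    (h2 : |f' 0 - v 0| ≤ δ) {t : ℝ} (ht : t ∈ Set.Icc 0 T) :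
    |f t - u t| ≤ gronwallBound δ (max 1 K : NNReal) η t ∧
      |f' t - v t| ≤ gronwallBound δ (max 1 K : NNReal) η t := by
  have hd : ∀ t, HasDerivAt (fun t => (f t, f' t)) (f' t, f'' t) t :=
    fun t => (hf t).prodMk (hf' t)
  have hd1 : ∀ t, HasDerivAt (fun t => (u t, v t)) (v t, G t (u t)) t :=
    fun t => (h.hasDerivAt_fst t).prodMk (h.hasDerivAt_snd t)
  have := dist_le_of_approx_trajectories_ODE (v := fun t (z : ℝ × ℝ) => (z.2, G t z.1))
    (f := fun t => (f t, f' t)) (g := fun t => (u t, v t)) (f' := fun t => (f' t, f'' t))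
    (g' := fun t => (v t, G t (u t))) (a := 0) (b := T) (δ := δ) (εf := η) (εg := 0)
    (lipschitzWith_field hL)
    (fun s _ => (hd s).continuousAt.continuousWithinAt) (fun s _ => (hd s).hasDerivWithinAt)
    (fun s hs => by
      rw [Prod.dist_eq, dist_self, Real.dist_eq]
      exact max_le ((abs_nonneg _).trans (hη s hs)) (hη s hs))
    (fun s _ => (hd1 s).continuousAt.continuousWithinAt) (fun s _ => (hd1 s).hasDerivWithinAt)
    (fun s _ => by simp) (by
      rw [Prod.dist_eq, Real.dist_eq, Real.dist_eq]
      exact max_le h1 h2) t ht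
  rw [Prod.dist_eq, Real.dist_eq, Real.dist_eq, add_zero, sub_zero] at this
  exact max_le_iff.1 this

end IsSol

/-- The derivative of `truncCube`. -/
noncomputable def dTruncCube (s : ℝ) : ℝ := 3 * min (s ^ 2) 4

/-- An odd `C¹` function with bounded derivative that agrees with `s ↦ s³` on `[-2, 2]` and is
affine outside of this interval. -/
noncomputable def truncCube (s : ℝ) : ℝ := ∫ t in (0 : ℝ)..s, dTruncCube t

lemma continuous_dTruncCube : Continuous dTruncCube := by
  unfold dTruncCube
  fun_prop

lemma hasDerivAt_truncCube (s : ℝ) : HasDerivAt truncCube (dTruncCube s) s :=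
  intervalIntegral.integral_hasDerivAt_right (continuous_dTruncCube.intervalIntegrable _ _)
    (continuous_dTruncCube.stronglyMeasurableAtFilter _ _) continuous_dTruncCube.continuousAt

lemma dTruncCube_nonneg (s : ℝ) : 0 ≤ dTruncCube s := by
  unfold dTruncCube; positivity

lemma dTruncCube_le (s : ℝ) : dTruncCube s ≤ 12 := by
  unfold dTruncCube; linarith [min_le_right (s ^ 2) 4]

lemma monotone_truncCube : Monotone truncCube :=
  monotone_of_hasDerivAt_nonneg hasDerivAt_truncCube fun s => dTruncCube_nonneg s

lemma truncCube_neg (s : ℝ) : truncCube (-s) = -truncCube s := by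
  have := intervalIntegral.integral_comp_neg (a := 0) (b := s) dTruncCube
  rw [neg_zero, intervalIntegral.integral_symm 0 (-s)] at this
  simp only [dTruncCube, neg_sq] at this
  simp only [truncCube, dTruncCube]
  linarith

@[simp] lemma truncCube_zero : truncCube 0 = 0 := by simp [truncCube]

lemma lipschitzWith_truncCube : LipschitzWith 12 truncCube :=
  lipschitzWith_of_nnnorm_deriv_le (fun s => (hasDerivAt_truncCube s).differentiableAt) fun s => by
    rw [(hasDerivAt_truncCube s).deriv, ← NNReal.coe_le_coe, coe_nnnorm, Real.norm_of_nonneg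
      (dTruncCube_nonneg s)]
    exact_mod_cast dTruncCube_le s

lemma truncCube_of_nonneg_le {s : ℝ} (h0 : 0 ≤ s) (h : s ≤ 2) : truncCube s = s ^ 3 := by
  have : truncCube s = ∫ t in (0 : ℝ)..s, 3 * t ^ 2 := by
    refine intervalIntegral.integral_congr fun t ht => ?_
    rw [Set.uIcc_of_le h0] at ht
    simp only [dTruncCube]
    rw [min_eq_left (by nlinarith [ht.1, ht.2])]
  rw [this, intervalIntegral.integral_const_mul, integral_pow]
  norm_num
  ring

lemma truncCube_of_abs_le {s : ℝ} (h : |s| ≤ 2) : truncCube s = s ^ 3 := by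
  rcases le_total 0 s with h0 | h0
  · exact truncCube_of_nonneg_le h0 (abs_le.1 h).2
  · rw [← neg_neg s, truncCube_neg, truncCube_of_nonneg_le (by linarith)
      (by linarith [(abs_le.1 h).1])]
    ring

lemma truncCube_of_two_le {s : ℝ} (h : 2 ≤ s) : truncCube s = 12 * s - 16 := by
  have h1 := intervalIntegral.integral_add_adjacent_intervals
    (continuous_dTruncCube.intervalIntegrable (μ := MeasureTheory.volume) 0 2)
    (continuous_dTruncCube.intervalIntegrable 2 s)
  have h2 : ∫ t in (2 : ℝ)..s, dTruncCube t = ∫ t in (2 : ℝ)..s, (12 : ℝ) := by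
    refine intervalIntegral.integral_congr fun t ht => ?_
    rw [Set.uIcc_of_le h] at ht
    simp only [dTruncCube]
    rw [min_eq_right (by nlinarith [ht.1, ht.2])]
    norm_num
  have h3 : truncCube 2 = 8 := by
    rw [truncCube_of_nonneg_le (by norm_num) le_rfl]; norm_num
  unfold truncCube at h3 ⊢
  rw [← h1, h3, h2, intervalIntegral.integral_const, smul_eq_mul]
  ring

/-- `truncCube s / s` is strictly increasing on the positive half-line. -/
lemma truncCube_mul_lt {p u : ℝ} (hp : 0 < p) (hpu : p < u) :
    truncCube p * u < truncCube u * p := by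
  rcases le_total u 2 with hu | hu
  · rw [truncCube_of_nonneg_le hp.le (hpu.le.trans hu), truncCube_of_nonneg_le (hp.trans hpu).le hu]
    have : 0 < p * u * ((u - p) * (u + p)) := by
      have := hp.trans hpu
      have : 0 < u - p := by linarith
      positivity
    nlinarith
  · rw [truncCube_of_two_le hu]
    rcases le_total p 2 with hp2 | hp2
    · rw [truncCube_of_nonneg_le hp.le hp2]
      have h1 : p ^ 2 * u ≤ 4 * u := mul_le_mul_of_nonneg_right (by nlinarith) (by linarith)
      rcases eq_or_lt_of_le hu with rfl | hu'
      · have : p ^ 2 < 4 := by nlinarith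
        nlinarith
      · nlinarith
    · rw [truncCube_of_two_le hp2]
      linarith

lemma truncCube_lt_dTruncCube_mul {p : ℝ} (hp : 0 < p) : truncCube p < dTruncCube p * p := by
  unfold dTruncCube
  rcases le_total p 2 with hp2 | hp2
  · rw [truncCube_of_nonneg_le hp.le hp2, min_eq_left (by nlinarith)]
    nlinarith [pow_pos hp 3]
  · rw [truncCube_of_two_le hp2, min_eq_right (by nlinarith)]
    linarith

lemma two_mul_le_truncCube {s : ℝ} (hs : 3 / 2 < s) : 2 * s ≤ truncCube s := by
  have := truncCube_mul_lt (by norm_num) hs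
  rw [truncCube_of_nonneg_le (by norm_num) (by norm_num)] at this
  linarith

lemma two_mul_truncCube_le {e : ℝ} (he : 0 ≤ e) (o : ℝ) :
    2 * truncCube e ≤ truncCube (e + o) + truncCube (e - o) := by
  wlog ho : 0 ≤ o generalizing o
  · have := this (-o) (by linarith)
    rw [sub_neg_eq_add, ← sub_eq_add_neg] at this
    linarith
  have hd : ∀ s, HasDerivAt (fun s => truncCube (e + s) + truncCube (e - s))
      (dTruncCube (e + s) - dTruncCube (e - s)) s := fun s => by
    have h1 := (hasDerivAt_truncCube (e + s)).comp s ((hasDerivAt_id s).const_add e)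
    have h2 := (hasDerivAt_truncCube (e - s)).comp s ((hasDerivAt_id s).const_sub e)
    convert! h1.add h2 using 1
    ring
  have hm : MonotoneOn (fun s => truncCube (e + s) + truncCube (e - s)) (Set.Ici 0) := by
    refine monotoneOn_of_deriv_nonneg (convex_Ici 0)
      (fun s _ => (hd s).continuousAt.continuousWithinAt)
      (fun s _ => (hd s).differentiableAt.differentiableWithinAt) fun s hs => ?_
    rw [interior_Ici] at hs
    have hs : 0 < s := hs
    rw [(hd s).deriv, sub_nonneg]
    unfold dTruncCube
    gcongr 3 * min ?_ 4
    nlinarith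
  have := hm (Set.mem_Ici.2 le_rfl) (Set.mem_Ici.2 ho) ho
  simp only [add_zero, sub_zero] at this
  linarith

lemma abs_dTruncCube_sub_le (s t : ℝ) : |dTruncCube s - dTruncCube t| ≤ 12 * |s - t| := by
  have key : ∀ s, dTruncCube s = 3 * (min |s| 2) ^ 2 := fun s => by
    unfold dTruncCube
    rcases le_total |s| 2 with h | h
    · rw [min_eq_left h, sq_abs, min_eq_left (by nlinarith [sq_abs s, abs_nonneg s])]
    · rw [min_eq_right h, min_eq_right (by nlinarith [sq_abs s, abs_nonneg s])]
      norm_num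
  have h1 : |min |s| 2 - min |t| 2| ≤ |s - t| :=
    (abs_min_sub_min_le_max _ _ _ _).trans (by simpa using abs_abs_sub_abs_le s t)
  have h2 : |min |s| 2 + min |t| 2| ≤ 4 := by
    rw [abs_of_nonneg (by positivity)]
    linarith [min_le_right |s| 2, min_le_right |t| 2]
  rw [key, key, show 3 * (min |s| 2) ^ 2 - 3 * (min |t| 2) ^ 2 =
    3 * ((min |s| 2 - min |t| 2) * (min |s| 2 + min |t| 2)) by ring, abs_mul, abs_mul,
    abs_of_pos (show (0 : ℝ) < 3 by norm_num)]
  nlinarith [mul_le_mul h1 h2 (abs_nonneg _) (abs_nonneg _)]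

lemma abs_truncCube_sub_sub_le (p u : ℝ) :
    |truncCube u - truncCube p - dTruncCube p * (u - p)| ≤ 12 * |u - p| ^ 2 := by
  have := Convex.norm_image_sub_le_of_norm_hasDerivWithin_le (𝕜 := ℝ) (s := Set.uIcc p u)
    (f := fun s => truncCube s - dTruncCube p * s) (f' := fun s => dTruncCube s - dTruncCube p)
    (C := 12 * |u - p|) (x := p) (y := u)
    (fun s _ => ((hasDerivAt_truncCube s).sub
      (by simpa using (hasDerivAt_id s).const_mul (dTruncCube p))).hasDerivWithinAt)
    (fun s hs => (abs_dTruncCube_sub_le s p).trans (by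
      gcongr 12 * ?_
      exact Set.abs_sub_left_of_mem_uIcc hs))
    (convex_uIcc p u) Set.left_mem_uIcc Set.right_mem_uIcc
  simp only [Real.norm_eq_abs] at this
  calc _ = |truncCube u - dTruncCube p * u - (truncCube p - dTruncCube p * p)| := by ring_nf
    _ ≤ _ := this
    _ = _ := by ring

/-- Sturm-type comparison: if the Wronskian `f' ψ - f ψ'` is nonnegative at `0` and nondecreasing
as long as `f > ψ > 0`, then `f > ψ` persists and the Wronskian is nondecreasing. -/
lemma sturm_comparison {f f' f'' ψ ψ' ψ'' : ℝ → ℝ} {T : ℝ}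
    (hf : ∀ t, HasDerivAt f (f' t) t) (hf' : ∀ t, HasDerivAt f' (f'' t) t)
    (hψ : ∀ t, HasDerivAt ψ (ψ' t) t) (hψ' : ∀ t, HasDerivAt ψ' (ψ'' t) t)
    (hpos : ∀ t ∈ Set.Ioo 0 T, 0 < ψ t) (hW0 : 0 ≤ f' 0 * ψ 0 - f 0 * ψ' 0)
    (hinit : ∃ δ > 0, ∀ t ∈ Set.Ioo 0 δ, ψ t < f t)
    (hyp : ∀ t ∈ Set.Ioo 0 T, ψ t < f t → f t * ψ'' t ≤ f'' t * ψ t) :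
    (∀ t ∈ Set.Ioo 0 T, ψ t < f t) ∧
      MonotoneOn (fun t => f' t * ψ t - f t * ψ' t) (Set.Icc 0 T) := by
  have hfc : Continuous f := continuous_iff_continuousAt.2 fun t => (hf t).continuousAt
  have hψc : Continuous ψ := continuous_iff_continuousAt.2 fun t => (hψ t).continuousAt
  have hWd : ∀ t, HasDerivAt (fun t => f' t * ψ t - f t * ψ' t) (f'' t * ψ t - f t * ψ'' t) t :=
    fun t => by
      convert! ((hf' t).mul (hψ t)).sub ((hf t).mul (hψ' t)) using 1
      ring
  have hmono : ∀ s ≤ T, (∀ t ∈ Set.Ioo 0 s, ψ t < f t) →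
      MonotoneOn (fun t => f' t * ψ t - f t * ψ' t) (Set.Icc 0 s) := fun s hs h => by
    refine monotoneOn_of_deriv_nonneg (convex_Icc 0 s)
      (fun t _ => (hWd t).continuousAt.continuousWithinAt)
      (fun t _ => (hWd t).differentiableAt.differentiableWithinAt) fun t ht => ?_
    rw [interior_Icc] at ht
    rw [(hWd t).deriv, sub_nonneg]
    exact hyp t ⟨ht.1, ht.2.trans_le hs⟩ (h t ht)
  suffices H : ∀ t ∈ Set.Ioo 0 T, ψ t < f t from ⟨H, hmono T le_rfl H⟩
  by_contra! hcon
  obtain ⟨t₁, ht₁, hle⟩ := hcon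
  obtain ⟨δ, hδ, hδf⟩ := hinit
  set t₀ := min δ t₁ / 2 with ht₀
  have hmin : 0 < min δ t₁ := lt_min hδ ht₁.1
  have ht₀δ : t₀ < δ := by linarith [min_le_left δ t₁]
  have ht₀t₁ : t₀ < t₁ := by linarith [min_le_right δ t₁]
  have ht₀0 : 0 < t₀ := by linarith
  have hcpt : IsCompact (Set.Icc t₀ t₁ ∩ {t | f t ≤ ψ t}) :=
    isCompact_Icc.inter_right (isClosed_le hfc hψc)
  obtain ⟨z, ⟨hz, hzle⟩, hzmin⟩ := hcpt.exists_isLeast ⟨t₁, ⟨ht₀t₁.le, le_rfl⟩, hle⟩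
  have hzle : f z ≤ ψ z := hzle
  have hzT : z < T := hz.2.trans_lt ht₁.2
  have hlt : ∀ t ∈ Set.Ioo 0 z, ψ t < f t := fun t ht => by
    rcases lt_or_ge t δ with h | h
    · exact hδf t ⟨ht.1, h⟩
    · by_contra! hc
      exact absurd (hzmin ⟨⟨(ht₀δ.trans_le h).le, ht.2.le.trans hz.2⟩, hc⟩) (not_le.2 ht.2)
  have hf0 : ψ t₀ < f t₀ := hδf _ ⟨ht₀0, ht₀δ⟩
  have hWm := hmono z hzT.le hlt
  have hdiv : MonotoneOn (fun t => f t / ψ t) (Set.Icc t₀ z) := by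
    have hpos' : ∀ t ∈ Set.Icc t₀ z, 0 < ψ t := fun t ht =>
      hpos t ⟨ht₀0.trans_le ht.1, ht.2.trans_lt hzT⟩
    refine monotoneOn_of_deriv_nonneg (convex_Icc _ _)
      (hfc.continuousOn.div hψc.continuousOn fun t ht => (hpos' t ht).ne')
      (fun t ht => ?_) fun t ht => ?_
    · rw [interior_Icc] at ht
      exact ((hf t).div (hψ t)
        (hpos' t ⟨ht.1.le, ht.2.le⟩).ne').differentiableAt.differentiableWithinAt
    · rw [interior_Icc] at ht
      have hd : HasDerivAt (fun t => f t / ψ t) _ t :=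
        (hf t).div (hψ t) (hpos' t ⟨ht.1.le, ht.2.le⟩).ne'
      rw [hd.deriv]
      refine div_nonneg ?_ (sq_nonneg _)
      exact hW0.trans (hWm ⟨le_rfl, (ht₀0.trans_le hz.1).le⟩
        ⟨(ht₀0.trans ht.1).le, ht.2.le⟩ (ht₀0.trans ht.1).le)
  have h1 := hdiv ⟨le_rfl, hz.1⟩ ⟨hz.1, le_rfl⟩ hz.1
  have h2 : 1 < f t₀ / ψ t₀ := (one_lt_div (hpos _ ⟨ht₀0, ht₀t₁.trans ht₁.2⟩)).2 hf0
  have h3 : f z / ψ z ≤ 1 := (div_le_one (hpos _ ⟨ht₀0.trans_le hz.1, hzT⟩)).2 hzle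
  simp only at h1
  linarith

/-- Version of `sturm_comparison` for initial values satisfying `ψ 0 < f 0`. -/
lemma sturm_comparison_of_lt {f f' f'' ψ ψ' ψ'' : ℝ → ℝ} {T : ℝ} (hT : 0 < T)
    (hf : ∀ t, HasDerivAt f (f' t) t) (hf' : ∀ t, HasDerivAt f' (f'' t) t)
    (hψ : ∀ t, HasDerivAt ψ (ψ' t) t) (hψ' : ∀ t, HasDerivAt ψ' (ψ'' t) t)
    (hpos : ∀ t ∈ Set.Ioo 0 T, 0 < ψ t) (hW0 : 0 ≤ f' 0 * ψ 0 - f 0 * ψ' 0)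
    (hlt : ψ 0 < f 0)
    (hyp : ∀ t ∈ Set.Ioo 0 T, ψ t < f t → f t * ψ'' t ≤ f'' t * ψ t) :
    ψ T ≤ f T ∧ MonotoneOn (fun t => f' t * ψ t - f t * ψ' t) (Set.Icc 0 T) := by
  have hfc : Continuous f := continuous_iff_continuousAt.2 fun t => (hf t).continuousAt
  have hψc : Continuous ψ := continuous_iff_continuousAt.2 fun t => (hψ t).continuousAt
  have hinit : ∃ δ > 0, ∀ t ∈ Set.Ioo 0 δ, ψ t < f t := by
    obtain ⟨δ, hδ, h⟩ := Metric.eventually_nhds_iff.1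
      (hψc.continuousAt.eventually_lt hfc.continuousAt hlt)
    refine ⟨δ, hδ, fun t ht => h ?_⟩
    rw [Real.dist_eq, sub_zero, abs_of_pos ht.1]
    exact ht.2
  obtain ⟨h1, h2⟩ := sturm_comparison hf hf' hψ hψ' hpos hW0 hinit hyp
  refine ⟨?_, h2⟩
  have : T ∈ closure (Set.Ioo 0 T) := by
    rw [closure_Ioo hT.ne]
    exact ⟨hT.le, le_rfl⟩
  exact closure_minimal (fun t ht => (h1 t ht).le) (isClosed_le hψc hfc) this

/-- Strict version of `sturm_comparison_of_lt` when the comparison function vanishes at `T`. -/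
lemma sturm_comparison_pos {f f' f'' ψ ψ' ψ'' : ℝ → ℝ} {T : ℝ} (hT : 0 < T)
    (hf : ∀ t, HasDerivAt f (f' t) t) (hf' : ∀ t, HasDerivAt f' (f'' t) t)
    (hψ : ∀ t, HasDerivAt ψ (ψ' t) t) (hψ' : ∀ t, HasDerivAt ψ' (ψ'' t) t)
    (hpos : ∀ t ∈ Set.Ioo 0 T, 0 < ψ t) (hW0 : f' 0 * ψ 0 - f 0 * ψ' 0 = 0)
    (hlt : ψ 0 < f 0)
    (hyp : ∀ t ∈ Set.Ioo 0 T, ψ t < f t → f t * ψ'' t ≤ f'' t * ψ t)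
    (hstrict : f 0 * ψ'' 0 < f'' 0 * ψ 0) (hψT : ψ T = 0) : 0 < f T := by
  obtain ⟨h1, h2⟩ := sturm_comparison_of_lt hT hf hf' hψ hψ' hpos hW0.ge hlt hyp
  rw [hψT] at h1
  refine lt_of_le_of_ne h1 fun h0 => ?_
  have hz : ∀ t ∈ Set.Icc 0 T, f' t * ψ t - f t * ψ' t = 0 := fun t ht => by
    have ha := h2 ⟨le_rfl, hT.le⟩ ht ht.1
    have hb := h2 ht ⟨hT.le, le_rfl⟩ ht.2
    simp only [hψT, ← h0, hW0] at ha hb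
    linarith
  have hd : HasDerivAt (fun t => f' t * ψ t - f t * ψ' t) (f'' 0 * ψ 0 - f 0 * ψ'' 0) 0 := by
    convert! ((hf' 0).mul (hψ 0)).sub ((hf 0).mul (hψ' 0)) using 1
    ring
  have hd0 : HasDerivWithinAt (fun t => f' t * ψ t - f t * ψ' t) 0 (Set.Icc 0 T) 0 :=
    (hasDerivWithinAt_const (0 : ℝ) (Set.Icc 0 T) (0 : ℝ)).congr hz (hz 0 ⟨le_rfl, hT.le⟩)
  have := (uniqueDiffOn_Icc hT 0 ⟨le_rfl, hT.le⟩).eq_deriv _ hd.hasDerivWithinAt hd0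
  linarith

lemma sqrt_two_mul_pi_div_two_lt : √2 * (π / 2) < π := by
  have : √2 < 2 := by rw [Real.sqrt_lt' (by norm_num)]; norm_num
  nlinarith [pi_pos]

/-- Lower bound for a function with `f 0 = 0`, `f' 0 > 0` and `f'' ≥ -2 f`. -/
lemma sin_lower_bound {f f' f'' : ℝ → ℝ} (hf : ∀ t, HasDerivAt f (f' t) t)
    (hf' : ∀ t, HasDerivAt f' (f'' t) t) (h0 : f 0 = 0) (h1 : 0 < f' 0)
    (hyp : ∀ t ∈ Set.Ioo 0 (π / 2), 0 < f t → -2 * f t ≤ f'' t) {t : ℝ}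
    (ht : t ∈ Set.Ioc 0 (π / 2)) : f' 0 / (2 * √2) * sin (√2 * t) ≤ f t := by
  have h2 : (0 : ℝ) < √2 := by positivity
  have hsq : √2 * √2 = 2 := Real.mul_self_sqrt (by norm_num)
  set κ := f' 0 / (2 * √2) with hκ
  have hκ0 : 0 < κ := by positivity
  have hl : ∀ t, HasDerivAt (fun t => √2 * t) √2 t := fun t => by
    simpa using (hasDerivAt_id t).const_mul √2
  have hψ : ∀ t, HasDerivAt (fun t => κ * sin (√2 * t)) (κ * √2 * cos (√2 * t)) t := fun t => by
    convert! (hl t).sin.const_mul κ using 1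
    ring
  have hψ' : ∀ t, HasDerivAt (fun t => κ * √2 * cos (√2 * t)) (-2 * (κ * sin (√2 * t))) t :=
    fun t => by
      convert! (hl t).cos.const_mul (κ * √2) using 1
      linear_combination (-κ * sin (√2 * t)) * hsq.symm
  have hκ1 : κ * √2 < f' 0 := by
    rw [hκ]
    field_simp
    linarith
  have hpos : ∀ t ∈ Set.Ioo 0 (π / 2), 0 < κ * sin (√2 * t) := fun t ht => by
    refine mul_pos hκ0 (sin_pos_of_pos_of_lt_pi (mul_pos h2 ht.1) ?_)
    have := sqrt_two_mul_pi_div_two_lt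
    nlinarith [ht.2]
  have hinit : ∃ δ > 0, ∀ t ∈ Set.Ioo 0 δ, κ * sin (√2 * t) < f t := by
    have hd := (hf 0).sub (hψ 0)
    simp only [mul_zero, cos_zero, mul_one] at hd
    have := (hasDerivAt_iff_tendsto_slope.1 hd).eventually_const_lt
      (show (0 : ℝ) < f' 0 - κ * √2 by linarith)
    rw [eventually_nhdsWithin_iff] at this
    obtain ⟨δ, hδ, h⟩ := Metric.eventually_nhds_iff.1 this
    refine ⟨δ, hδ, fun t ht => ?_⟩
    have := h (y := t) (by rw [Real.dist_eq, sub_zero, abs_of_pos ht.1]; exact ht.2) ht.1.ne'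
    rw [slope_def_field] at this
    simp only [Pi.sub_apply, h0, mul_zero, sin_zero, sub_zero] at this
    rw [lt_div_iff₀ ht.1] at this
    linarith
  have := (sturm_comparison hf hf' hψ hψ' hpos (by simp [h0]) hinit fun t ht hlt => by
    nlinarith [hyp t ht ((hpos t ht).trans hlt), hpos t ht]).1
  have hcl : t ∈ closure (Set.Ioo 0 (π / 2)) := by
    rw [closure_Ioo (by positivity)]
    exact ⟨ht.1.le, ht.2⟩
  exact closure_minimal (fun t ht => (this t ht).le) (isClosed_le
    (continuous_iff_continuousAt.2 fun t => (hψ t).continuousAt)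
    (continuous_iff_continuousAt.2 fun t => (hf t).continuousAt)) hcl

lemma sin_lower_bound_pos {f f' f'' : ℝ → ℝ} (hf : ∀ t, HasDerivAt f (f' t) t)
    (hf' : ∀ t, HasDerivAt f' (f'' t) t) (h0 : f 0 = 0) (h1 : 0 < f' 0)
    (hyp : ∀ t ∈ Set.Ioo 0 (π / 2), 0 < f t → -2 * f t ≤ f'' t) {t : ℝ}
    (ht : t ∈ Set.Ioc 0 (π / 2)) : 0 < f t := by
  refine lt_of_lt_of_le ?_ (sin_lower_bound hf hf' h0 h1 hyp ht)
  have := sqrt_two_mul_pi_div_two_lt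
  have h2 : (0 : ℝ) < √2 := by positivity
  refine mul_pos (by positivity) (sin_pos_of_pos_of_lt_pi (mul_pos h2 ht.1) ?_)
  nlinarith [ht.2]

/-- Lower bound for a function with `f 0 > 0`, `f' 0 = 0` and `f'' ≥ -(1 - cos (2 * t)) f`. -/
lemma even_lower_bound {f f' f'' : ℝ → ℝ} (hf : ∀ t, HasDerivAt f (f' t) t)
    (hf' : ∀ t, HasDerivAt f' (f'' t) t) (h0 : 0 < f 0) (h1 : f' 0 = 0)
    (hyp : ∀ t ∈ Set.Ioo 0 (π / 2), 0 < f t → -(1 - cos (2 * t)) * f t ≤ f'' t) :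
    f 0 / 2 * (3 / 2 - π ^ 2 / 8) ≤ f (π / 2) := by
  set κ := f 0 / 2 with hκ
  have hκ0 : 0 < κ := by positivity
  have hl : ∀ t : ℝ, HasDerivAt (fun t : ℝ => 2 * t) 2 t := fun t => by
    simpa using (hasDerivAt_id t).const_mul (2 : ℝ)
  have hψ : ∀ t, HasDerivAt (fun t => κ * (1 - t ^ 2 / 2 + (1 - cos (2 * t)) / 4))
      (κ * (-t + sin (2 * t) / 2)) t := fun t => by
    convert! (((hasDerivAt_pow 2 t).div_const 2).const_sub 1).add
      (((hl t).cos.const_sub 1).div_const 4) |>.const_mul κ using 1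
    push_cast
    ring
  have hψ' : ∀ t, HasDerivAt (fun t => κ * (-t + sin (2 * t) / 2))
      (κ * (-(1 - cos (2 * t)))) t := fun t => by
    convert! ((hasDerivAt_id t).neg.add ((hl t).sin.div_const 2)).const_mul κ using 1
    ring
  have hanti : AntitoneOn (fun t => κ * (1 - t ^ 2 / 2 + (1 - cos (2 * t)) / 4))
      (Set.Icc 0 (π / 2)) := by
    refine antitoneOn_of_deriv_nonpos (convex_Icc _ _)
      (fun t _ => (hψ t).continuousAt.continuousWithinAt)
      (fun t _ => (hψ t).differentiableAt.differentiableWithinAt) fun t ht => ?_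
    rw [interior_Icc] at ht
    rw [(hψ t).deriv]
    have := sin_le (show 0 ≤ 2 * t by linarith [ht.1])
    exact mul_nonpos_of_nonneg_of_nonpos hκ0.le (by linarith)
  have hend : κ * (1 - (π / 2) ^ 2 / 2 + (1 - cos (2 * (π / 2))) / 4) =
      κ * (3 / 2 - π ^ 2 / 8) := by
    rw [show 2 * (π / 2) = π by ring, cos_pi]
    ring
  have hendpos : 0 < κ * (3 / 2 - π ^ 2 / 8) := by
    refine mul_pos hκ0 ?_
    nlinarith [pi_lt_d2, pi_pos]
  have hpi : (0 : ℝ) < π / 2 := by positivity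
  have hpos : ∀ t ∈ Set.Ioo 0 (π / 2), 0 < κ * (1 - t ^ 2 / 2 + (1 - cos (2 * t)) / 4) :=
    fun t ht => by
      have := hanti ⟨ht.1.le, ht.2.le⟩ ⟨hpi.le, le_rfl⟩ ht.2.le
      simp only [hend] at this
      exact hendpos.trans_le this
  have hle : ∀ t ∈ Set.Ioo 0 (π / 2), κ * (1 - t ^ 2 / 2 + (1 - cos (2 * t)) / 4) ≤ κ :=
    fun t ht => by
      have := hanti ⟨le_rfl, hpi.le⟩ ⟨ht.1.le, ht.2.le⟩ ht.1.le
      simpa using this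
  have := (sturm_comparison_of_lt hpi hf hf' hψ hψ' hpos (by simp [h1])
    (by simp [hκ]; linarith) fun t ht hlt => by
      have hft := (hpos t ht).trans hlt
      have hc : 0 ≤ 1 - cos (2 * t) := by linarith [cos_le_one (2 * t)]
      have h1 := mul_le_mul_of_nonneg_right (hyp t ht hft) (hpos t ht).le
      have h2 := mul_le_mul_of_nonneg_left (hle t ht) (mul_nonneg hc hft.le)
      nlinarith).1
  rwa [hend] at this

section Symmetry

variable {f f' f'' : ℝ → ℝ}

lemma hasDerivAt_comp_const_add (hf : ∀ t, HasDerivAt f (f' t) t) (c t : ℝ) :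
    HasDerivAt (fun t => f (c + t)) (f' (c + t)) t := by
  simpa using (hf (c + t)).comp_const_add c t

lemma hasDerivAt_comp_const_sub (hf : ∀ t, HasDerivAt f (f' t) t) (c t : ℝ) :
    HasDerivAt (fun t => f (c - t)) (-f' (c - t)) t := by
  simpa using (hf (c - t)).comp_const_sub c t

lemma hasDerivAt_even_part (hf : ∀ t, HasDerivAt f (f' t) t) (c t : ℝ) :
    HasDerivAt (fun t => (f (c + t) + f (c - t)) / 2) ((f' (c + t) - f' (c - t)) / 2) t :=
  ((hasDerivAt_comp_const_add hf c t).add (hasDerivAt_comp_const_sub hf c t)).div_const 2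

lemma hasDerivAt_odd_part (hf : ∀ t, HasDerivAt f (f' t) t) (c t : ℝ) :
    HasDerivAt (fun t => (f (c + t) - f (c - t)) / 2) ((f' (c + t) + f' (c - t)) / 2) t := by
  convert! ((hasDerivAt_comp_const_add hf c t).sub
    (hasDerivAt_comp_const_sub hf c t)).div_const 2 using 1
  ring

end Symmetry

namespace IsSol

variable {G : ℝ → ℝ → ℝ} {u v : ℝ → ℝ} {K : NNReal}

lemma neg (hG : ∀ x y, G x (-y) = -G x y) (h : IsSol G u v) :
    IsSol G (fun x => -u x) (fun x => -v x) :=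
  ⟨fun x => (h.hasDerivAt_fst x).neg, fun x => by rw [hG]; exact (h.hasDerivAt_snd x).neg⟩

lemma shift {s : ℝ} (hG : ∀ x y, G (s + x) y = G x y) (h : IsSol G u v) :
    IsSol G (fun x => u (s + x)) (fun x => v (s + x)) :=
  ⟨hasDerivAt_comp_const_add h.hasDerivAt_fst s, fun x => by
    rw [← hG x]; exact hasDerivAt_comp_const_add h.hasDerivAt_snd s x⟩

lemma reflect {c : ℝ} (hG : ∀ x y, G (c - x) y = G x y) (h : IsSol G u v) :
    IsSol G (fun x => u (c - x)) (fun x => -v (c - x)) :=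
  ⟨hasDerivAt_comp_const_sub h.hasDerivAt_fst c, fun x => by
    rw [← hG x]
    have := (hasDerivAt_comp_const_sub h.hasDerivAt_snd c x).neg
    rw [neg_neg] at this
    exact this⟩

lemma even_of_snd_eq_zero (hL : ∀ x, LipschitzWith K (G x)) {c : ℝ}
    (hG : ∀ x y, G (2 * c - x) y = G x y) (h : IsSol G u v) (hc : v c = 0) (x : ℝ) :
    u (2 * c - x) = u x := by
  have := (unique hL (h.reflect hG) h (c := c) (by ring_nf) (by
    rw [show 2 * c - c = c by ring, hc, neg_zero])).1
  exact congrFun this x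

lemma odd_of_fst_eq_zero (hL : ∀ x, LipschitzWith K (G x)) {c : ℝ}
    (hG : ∀ x y, G (2 * c - x) y = G x y) (hodd : ∀ x y, G x (-y) = -G x y) (h : IsSol G u v)
    (hc : u c = 0) (x : ℝ) : u (2 * c - x) = -u x := by
  have := (unique hL (h.reflect hG) (h.neg hodd) (c := c) (by
    rw [show 2 * c - c = c by ring, hc, neg_zero]) (by rw [show 2 * c - c = c by ring])).1
  exact congrFun this x

end IsSol

/-- The right-hand side of the Gross–Pitaevskii equation, with truncated nonlinearity. -/
noncomputable def gpField (x y : ℝ) : ℝ := -(1 + cos (2 * x)) * y + truncCube y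

/-- The right-hand side of the linearization of the truncated equation along `p`. -/
noncomputable def linField (p : ℝ → ℝ) (x y : ℝ) : ℝ :=
  (-(1 + cos (2 * x)) + dTruncCube (p x)) * y

lemma abs_one_add_cos_le (x : ℝ) : |1 + cos (2 * x)| ≤ 2 :=
  abs_le.2 ⟨by linarith [neg_one_le_cos (2 * x)], by linarith [cos_le_one (2 * x)]⟩

lemma lipschitzWith_gpField (x : ℝ) : LipschitzWith 14 (gpField x) := by
  refine LipschitzWith.of_dist_le_mul fun y z => ?_
  have h1 := lipschitzWith_truncCube.dist_le_mul y z
  rw [Real.dist_eq, Real.dist_eq] at *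
  have h2 : |(1 + cos (2 * x)) * (y - z)| ≤ 2 * |y - z| := by
    rw [abs_mul]
    exact mul_le_mul_of_nonneg_right (abs_one_add_cos_le x) (abs_nonneg _)
  calc |gpField x y - gpField x z|
      = |(truncCube y - truncCube z) - (1 + cos (2 * x)) * (y - z)| := by
        unfold gpField; ring_nf
    _ ≤ |truncCube y - truncCube z| + |(1 + cos (2 * x)) * (y - z)| := abs_sub _ _
    _ ≤ _ := by push_cast at h1 ⊢; linarith

lemma lipschitzWith_linField (p : ℝ → ℝ) (x : ℝ) : LipschitzWith 14 (linField p x) := by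
  refine LipschitzWith.of_dist_le_mul fun y z => ?_
  rw [Real.dist_eq, Real.dist_eq]
  unfold linField
  rw [← mul_sub, abs_mul]
  refine mul_le_mul_of_nonneg_right ?_ (abs_nonneg _)
  have := abs_le.1 (abs_one_add_cos_le x)
  have h1 := dTruncCube_nonneg (p x)
  have h2 := dTruncCube_le (p x)
  exact abs_le.2 ⟨by push_cast; linarith, by push_cast; linarith⟩

lemma gpField_neg (x y : ℝ) : gpField x (-y) = -gpField x y := by
  unfold gpField; rw [truncCube_neg]; ring

lemma cos_two_mul_add_nat_mul_pi (k : ℕ) (x : ℝ) : cos (2 * (k * π + x)) = cos (2 * x) := by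
  rw [← cos_add_nat_mul_two_pi (2 * x) k]; ring_nf

lemma cos_two_mul_nat_mul_pi_sub (k : ℕ) (x : ℝ) : cos (2 * (k * π - x)) = cos (2 * x) := by
  rw [sub_eq_add_neg, cos_two_mul_add_nat_mul_pi, mul_neg, cos_neg]

lemma gpField_add_nat_mul_pi (k : ℕ) (x y : ℝ) : gpField (k * π + x) y = gpField x y := by
  unfold gpField; rw [cos_two_mul_add_nat_mul_pi]

lemma gpField_nat_mul_pi_sub (k : ℕ) (x y : ℝ) : gpField (k * π - x) y = gpField x y := by
  unfold gpField; rw [cos_two_mul_nat_mul_pi_sub]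

lemma gpField_zero (x : ℝ) : gpField x 0 = 0 := by simp [gpField]

lemma isSol_gpField_zero : IsSol gpField (fun _ => 0) (fun _ => 0) :=
  ⟨fun x => hasDerivAt_const x 0, fun x => by
    rw [gpField_zero]; exact hasDerivAt_const x 0⟩

lemma gpField_nonneg (x : ℝ) {y : ℝ} (hy : 3 / 2 < y) : 0 ≤ gpField x y := by
  have h1 := two_mul_le_truncCube hy
  have h2 := cos_le_one (2 * x)
  simp only [gpField]
  nlinarith

/-- A function that is convex where it exceeds `3 / 2` stays large once it is large and
nondecreasing. -/
lemma ge_of_large {f f' f'' : ℝ → ℝ} (hf : ∀ t, HasDerivAt f (f' t) t)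
    (hf' : ∀ t, HasDerivAt f' (f'' t) t) (hyp : ∀ t, 3 / 2 < f t → 0 ≤ f'' t)
    (h0 : 3 / 2 < f 0) (hv : 0 ≤ f' 0) {x : ℝ} (hx : 0 < x) : 3 / 2 ≤ f x :=
  (sturm_comparison_of_lt hx hf hf' (fun t => hasDerivAt_const t (3 / 2 : ℝ))
    (fun t => hasDerivAt_const t (0 : ℝ)) (fun _ _ => by norm_num) (by simpa using by linarith) h0
    fun t _ hl => by linarith [hyp t hl]).1

namespace IsSol

variable {u v p q : ℝ → ℝ}

lemma le_add_of_pos (h : IsSol gpField u v) (hpos : 0 < u (π / 2)) :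
    (3 / 2 - π ^ 2 / 8) * u (π / 2) ≤ u 0 + u π := by
  have := even_lower_bound (hasDerivAt_even_part h.hasDerivAt_fst (π / 2))
    (hasDerivAt_odd_part h.hasDerivAt_snd (π / 2)) (by simpa using hpos) (by simp)
    fun t _ hpos => by
    have e1 : cos (2 * (π / 2 + t)) = -cos (2 * t) := by
      rw [← cos_add_pi]; ring_nf
    have e2 : cos (2 * (π / 2 - t)) = -cos (2 * t) := by
      rw [← cos_pi_sub]; ring_nf
    have hm := monotone_truncCube (show -u (π / 2 - t) ≤ u (π / 2 + t) by linarith)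
    rw [truncCube_neg] at hm
    simp only [gpField, e1, e2]
    linarith
  simp only [add_zero, sub_zero, add_halves, sub_self] at this
  linarith

lemma sub_le_of_snd_pos (h : IsSol gpField u v) (hpos : 0 < v 0) :
    sin (√2 * (π / 2)) / √2 * v 0 ≤ u (π / 2) - u (-(π / 2)) := by
  have := sin_lower_bound (hasDerivAt_odd_part h.hasDerivAt_fst 0)
    (hasDerivAt_even_part h.hasDerivAt_snd 0) (by simp) (by simpa using hpos) (fun t _ hpos => by
    have e2 : cos (2 * (0 - t)) = cos (2 * t) := by
      rw [← cos_neg]; ring_nf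
    have hm := monotone_truncCube (show u (0 - t) ≤ u (0 + t) by linarith)
    have := cos_le_one (2 * t)
    simp only [gpField, e2, zero_add] at hpos hm ⊢
    nlinarith) (t := π / 2) ⟨by positivity, le_rfl⟩
  simp only [add_zero, sub_zero, zero_add, zero_sub, add_self_div_two] at this
  have h2 : sin (√2 * (π / 2)) / √2 * v 0 = 2 * (v 0 / (2 * √2) * sin (√2 * (π / 2))) := by
    field_simp
  linarith

lemma pos_right_of_zero (h : IsSol gpField u v) {z : ℝ} (hz : u z = 0) (hv : 0 < v z) {t : ℝ}
    (ht : t ∈ Set.Ioc 0 (π / 2)) : 0 < u (z + t) :=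
  sin_lower_bound_pos (hasDerivAt_comp_const_add h.hasDerivAt_fst z)
    (hasDerivAt_comp_const_add h.hasDerivAt_snd z) (by simpa using hz) (by simpa using hv)
    (fun t _ hpos => by
      have hm := monotone_truncCube hpos.le
      rw [truncCube_zero] at hm
      have := cos_le_one (2 * (z + t))
      simp only [gpField]
      nlinarith) ht

lemma eq_zero (h : IsSol gpField u v) {z : ℝ} (hz : u z = 0) (hv : v z = 0) (x : ℝ) : u x = 0 :=
  congrFun (unique lipschitzWith_gpField h isSol_gpField_zero hz hv).1 x

/-- Zeros of solutions are more than `π / 2` apart. -/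
lemma pos_of_endpoints (h : IsSol gpField u v) (h0 : 0 < u 0) (h1 : 0 ≤ u (π / 2)) {t : ℝ}
    (ht : t ∈ Set.Ioo 0 (π / 2)) : 0 < u t := by
  by_contra! hle
  obtain ⟨z, hz, huz⟩ := intermediate_value_Icc' ht.1.le h.continuous_fst.continuousOn
    ⟨hle, h0.le⟩
  have hz0 : 0 < z := lt_of_le_of_ne hz.1 fun hz0 => by rw [← hz0] at huz; linarith
  rcases lt_trichotomy (v z) 0 with hv | hv | hv
  · have := (h.neg gpField_neg).pos_right_of_zero (z := z) (by simpa using huz) (by linarith)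
      (t := π / 2 - z) ⟨by linarith [hz.2, ht.2], by linarith⟩
    rw [show z + (π / 2 - z) = π / 2 by ring] at this
    linarith
  · exact h0.ne' (h.eq_zero huz hv 0)
  · have hr : IsSol gpField (fun x => -u (-x)) (fun x => - -v (-x)) := by
      have := (h.reflect (c := 0) (by simpa using gpField_nat_mul_pi_sub 0)).neg gpField_neg
      simpa using this
    have := hr.pos_right_of_zero (z := -z) (by simpa using huz) (by simpa using hv)
      (t := z) ⟨hz0, by linarith [hz.2, ht.2]⟩
    simp only [neg_add_cancel, neg_zero] at this
    linarith

/-- Comparison of a solution with a solution `p` that is even about `0` and vanishes at `π / 2`. -/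
lemma add_nonneg_of_lt (hp : IsSol gpField p q) (hp0 : 0 < p 0) (hq0 : q 0 = 0)
    (hp1 : p (π / 2) = 0) (h : IsSol gpField u v) (hlt : p 0 < u 0) :
    0 ≤ u (π / 2) + u (-(π / 2)) := by
  have hpos := fun t ht => hp.pos_of_endpoints hp0 hp1.ge (t := t) ht
  have := (sturm_comparison_of_lt (T := π / 2) (by positivity)
    (hasDerivAt_even_part h.hasDerivAt_fst 0)
    (hasDerivAt_odd_part h.hasDerivAt_snd 0)
    hp.hasDerivAt_fst hp.hasDerivAt_snd hpos (by simp [hq0]) (by simpa using hlt)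
    fun t ht hl => by
      have e2 : cos (2 * (0 - t)) = cos (2 * t) := by
        rw [← cos_neg]; ring_nf
      have hpt := hpos t ht
      have h1 := truncCube_mul_lt hpt hl
      have h2 := two_mul_truncCube_le (hpt.trans hl).le ((u (0 + t) - u (0 - t)) / 2)
      rw [show (u (0 + t) + u (0 - t)) / 2 + (u (0 + t) - u (0 - t)) / 2 = u (0 + t) by ring,
        show (u (0 + t) + u (0 - t)) / 2 - (u (0 + t) - u (0 - t)) / 2 = u (0 - t) by ring] at h2
      have h3 := mul_le_mul_of_nonneg_right h2 hpt.le
      simp only [gpField, e2]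
      rw [zero_add] at *
      linarith).1
  simp only [zero_add, zero_sub, hp1] at this
  linarith

lemma pos_of_lt (hp : IsSol gpField p q) (hp0 : 0 < p 0) (hq0 : q 0 = 0)
    (hp1 : p (π / 2) = 0) (h : IsSol gpField u v) (hv0 : v 0 = 0) (hlt : p 0 < u 0) :
    0 < u (π / 2) :=
  sturm_comparison_pos (T := π / 2) (by positivity) h.hasDerivAt_fst h.hasDerivAt_snd
    hp.hasDerivAt_fst hp.hasDerivAt_snd
    (fun t ht => hp.pos_of_endpoints hp0 hp1.ge ht) (by simp [hq0, hv0]) hlt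
    (fun t ht hl => by
      have := truncCube_mul_lt (hp.pos_of_endpoints hp0 hp1.ge ht) hl
      simp only [gpField]
      linarith)
    (by
      have := truncCube_mul_lt hp0 hlt
      simp only [gpField]
      linarith) hp1

/-- A solution with small initial amplitude vanishes before `π / 2`. -/
lemma nonpos_of_eq_half (h : IsSol gpField u v) (h0 : u 0 = 1 / 2) (hv : v 0 = 0) :
    u (π / 2) ≤ 0 := by
  by_contra! hpos
  have hp := fun t ht => h.pos_of_endpoints (by rw [h0]; norm_num) hpos.le (t := t) ht
  have hl : ∀ t : ℝ, HasDerivAt (fun t : ℝ => 3 * t) 3 t := fun t => by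
    simpa using (hasDerivAt_id t).const_mul (3 : ℝ)
  have hφ : ∀ t, HasDerivAt (fun t => cos t / 2 + cos (3 * t) / 34)
      (-sin t / 2 - 3 * sin (3 * t) / 34) t := fun t => by
    convert! ((hasDerivAt_cos t).div_const 2).add ((hl t).cos.div_const 34) using 1
    ring
  have hφ' : ∀ t, HasDerivAt (fun t => -sin t / 2 - 3 * sin (3 * t) / 34)
      (-cos t / 2 - 9 * cos (3 * t) / 34) t := fun t => by
    convert! ((hasDerivAt_sin t).neg.div_const 2).sub
      (((hl t).sin.const_mul 3).div_const 34) using 1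
    ring
  have := (sturm_comparison_of_lt (T := π / 2) (by positivity) hφ hφ' h.hasDerivAt_fst
    h.hasDerivAt_snd hp (by simp [hv]) (by rw [h0]; norm_num) fun t ht hl => by
      have hut := hp t ht
      have h1 := truncCube_mul_lt hut hl
      have hC : 0 < cos t := cos_pos_of_mem_Ioo ⟨by linarith [ht.1, pi_pos], ht.2⟩
      have hC1 := cos_le_one t
      rw [truncCube_of_nonneg_le (s := cos t / 2 + cos (3 * t) / 34) (hut.trans hl).le
        (by linarith [cos_le_one (3 * t)])] at h1
      have hkey : (cos t / 2 + cos (3 * t) / 34) ^ 3 ≤ -cos t / 2 - 9 * cos (3 * t) / 34 +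
          (1 + cos (2 * t)) * (cos t / 2 + cos (3 * t) / 34) := by
        rw [cos_three_mul, cos_two_mul]
        set C := cos t
        have e1 : C / 2 + (4 * C ^ 3 - 3 * C) / 34 = C * ((7 + 2 * C ^ 2) / 17) := by ring
        have hy : C ^ 2 ≤ 1 := by nlinarith
        have hb0 : 0 ≤ (7 + 2 * C ^ 2) / 17 := by positivity
        have hb : (7 + 2 * C ^ 2) / 17 ≤ 9 / 17 := by linarith
        have hb3 : ((7 + 2 * C ^ 2) / 17) ^ 3 ≤ (9 / 17) ^ 3 := by gcongr
        have h3 : C ^ 3 ≤ C := by nlinarith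
        have h4 : C ^ 3 * ((7 + 2 * C ^ 2) / 17) ^ 3 ≤ C * (9 / 17) ^ 3 := by gcongr
        rw [e1, mul_pow]
        have h5 : 0 ≤ C * (2 * C ^ 2 - 1) ^ 2 := by positivity
        nlinarith
      have h2 := mul_le_mul_of_nonneg_right hkey hut.le
      simp only [gpField]
      nlinarith).1
  rw [show 3 * (π / 2) = π / 2 + π by ring, cos_add_pi, cos_pi_div_two] at this
  norm_num at this
  linarith

end IsSol

/-- Shooting argument: if the first sign change of `c · α` happens at an index of different parity
at the two endpoints of an interval, then there is no sign change at all for some `α` in between. -/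
lemma exists_forall_pos_of_parity {c : ℕ → ℝ → ℝ} {a b : ℝ} (hab : a ≤ b)
    (hc : ∀ n, Continuous (c n))
    (hzero : ∀ α ∈ Set.Icc a b, ∀ n, (∀ m < n, 0 < c m α) → c n α = 0 →
      0 < c (n + 1) α ∧ c (n + 2) α < 0)
    (ha : ∃ n, n % 2 = 1 ∧ c n a ≤ 0 ∧ ∀ m < n, 0 < c m a)
    (hb : ∃ n, n % 2 = 0 ∧ c n b ≤ 0 ∧ ∀ m < n, 0 < c m b) :
    ∃ α ∈ Set.Icc a b, ∀ n, 0 < c n α := by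
  set F : ℕ → Set ℝ := fun r => {α | ∃ n, n % 2 = r ∧ c n α ≤ 0 ∧ ∀ m < n, 0 < c m α} with hF
  have hpos : ∀ n α, 0 < c n α → ∀ᶠ β in nhds α, 0 < c n β := fun n α h =>
    (hc n).continuousAt.eventually (lt_mem_nhds h)
  have hneg : ∀ n α, c n α < 0 → ∀ᶠ β in nhds α, c n β < 0 := fun n α h =>
    (hc n).continuousAt.eventually (gt_mem_nhds h)
  have hint : ∀ r, ∀ α ∈ Set.Icc a b, α ∈ F r → α ∈ interior (F r) := by
    rintro r α hα ⟨n, hn, hle, hlt⟩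
    rw [mem_interior_iff_mem_nhds]
    have hall : ∀ᶠ β in nhds α, ∀ m < n, 0 < c m β :=
      (eventually_all_finite (Set.finite_lt_nat n)).2 fun m hm => hpos m α (hlt m hm)
    rcases hle.lt_or_eq with h | h
    · filter_upwards [hall, hneg n α h] with β h1 h2 using ⟨n, hn, h2.le, h1⟩
    · obtain ⟨h3, h4⟩ := hzero α hα n hlt h
      filter_upwards [hall, hpos _ α h3, hneg _ α h4] with β h1 h5 h6
      rcases le_or_gt (c n β) 0 with h7 | h7
      · exact ⟨n, hn, h7, h1⟩
      · refine ⟨n + 2, by omega, h6.le, fun m hm => ?_⟩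
        obtain h8 | rfl | rfl : m < n ∨ m = n ∨ m = n + 1 := by omega
        exacts [h1 m h8, h7, h5]
  by_contra! hcon
  have hcover : Set.Icc a b ⊆ interior (F 1) ∪ interior (F 0) := by
    intro α hα
    classical
    have hex := hcon α hα
    have hmem : α ∈ F (Nat.find hex % 2) :=
      ⟨_, rfl, Nat.find_spec hex, fun m hm => not_le.1 (Nat.find_min hex hm)⟩
    rcases Nat.mod_two_eq_zero_or_one (Nat.find hex) with h | h <;> rw [h] at hmem
    · exact Or.inr (hint 0 α hα hmem)
    · exact Or.inl (hint 1 α hα hmem)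
  have hmema : a ∈ Set.Icc a b := Set.left_mem_Icc.2 hab
  have hmemb : b ∈ Set.Icc a b := Set.right_mem_Icc.2 hab
  obtain ⟨α, -, h1, h0⟩ := isPreconnected_Icc (interior (F 1)) (interior (F 0)) isOpen_interior
    isOpen_interior hcover ⟨a, hmema, hint 1 a hmema ha⟩ ⟨b, hmemb, hint 0 b hmemb hb⟩
  obtain ⟨n, hn, hle, hlt⟩ := interior_subset h1
  obtain ⟨m, hm, hle', hlt'⟩ := interior_subset h0
  rcases lt_trichotomy n m with h | h | h
  · exact (hlt' n h).not_ge hle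
  · omega
  · exact (hlt m h).not_ge hle'

lemma exists_neg_of_recurrence {β δ : ℕ → ℝ} {m c : ℝ} (hm : 0 < m) (hc : 0 < c) (h0 : 0 < β 0)
    (hβ : ∀ k, β (k + 1) - β k = m * δ (k + 1))
    (hδ : ∀ k, 0 ≤ β k → c * β k ≤ δ k - δ (k + 1)) : ∃ N, β N < 0 := by
  by_contra! hall
  have hanti : Antitone δ := antitone_nat_of_succ_le fun k => by
    have := hδ k (hall k)
    have := mul_nonneg hc.le (hall k)
    linarith
  by_cases hpos : ∀ k, 0 ≤ δ k
  · have hmono : Monotone β := monotone_nat_of_le_succ fun k => by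
      have := mul_nonneg hm.le (hpos (k + 1))
      linarith [hβ k]
    have hlin : ∀ k : ℕ, δ k ≤ δ 0 - k * (c * β 0) := fun k => by
      induction k with
      | zero => simp
      | succ k ih =>
        have h1 := hδ k (hall k)
        have h2 := mul_le_mul_of_nonneg_left (hmono (Nat.zero_le k)) hc.le
        push_cast
        linarith
    obtain ⟨n, hn⟩ := exists_nat_gt (δ 0 / (c * β 0))
    rw [div_lt_iff₀ (by positivity)] at hn
    linarith [hlin n, hpos n]
  · push Not at hpos
    obtain ⟨M, hM⟩ := hpos
    have hlin : ∀ k : ℕ, β (M + k) ≤ β M + k * (m * δ M) := fun k => by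
      induction k with
      | zero => simp
      | succ k ih =>
        have h1 := hβ (M + k)
        have h2 := mul_le_mul_of_nonneg_left (hanti (show M ≤ M + k + 1 by omega)) hm.le
        rw [← add_assoc]
        push_cast
        linarith
    have hneg : m * δ M < 0 := mul_neg_of_pos_of_neg hm hM
    obtain ⟨n, hn⟩ := exists_nat_gt (β M / -(m * δ M))
    rw [div_lt_iff₀ (by linarith)] at hn
    linarith [hlin n, hall (M + n)]

/-- The function `u`, translated by `k π` and multiplied by `(-1) ^ k`. -/
noncomputable def turn (k : ℕ) (u : ℝ → ℝ) (x : ℝ) : ℝ := (-1) ^ k * u (k * π + x)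

lemma turn_pi (k : ℕ) (u : ℝ → ℝ) : turn k u π = -turn (k + 1) u 0 := by
  simp only [turn, pow_succ]
  push_cast
  ring_nf

lemma turn_succ_neg (k : ℕ) (u : ℝ → ℝ) :
    turn (k + 1) u (-(π / 2)) = -turn k u (π / 2) := by
  simp only [turn, pow_succ]
  push_cast
  ring_nf

lemma turn_zero (u : ℝ → ℝ) : turn 0 u = u := by
  ext x; simp [turn]

lemma abs_turn (k : ℕ) (u : ℝ → ℝ) (x : ℝ) : |turn k u x| = |u (k * π + x)| := by
  rw [turn, abs_mul, abs_neg_one_pow, one_mul]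

namespace IsSol

variable {G : ℝ → ℝ → ℝ} {u v u₁ v₁ : ℝ → ℝ}

lemma turn {k : ℕ} (hG : ∀ x y, G (k * π + x) y = G x y) (hodd : ∀ x y, G x (-y) = -G x y)
    (h : IsSol G u v) : IsSol G (turn k u) (turn k v) := by
  have := h.shift hG
  unfold _root_.turn
  rcases neg_one_pow_eq_or ℝ k with hk | hk
  · simpa [hk] using this
  · simpa [hk] using this.neg hodd

lemma turn_gpField (h : IsSol gpField u v) (k : ℕ) :
    IsSol gpField (_root_.turn k u) (_root_.turn k v) :=
  h.turn (gpField_add_nat_mul_pi k) gpField_neg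

lemma gpField_dist_le (h : IsSol gpField u v) (h₁ : IsSol gpField u₁ v₁) {t : ℝ} (ht : 0 ≤ t) :
    |u t - u₁ t| ≤ max |u 0 - u₁ 0| |v 0 - v₁ 0| * exp (14 * t) ∧
      |v t - v₁ t| ≤ max |u 0 - u₁ 0| |v 0 - v₁ 0| * exp (14 * t) := by
  have := dist_le lipschitzWith_gpField h₁ h.hasDerivAt_fst h.hasDerivAt_snd (T := t) (η := 0)
    (fun s _ => by simp) (le_max_left _ |v 0 - v₁ 0|) (le_max_right _ _) ⟨ht, le_rfl⟩
  rw [gronwallBound_ε0, show ((max 1 14 : NNReal) : ℝ) = 14 by norm_num] at this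
  exact this

lemma c_mul_abs_snd_le (h : IsSol gpField u v) :
    sin (√2 * (π / 2)) / √2 * |v 0| ≤ |u (π / 2) - u (-(π / 2))| := by
  rcases lt_trichotomy (v 0) 0 with hv | hv | hv
  · have := (h.neg gpField_neg).sub_le_of_snd_pos (by linarith)
    rw [abs_of_neg hv]
    exact this.trans (by rw [← abs_neg]; exact le_trans (by linarith) (le_abs_self _))
  · simp [hv]
  · rw [abs_of_pos hv]
    exact (h.sub_le_of_snd_pos hv).trans (le_abs_self _)

end IsSol

lemma continuous_gpField_left (y : ℝ) : Continuous fun x => gpField x y := by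
  unfold gpField; fun_prop

lemma exists_flow (α : ℝ) : ∃ w : (ℝ → ℝ) × (ℝ → ℝ), IsSol gpField w.1 w.2 ∧ w.1 0 = α ∧
    w.2 0 = 0 := by
  obtain ⟨u, v, h⟩ := IsSol.exists_sol lipschitzWith_gpField continuous_gpField_left gpField_zero
    α 0
  exact ⟨(u, v), h⟩

/-- The solution of the truncated equation with initial value `α` and initial slope `0`. -/
noncomputable def flow (α : ℝ) : ℝ → ℝ := (exists_flow α).choose.1

/-- The derivative of `flow α`. -/
noncomputable def flowDeriv (α : ℝ) : ℝ → ℝ := (exists_flow α).choose.2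

lemma isSol_flow (α : ℝ) : IsSol gpField (flow α) (flowDeriv α) := (exists_flow α).choose_spec.1

@[simp] lemma flow_zero (α : ℝ) : flow α 0 = α := (exists_flow α).choose_spec.2.1

@[simp] lemma flowDeriv_zero (α : ℝ) : flowDeriv α 0 = 0 := (exists_flow α).choose_spec.2.2

lemma flow_neg (α x : ℝ) : flow α (-x) = flow α x := by
  simpa using (isSol_flow α).even_of_snd_eq_zero lipschitzWith_gpField (c := 0)
    (by simpa using gpField_nat_mul_pi_sub 0) (flowDeriv_zero α) x

lemma abs_flow_sub_le (α β : ℝ) {t : ℝ} (ht : 0 ≤ t) :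
    |flow α t - flow β t| ≤ |α - β| * exp (14 * t) := by
  simpa using ((isSol_flow α).gpField_dist_le (isSol_flow β) ht).1

lemma continuous_flow {t : ℝ} (ht : 0 ≤ t) : Continuous fun α => flow α t := by
  refine continuous_iff_continuousAt.2 fun β => ?_
  refine tendsto_iff_dist_tendsto_zero.2 (squeeze_zero (fun _ => dist_nonneg)
    (fun α => (Real.dist_eq _ _).trans_le (abs_flow_sub_le α β ht)) ?_)
  have : Continuous fun α => |α - β| * exp (14 * t) := by fun_prop
  simpa using this.tendsto β

/-- The values of `u` at the multiples of `π / 2`, with signs in the pattern `+ + - -`. -/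
noncomputable def quarter (n : ℕ) (u : ℝ → ℝ) : ℝ := (-1) ^ (n / 2) * u (n * (π / 2))

lemma quarter_two_mul (k : ℕ) (u : ℝ → ℝ) : quarter (2 * k) u = turn k u 0 := by
  rw [quarter, turn, Nat.mul_div_cancel_left k (by norm_num)]
  push_cast
  ring_nf

lemma quarter_two_mul_add_one (k : ℕ) (u : ℝ → ℝ) :
    quarter (2 * k + 1) u = turn k u (π / 2) := by
  rw [quarter, turn, show (2 * k + 1) / 2 = k by omega]
  push_cast
  ring_nf

lemma quarter_add_two (n : ℕ) (u : ℝ → ℝ) :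
    quarter (n + 2) u = -((-1) ^ (n / 2) * u (n * (π / 2) + π)) := by
  rw [quarter, show (n + 2) / 2 = n / 2 + 1 by omega, pow_succ]
  push_cast
  ring_nf

lemma gpField_quarter_sub (n : ℕ) (x y : ℝ) :
    gpField (2 * (n * (π / 2)) - x) y = gpField x y := by
  rw [show 2 * (n * (π / 2)) = n * π by ring, gpField_nat_mul_pi_sub]

lemma IsSol.quarter_of_eq_zero {u v : ℝ → ℝ} (h : IsSol gpField u v) {n : ℕ}
    (hn : quarter (n + 2) u = 0) :
    quarter (n + 3) u = quarter (n + 1) u ∧ quarter (n + 4) u = -quarter n u := by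
  have hu : u ((n + 2 : ℕ) * (π / 2)) = 0 := by simpa [quarter] using hn
  have hodd := h.odd_of_fst_eq_zero lipschitzWith_gpField (gpField_quarter_sub (n + 2))
    gpField_neg hu
  have h1 := hodd ((n + 1 : ℕ) * (π / 2))
  have h2 := hodd (n * (π / 2))
  push_cast at h1 h2
  constructor
  · rw [quarter_add_two, quarter]
    push_cast
    rw [show ((n : ℝ) + 1) * (π / 2) + π = 2 * ((n + 2) * (π / 2)) - (n + 1) * (π / 2) by ring, h1]
    ring
  · rw [quarter_add_two, quarter, show (n + 2) / 2 = n / 2 + 1 by omega, pow_succ]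
    push_cast
    rw [show ((n : ℝ) + 2) * (π / 2) + π = 2 * ((n + 2) * (π / 2)) - n * (π / 2) by ring, h2]
    ring

lemma continuous_quarter_flow (n : ℕ) : Continuous fun α => quarter n (flow α) :=
  (continuous_flow (by positivity)).const_mul _

lemma three_halves_sub_pos : 0 < 3 / 2 - π ^ 2 / 8 := by
  nlinarith [pi_lt_d2, pi_pos]

lemma sin_sqrt_two_div_pos : 0 < sin (√2 * (π / 2)) / √2 :=
  div_pos (sin_pos_of_pos_of_lt_pi (by positivity) sqrt_two_mul_pi_div_two_lt) (by positivity)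

namespace IsSol

variable {u v : ℝ → ℝ}

lemma turn_sub_turn_succ (h : IsSol gpField u v) {k : ℕ} (hk : 0 < _root_.turn k u (π / 2)) :
    (3 / 2 - π ^ 2 / 8) * _root_.turn k u (π / 2) ≤
      _root_.turn k u 0 - _root_.turn (k + 1) u 0 := by
  have := (h.turn_gpField k).le_add_of_pos hk
  rw [turn_pi] at this
  linarith

/-- A solution whose values at the multiples of `π / 2` follow the sign pattern `+ + - -` decays
along the multiples of `π`. -/
lemma tendsto_turn_zero (h : IsSol gpField u v) (hA : ∀ k, 0 < _root_.turn k u 0)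
    (hb : ∀ k, 0 < _root_.turn k u (π / 2)) :
    Tendsto (fun k => _root_.turn k u 0) atTop (nhds 0) ∧
      Tendsto (fun k => _root_.turn k v 0) atTop (nhds 0) := by
  have hdec : ∀ k, _root_.turn (k + 1) u 0 < _root_.turn k u 0 := fun k => by
    have := h.turn_sub_turn_succ (hb k)
    have := mul_pos three_halves_sub_pos (hb k)
    linarith
  have hanti : StrictAnti fun k => _root_.turn k u 0 := strictAnti_nat_of_succ_lt hdec
  have hbdd : BddBelow (Set.range fun k => _root_.turn k u 0) :=
    ⟨0, by rintro _ ⟨k, rfl⟩; exact (hA k).le⟩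
  obtain ⟨L, hL⟩ : ∃ L, Tendsto (fun k => _root_.turn k u 0) atTop (nhds L) :=
    ⟨_, tendsto_atTop_ciInf hanti.antitone hbdd⟩
  have hL0 : 0 ≤ L := ge_of_tendsto' hL fun k => (hA k).le
  have hlt : ∀ k, L < _root_.turn k u 0 := fun k =>
    (hanti.antitone.le_of_tendsto hL (k + 1)).trans_lt (hdec k)
  have hb0 : Tendsto (fun k => _root_.turn k u (π / 2)) atTop (nhds 0) := by
    have h1 : Tendsto (fun k => (_root_.turn k u 0 - _root_.turn (k + 1) u 0) /
        (3 / 2 - π ^ 2 / 8)) atTop (nhds 0) := by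
      simpa using (hL.sub (hL.comp (tendsto_add_atTop_nat 1))).div_const (3 / 2 - π ^ 2 / 8)
    refine squeeze_zero (fun k => (hb k).le) (fun k => ?_) h1
    rw [le_div_iff₀ three_halves_sub_pos, mul_comm]
    exact h.turn_sub_turn_succ (hb k)
  have hB0 : Tendsto (fun k => _root_.turn k v 0) atTop (nhds 0) := by
    rw [← tendsto_add_atTop_iff_nat 1]
    have h1 : Tendsto (fun k => |_root_.turn (k + 1) u (π / 2) + _root_.turn k u (π / 2)| /
        (sin (√2 * (π / 2)) / √2)) atTop (nhds 0) := by
      simpa using (((hb0.comp (tendsto_add_atTop_nat 1)).add hb0).abs).div_const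
        (sin (√2 * (π / 2)) / √2)
    refine squeeze_zero_norm (fun k => ?_) h1
    have h2 := (h.turn_gpField (k + 1)).c_mul_abs_snd_le
    rw [turn_succ_neg, sub_neg_eq_add] at h2
    rw [le_div_iff₀ sin_sqrt_two_div_pos, mul_comm]
    exact h2
  obtain rfl | hLpos := hL0.eq_or_lt
  · exact ⟨hL, hB0⟩
  exfalso
  have hp : flow L (π / 2) = 0 := by
    have h1 : Tendsto (fun k => max |_root_.turn k u 0 - L| |_root_.turn k v 0| *
        exp (14 * (π / 2))) atTop (nhds 0) := by
      simpa using (((hL.sub_const L).abs).max hB0.abs).mul_const (exp (14 * (π / 2)))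
    have h2 : Tendsto (fun k => _root_.turn k u (π / 2)) atTop (nhds (flow L (π / 2))) := by
      rw [tendsto_iff_dist_tendsto_zero]
      refine squeeze_zero (fun _ => dist_nonneg) (fun k => ?_) h1
      simpa [Real.dist_eq] using
        ((h.turn_gpField k).gpField_dist_le (isSol_flow L) (t := π / 2) (by positivity)).1
    exact tendsto_nhds_unique h2 hb0
  have hmono : Monotone fun k => _root_.turn k u (π / 2) := monotone_nat_of_le_succ fun k => by
    have := (isSol_flow L).add_nonneg_of_lt (by simpa) (flowDeriv_zero L) hp
      (h.turn_gpField (k + 1)) (by simpa using hlt (k + 1))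
    rw [turn_succ_neg] at this
    linarith
  linarith [ge_of_tendsto' hb0 fun k => hmono (Nat.zero_le k), hb 0]

lemma tendsto_atTop_of_turn (h : IsSol gpField u v)
    (hu : Tendsto (fun k => _root_.turn k u 0) atTop (nhds 0))
    (hv : Tendsto (fun k => _root_.turn k v 0) atTop (nhds 0)) :
    Tendsto (fun x => (u x, v x)) atTop (nhds (0, 0)) := by
  have hlim : Tendsto (fun x => max |_root_.turn ⌊x / π⌋₊ u 0| |_root_.turn ⌊x / π⌋₊ v 0| *
      exp (14 * π)) atTop (nhds 0) := by
    have := ((hu.abs.max hv.abs).mul_const (exp (14 * π))).comp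
      (tendsto_nat_floor_atTop.comp (tendsto_id.atTop_div_const pi_pos))
    rw [abs_zero, max_self, zero_mul] at this
    exact this
  have hbound : ∀ x : ℝ, 0 ≤ x →
      |u x| ≤ max |_root_.turn ⌊x / π⌋₊ u 0| |_root_.turn ⌊x / π⌋₊ v 0| * exp (14 * π) ∧
      |v x| ≤ max |_root_.turn ⌊x / π⌋₊ u 0| |_root_.turn ⌊x / π⌋₊ v 0| * exp (14 * π) := by
    intro x hx
    set k := ⌊x / π⌋₊
    have h1 : k * π ≤ x := (le_div_iff₀ pi_pos).1 (Nat.floor_le (by positivity))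
    have h2 : x < (k + 1) * π := (div_lt_iff₀ pi_pos).1 (Nat.lt_floor_add_one _)
    have h3 := (h.turn_gpField k).gpField_dist_le isSol_gpField_zero (t := x - k * π)
      (by linarith)
    simp only [sub_zero, abs_turn, add_sub_cancel] at h3 ⊢
    have h4 : exp (14 * (x - k * π)) ≤ exp (14 * π) := by
      gcongr; linarith
    have h5 := mul_le_mul_of_nonneg_left h4
      (le_max_of_le_left (b := |u (k * π + 0)|) (c := |v (k * π + 0)|) (abs_nonneg _))
    exact ⟨h3.1.trans h5, h3.2.trans h5⟩
  refine Tendsto.prodMk_nhds ?_ ?_ <;> refine squeeze_zero_norm' ?_ hlim <;>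
    filter_upwards [eventually_ge_atTop 0] with x hx
  exacts [(hbound x hx).1, (hbound x hx).2]

lemma abs_le_three_halves (h : IsSol gpField u v) (htop : Tendsto u atTop (nhds 0))
    (hbot : Tendsto u atBot (nhds 0)) (x : ℝ) : |u x| ≤ 3 / 2 := by
  have key : ∀ {u v : ℝ → ℝ}, IsSol gpField u v → Tendsto u atTop (nhds 0) →
      Tendsto u atBot (nhds 0) → u x ≤ 3 / 2 := by
    intro u v h htop hbot
    by_contra! hlt
    rcases le_total 0 (v x) with hv | hv
    · obtain ⟨t, h1, h2⟩ := (((htop.comp (tendsto_atTop_add_const_left atTop x tendsto_id)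
        ).eventually (gt_mem_nhds (show (0 : ℝ) < 3 / 2 by norm_num))).and
        (eventually_gt_atTop 0)).exists
      exact h1.not_ge (ge_of_large (hasDerivAt_comp_const_add h.hasDerivAt_fst x)
        (hasDerivAt_comp_const_add h.hasDerivAt_snd x) (fun t ht => gpField_nonneg _ ht)
        (by simpa using hlt) (by simpa using hv) h2)
    · obtain ⟨t, h1, h2⟩ := (((hbot.comp (tendsto_atBot_add_const_left atTop x
        tendsto_neg_atTop_atBot)).eventually (gt_mem_nhds (show (0 : ℝ) < 3 / 2 by norm_num))).and
        (eventually_gt_atTop 0)).exists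
      rw [Function.comp_apply, ← sub_eq_add_neg] at h1
      refine h1.not_ge (ge_of_large (hasDerivAt_comp_const_sub h.hasDerivAt_fst x)
        (fun t => ?_) (f'' := fun t => gpField (x - t) (u (x - t)))
        (fun t ht => gpField_nonneg _ ht) (by simpa using hlt) (by simpa using hv) h2)
      have := (hasDerivAt_comp_const_sub h.hasDerivAt_snd x t).neg
      rw [neg_neg] at this
      exact this
  refine abs_le.2 ⟨?_, key h htop hbot⟩
  have := key (h.neg gpField_neg) (by simpa using htop.neg) (by simpa using hbot.neg)
  linarith

end IsSol

lemma dTruncCube_neg (s : ℝ) : dTruncCube (-s) = dTruncCube s := by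
  simp [dTruncCube]

lemma linField_neg (p : ℝ → ℝ) (x y : ℝ) : linField p x (-y) = -linField p x y := by
  unfold linField; ring

lemma IsSol.lin_combination {p u v u₁ v₁ : ℝ → ℝ} (h : IsSol (linField p) u v)
    (h₁ : IsSol (linField p) u₁ v₁) (a b : ℝ) :
    IsSol (linField p) (fun x => a * u x + b * u₁ x) (fun x => a * v x + b * v₁ x) :=
  ⟨fun x => ((h.hasDerivAt_fst x).const_mul a).add ((h₁.hasDerivAt_fst x).const_mul b), fun x => by
    convert! ((h.hasDerivAt_snd x).const_mul a).add ((h₁.hasDerivAt_snd x).const_mul b) using 1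
    unfold linField; ring⟩

section Linearization

variable {p q w w' : ℝ → ℝ}

lemma linField_add_nat_mul_pi (hpi : ∀ x, p (x + π) = -p x) (k : ℕ) (x y : ℝ) :
    linField p (k * π + x) y = linField p x y := by
  have : dTruncCube (p (k * π + x)) = dTruncCube (p x) := by
    induction k with
    | zero => simp
    | succ k ih =>
      rw [show ((k + 1 : ℕ) : ℝ) * π + x = k * π + x + π by push_cast; ring, hpi, dTruncCube_neg,
        ih]
  rw [linField, linField, this, cos_two_mul_add_nat_mul_pi]

lemma linField_nat_mul_pi_sub (heven : ∀ x, p (-x) = p x) (hpi : ∀ x, p (x + π) = -p x) (k : ℕ)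
    (x y : ℝ) : linField p (k * π - x) y = linField p x y := by
  rw [sub_eq_add_neg, linField_add_nat_mul_pi hpi, linField, linField, heven, mul_neg, cos_neg]

/-- The linearization along a solution that is even about `0` and odd about `π / 2` is unstable:
its solution `w` with `w 0 = 1`, `w' 0 = 0` changes the sign pattern `+ + - -` at an odd multiple
of `π / 2`. -/
lemma exists_turn_neg (hp : IsSol gpField p q) (hp0 : 0 < p 0) (hq0 : q 0 = 0)
    (hp1 : p (π / 2) = 0) (heven : ∀ x, p (-x) = p x) (hpi : ∀ x, p (x + π) = -p x)
    (hw : IsSol (linField p) w w') (hw0 : w 0 = 1) (hdw0 : w' 0 = 0) :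
    ∃ N, turn N w (π / 2) < 0 := by
  have hsub := linField_nat_mul_pi_sub heven hpi
  have hturn : ∀ k, IsSol (linField p) (turn k w) (turn k w') := fun k =>
    hw.turn (linField_add_nat_mul_pi hpi k) (linField_neg p)
  have hpos : 0 < w (π / 2) := by
    have hpp := fun t ht => hp.pos_of_endpoints hp0 hp1.ge (t := t) ht
    refine sturm_comparison_pos (T := π / 2) (by positivity) hw.hasDerivAt_fst hw.hasDerivAt_snd
      (fun t => (hp.hasDerivAt_fst t).div_const (2 * p 0))
      (fun t => (hp.hasDerivAt_snd t).div_const (2 * p 0))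
      (fun t ht => div_pos (hpp t ht) (by positivity)) (by simp [hdw0, hq0]) ?_
      (fun t ht hl => ?_) ?_ (by simp [hp1])
    · rw [hw0, div_lt_one (by positivity)]
      linarith
    · have h1 := truncCube_lt_dTruncCube_mul (hpp t ht)
      have h2 : 0 < w t := (div_pos (hpp t ht) (by positivity)).trans hl
      have h3 := mul_lt_mul_of_pos_left h1 h2
      rw [mul_div_assoc', mul_div_assoc']
      refine div_le_div_of_nonneg_right ?_ (by positivity)
      unfold gpField linField
      linarith
    · have h1 := truncCube_lt_dTruncCube_mul hp0
      rw [mul_div_assoc', mul_div_assoc', hw0]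
      refine div_lt_div_of_pos_right ?_ (by positivity)
      unfold gpField linField
      linarith
  refine exists_neg_of_recurrence (δ := fun k => turn k w 0) (m := 2 * w (π / 2))
    (by positivity) three_halves_sub_pos (by rwa [turn_zero]) (fun k => ?_) fun k hk => ?_
  · have hr := (hturn (k + 1)).reflect (c := 0) (by simpa using hsub 0)
    have h1 := ((hturn (k + 1)).lin_combination hr (1 / 2) (1 / 2)).lin_combination hw 1
      (-turn (k + 1) w 0)
    have hz : IsSol (linField p) (fun _ => 0) (fun _ => 0) := by
      simpa using hw.lin_combination hw 0 0
    have h2 := congrFun (IsSol.unique (lipschitzWith_linField p) h1 hz (c := 0)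
      (by simp [hw0]; ring) (by simp [hdw0])).1 (π / 2)
    simp only [zero_sub, turn_succ_neg] at h2
    linarith
  · have hz := hturn k
    have href : ∀ x y, linField p (2 * (π / 2) - x) y = linField p x y := fun x y => by
      simpa [mul_div_cancel₀] using hsub 1 x y
    rcases hk.eq_or_lt with hk | hk
    · have := hz.odd_of_fst_eq_zero (lipschitzWith_linField p) href (linField_neg p) hk.symm 0
      rw [show 2 * (π / 2) - 0 = π by ring, turn_pi] at this
      rw [← hk]
      linarith
    · have := even_lower_bound (hasDerivAt_even_part hz.hasDerivAt_fst (π / 2))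
        (hasDerivAt_odd_part hz.hasDerivAt_snd (π / 2)) (by simpa using hk) (by simp)
        fun t _ hpos => by
          have h1 := href (π / 2 + t) (turn k w (π / 2 - t))
          rw [show 2 * (π / 2) - (π / 2 + t) = π / 2 - t by ring] at h1
          have e1 : cos (2 * (π / 2 + t)) = -cos (2 * t) := by
            rw [← cos_add_pi]; ring_nf
          have h2 := mul_nonneg (dTruncCube_nonneg (p (π / 2 + t))) hpos.le
          rw [h1]
          simp only [linField, e1]
          linarith
      simp only [add_zero, sub_zero, add_halves, sub_self, turn_pi, add_self_div_two] at this
      linarith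

/-- Differentiability of the flow in the initial value. -/
lemma tendsto_flow_sub_div {α : ℝ} (hw : IsSol (linField (flow α)) w w') (hw0 : w 0 = 1)
    (hdw0 : w' 0 = 0) {T : ℝ} (hT : 0 ≤ T) :
    Tendsto (fun β => (flow β T - flow α T) / (β - α)) (nhdsWithin α (Set.Ioi α))
      (nhds (w T)) := by
  have hlim : Tendsto (fun β => gronwallBound 0 14 (12 * (β - α) * exp (14 * T) ^ 2) T)
      (nhdsWithin α (Set.Ioi α)) (nhds 0) := by
    have : Continuous fun β => gronwallBound 0 14 (12 * (β - α) * exp (14 * T) ^ 2) T := by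
      simp only [gronwallBound_of_K_ne_0 (show (14 : ℝ) ≠ 0 by norm_num)]
      fun_prop
    have h0 := (this.tendsto α).mono_left (nhdsWithin_le_nhds (s := Set.Ioi α))
    simpa [gronwallBound_of_K_ne_0 (show (14 : ℝ) ≠ 0 by norm_num)] using h0
  rw [tendsto_iff_dist_tendsto_zero]
  refine squeeze_zero' (Eventually.of_forall fun _ => dist_nonneg) ?_ hlim
  filter_upwards [self_mem_nhdsWithin] with β hβ
  have hε : 0 < β - α := sub_pos.2 hβ
  have := (hw.dist_le (lipschitzWith_linField _) (T := T) (δ := 0)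
    (η := 12 * (β - α) * exp (14 * T) ^ 2)
    (fun t => (((isSol_flow β).hasDerivAt_fst t).sub
      ((isSol_flow α).hasDerivAt_fst t)).div_const (β - α))
    (fun t => (((isSol_flow β).hasDerivAt_snd t).sub
      ((isSol_flow α).hasDerivAt_snd t)).div_const (β - α)) (fun t ht => ?_)
    (by simp [hw0, div_self hε.ne']) (by simp [hdw0]) ⟨hT, le_rfl⟩).1
  · rw [show ((max 1 14 : NNReal) : ℝ) = 14 by norm_num] at this
    exact (Real.dist_eq _ _).trans_le this
  · have h1 := abs_truncCube_sub_sub_le (flow α t) (flow β t)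
    have h2 : |flow β t - flow α t| ≤ (β - α) * exp (14 * T) := by
      have h3 := abs_flow_sub_le β α ht.1
      rw [abs_of_pos hε] at h3
      refine h3.trans ?_
      gcongr
      exact ht.2.le
    have h3 : |flow β t - flow α t| ^ 2 ≤ ((β - α) * exp (14 * T)) ^ 2 := by gcongr
    have h4 : (gpField t (flow β t) - gpField t (flow α t)) / (β - α) -
        linField (flow α) t ((flow β t - flow α t) / (β - α)) =
        (truncCube (flow β t) - truncCube (flow α t) -
          dTruncCube (flow α t) * (flow β t - flow α t)) / (β - α) := by
      unfold gpField linField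
      field_simp
      ring
    have h5 : |(gpField t (flow β t) - gpField t (flow α t)) / (β - α) -
        linField (flow α) t ((flow β t - flow α t) / (β - α))| ≤
        12 * (β - α) * exp (14 * T) ^ 2 := by
      rw [h4, abs_div, abs_of_pos hε, div_le_iff₀ hε]
      linarith
    exact h5

end Linearization

lemma turn_of_antiperiodic {p : ℝ → ℝ} (hpi : ∀ x, p (x + π) = -p x) (k : ℕ) (x : ℝ) :
    turn k p x = p x := by
  induction k with
  | zero => simp [turn]
  | succ k ih =>
    rw [← ih, turn, turn, show ((k + 1 : ℕ) : ℝ) * π + x = k * π + x + π by push_cast; ring, hpi,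
      pow_succ]
    ring

lemma three_halves_le_flow_two {x : ℝ} (hx : 0 < x) : 3 / 2 ≤ flow 2 x :=
  ge_of_large (isSol_flow 2).hasDerivAt_fst (isSol_flow 2).hasDerivAt_snd
    (fun t ht => gpField_nonneg t ht) (by norm_num) (by simp) hx

lemma exists_flow_eq_zero : ∃ α, 0 < α ∧ α < 2 ∧ flow α (π / 2) = 0 := by
  obtain ⟨α, hα, h⟩ := intermediate_value_Icc (show (1 / 2 : ℝ) ≤ 2 by norm_num)
    (continuous_flow (t := π / 2) (by positivity)).continuousOn
    ⟨(isSol_flow (1 / 2)).nonpos_of_eq_half (flow_zero _) (flowDeriv_zero _),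
      (show (0 : ℝ) ≤ 3 / 2 by norm_num).trans (three_halves_le_flow_two (by positivity))⟩
  refine ⟨α, by linarith [hα.1], lt_of_le_of_ne hα.2 ?_, h⟩
  rintro rfl
  have := three_halves_le_flow_two (x := π / 2) (by positivity)
  linarith

lemma exists_first_nonpos_odd {α : ℝ} (hα : 0 < α) (hα2 : α < 2) (h : flow α (π / 2) = 0) :
    ∃ β ∈ Set.Ioo α 2, ∃ n, n % 2 = 1 ∧ quarter n (flow β) ≤ 0 ∧
      ∀ m < n, 0 < quarter m (flow β) := by
  have hp := isSol_flow α
  have hpi : ∀ x, flow α (x + π) = -flow α x := fun x => by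
    have := hp.odd_of_fst_eq_zero lipschitzWith_gpField (c := π / 2) (fun x y => by
      simpa [mul_div_cancel₀] using gpField_nat_mul_pi_sub 1 x y) gpField_neg h (-x)
    rwa [show 2 * (π / 2) - -x = x + π by ring, flow_neg] at this
  obtain ⟨w, w', hw, hw0, hdw0⟩ := IsSol.exists_sol (lipschitzWith_linField (flow α))
    (fun y => by
      have := continuous_dTruncCube.comp hp.continuous_fst
      simp only [Function.comp_def] at this
      unfold linField
      fun_prop) (fun x => by simp [linField]) 1 0
  obtain ⟨N, hN⟩ := exists_turn_neg hp (by simpa) (flowDeriv_zero α) h (flow_neg α) hpi hw hw0 hdw0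
  have h1 : ∀ᶠ β in nhdsWithin α (Set.Ioi α), turn N (flow β) (π / 2) < 0 := by
    have hlim := (tendsto_flow_sub_div hw hw0 hdw0 (T := N * π + π / 2) (by positivity)).const_mul
      ((-1) ^ N)
    filter_upwards [hlim.eventually (gt_mem_nhds hN), self_mem_nhdsWithin] with β hlt hβ
    have hzero := turn_of_antiperiodic hpi N (π / 2)
    rw [h, turn] at hzero
    rw [mul_div_assoc', div_lt_iff₀ (sub_pos.2 hβ), mul_sub, hzero] at hlt
    rw [turn]
    linarith
  have h2 : ∀ᶠ β in nhdsWithin α (Set.Ioi α), ∀ j ≤ N, 0 < turn j (flow β) 0 := by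
    refine (eventually_all_finite (Set.finite_le_nat N)).2 fun j _ => ?_
    simp only [← quarter_two_mul]
    refine ((continuous_quarter_flow (2 * j)).continuousAt.eventually (lt_mem_nhds ?_)).filter_mono
      nhdsWithin_le_nhds
    simpa [quarter_two_mul, turn_of_antiperiodic hpi] using hα
  obtain ⟨β, h3, h4, h5⟩ := (h1.and (h2.and (Ioo_mem_nhdsGT hα2))).exists
  refine ⟨β, h5, ?_⟩
  classical
  have hex : ∃ n, quarter n (flow β) ≤ 0 := ⟨2 * N + 1, by
    rw [quarter_two_mul_add_one]; exact h3.le⟩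
  have hle : Nat.find hex ≤ 2 * N + 1 := Nat.find_min' hex (by
    rw [quarter_two_mul_add_one]; exact h3.le)
  refine ⟨Nat.find hex, ?_, Nat.find_spec hex, fun m hm => not_le.1 (Nat.find_min hex hm)⟩
  by_contra hodd
  obtain ⟨j, hj⟩ : ∃ j, Nat.find hex = 2 * j := ⟨Nat.find hex / 2, by omega⟩
  have hspec := Nat.find_spec hex
  rw [hj, quarter_two_mul] at hspec
  exact (h4 j (by omega)).not_ge hspec

lemma exists_flow_pos : ∃ α, 0 < α ∧ ∀ n, 0 < quarter n (flow α) := by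
  obtain ⟨α, hα, hα2, h⟩ := exists_flow_eq_zero
  obtain ⟨β, hβ, hodd⟩ := exists_first_nonpos_odd hα hα2 h
  have hzero : ∀ γ ∈ Set.Icc β 2, ∀ n, (∀ m < n, 0 < quarter m (flow γ)) →
      quarter n (flow γ) = 0 → 0 < quarter (n + 1) (flow γ) ∧ quarter (n + 2) (flow γ) < 0 := by
    intro γ hγ n hlt hn
    match n with
    | 0 =>
      have : γ = 0 := by simpa [quarter] using hn
      linarith [hβ.1, hγ.1]
    | 1 =>
      have : flow γ (π / 2) = 0 := by simpa [quarter] using hn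
      have := (isSol_flow α).pos_of_lt (by simpa) (flowDeriv_zero α) h (isSol_flow γ)
        (flowDeriv_zero γ) (by simpa using hβ.1.trans_le hγ.1)
      linarith
    | n + 2 =>
      obtain ⟨h1, h2⟩ := (isSol_flow γ).quarter_of_eq_zero hn
      rw [h1, h2]
      exact ⟨hlt _ (by omega), neg_neg_of_pos (hlt _ (by omega))⟩
  have heven : quarter 2 (flow 2) ≤ 0 := by
    have := three_halves_le_flow_two pi_pos
    rw [show 2 = 2 * 1 from rfl, quarter_two_mul]
    simp [turn]
    linarith
  have hfirst : ∀ m < 2, 0 < quarter m (flow 2) := by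
    intro m hm
    have := three_halves_le_flow_two (x := π / 2) (by positivity)
    obtain rfl | rfl : m = 0 ∨ m = 1 := by omega
    · simp [quarter]
    · simp [quarter]
      linarith
  obtain ⟨γ, hγ, hpos⟩ := exists_forall_pos_of_parity hβ.2.le continuous_quarter_flow hzero hodd
    ⟨2, rfl, heven, hfirst⟩
  exact ⟨γ, by linarith [hβ.1, hγ.1], hpos⟩

/-- **Theorem 4.2 of the paper.**  The time-independent Gross–Pitaevskii equation
`u'' + (a − b cos(2x)) u − c u³ = 0` with parameters `a = 1`, `b = −1`,
`c = 1` has a soliton solution `u : ℝ → ℝ` (a `C²` solution on all of `ℝ` with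
`(u(x), u'(x)) → (0,0)` as `x → ±∞`) that is even and not identically zero. -/
theorem gross_pitaevskii_soliton_a1_bneg1_c1 :
    ∃ u : ℝ → ℝ,
      ContDiff ℝ 2 u ∧
      (∀ x : ℝ,
        deriv (deriv u) x + ((1 : ℝ) - (-1 : ℝ) * Real.cos (2 * x)) * u x
          - (1 : ℝ) * (u x) ^ 3 = 0) ∧
      Tendsto (fun x : ℝ => (u x, deriv u x)) atTop (nhds (0, 0)) ∧
      Tendsto (fun x : ℝ => (u x, deriv u x)) atBot (nhds (0, 0)) ∧
      (∀ x : ℝ, u (-x) = u x) ∧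
      u ≠ 0 := by
  obtain ⟨α, hα, hpos⟩ := exists_flow_pos
  have h := isSol_flow α
  have hderiv : deriv (flow α) = flowDeriv α := funext fun x => (h.hasDerivAt_fst x).deriv
  have hderiv₂ : deriv (flowDeriv α) = fun x => gpField x (flow α x) :=
    funext fun x => (h.hasDerivAt_snd x).deriv
  have hodd : ∀ x, flowDeriv α (-x) = -flowDeriv α x := fun x => by
    have h1 := ((h.hasDerivAt_fst (-x)).scomp x (hasDerivAt_neg x)).unique
      ((h.hasDerivAt_fst x).congr_of_eventuallyEq (Eventually.of_forall (flow_neg α)))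
    simp only [neg_smul, one_smul] at h1
    linarith
  obtain ⟨hA, hB⟩ := h.tendsto_turn_zero (fun k => by simpa [quarter_two_mul] using hpos (2 * k))
    fun k => by simpa [quarter_two_mul_add_one] using hpos (2 * k + 1)
  have htop := h.tendsto_atTop_of_turn hA hB
  have hbot : Tendsto (fun x => (flow α x, flowDeriv α x)) atBot (nhds (0, 0)) := by
    have h1 := htop.comp tendsto_neg_atBot_atTop
    simp only [Function.comp_def, flow_neg, hodd] at h1
    have h2 := h1.fst_nhds.prodMk_nhds h1.snd_nhds.neg
    simpa using h2
  have hbound := h.abs_le_three_halves htop.fst_nhds hbot.fst_nhds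
  have hcont : Continuous fun x => gpField x (flow α x) := by
    have h1 := (continuous_iff_continuousAt.2 fun s =>
      (hasDerivAt_truncCube s).continuousAt).comp h.continuous_fst
    have h2 := h.continuous_fst
    simp only [Function.comp_def] at h1
    unfold gpField
    fun_prop
  refine ⟨flow α, ?_, fun x => ?_, by rwa [hderiv], by rwa [hderiv], flow_neg α, fun h0 => ?_⟩
  · rw [show (2 : WithTop ℕ∞) = 1 + 1 by norm_num, contDiff_succ_iff_deriv, hderiv,
      contDiff_one_iff_deriv, hderiv₂]
    exact ⟨fun x => (h.hasDerivAt_fst x).differentiableAt, by simp,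
      fun x => (h.hasDerivAt_snd x).differentiableAt, hcont⟩
  · simp only [hderiv, hderiv₂, gpField]
    rw [truncCube_of_abs_le ((hbound x).trans (by norm_num))]
    ring
  · have := flow_zero α
    rw [h0, Pi.zero_apply] at this
    exact hα.ne this
end

section
/- The time-independent Gross–Pitaevskii equation u''(x) + (a − b·cos(2x))·u(x) − c·u(x)³ = 0 with parameters a = 1, b = 1, c = 1 has a soliton solution u : ℝ → ℝ that is even and not identically zero. -/
open Filter Real

/-- The scale of the fixed-point numbers in the certified integration. -/
def scl : ℤ := 1099511627776

def padd : List ℤ → List ℤ → List ℤ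
  | [], m => m
  | a :: l, [] => a :: l
  | a :: l, b :: m => (a + b) :: padd l m

def psmul (k : ℤ) : List ℤ → List ℤ
  | [] => []
  | a :: l => (k * a) :: psmul k l

def pmadd (k : ℤ) : List ℤ → List ℤ → List ℤ
  | [], m => m
  | a :: l, m => (k * a + m.headD 0) :: pmadd k l m.tail

def pmul : List ℤ → List ℤ → List ℤ
  | [], _ => []
  | a :: l, m => pmadd a m (0 :: pmul l m)

def pder : List ℤ → List ℤ
  | [] => []
  | _ :: l => padd l (0 :: pder l)

def pnorm : List ℤ → ℤ
  | [] => 0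
  | a :: l => (a.natAbs : ℤ) + pnorm l

def psum : List ℤ → ℤ
  | [] => 0
  | a :: l => a + psum l

def forceNat (n : ℕ) (k : ℕ → Bool) : Bool :=
  match n with
  | 0 => k 0
  | m + 1 => k (m + 1)

def forceInt (z : ℤ) (k : ℤ → Bool) : Bool :=
  match z with
  | Int.ofNat n => forceNat n (fun n => k (Int.ofNat n))
  | Int.negSucc n => forceNat n (fun n => k (Int.negSucc n))

def forceList (l : List ℤ) (k : List ℤ → Bool) : Bool :=
  match l with
  | [] => k []
  | a :: l => forceInt a fun a => forceList l fun l => k (a :: l)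

def dot : List ℤ → List ℤ → ℤ
  | a :: l, b :: m => a * b + dot l m
  | _, _ => 0

/-- Taylor coefficients -/
def gen : ℕ → ℤ → List ℤ → List ℤ → List ℤ → (List ℤ → List ℤ → Bool) → Bool
  | 0, _, ur, cr, _, K => K ur.reverse cr.reverse
  | n + 1, k, ur, cr, gr, K =>
    forceInt ((dot ur.tail ur.tail.reverse + 2 * dot cr.tail cr.tail.reverse) / scl
      - (if k = 0 then 2 * scl else 0)) fun g =>
    forceInt (dot (g :: gr) ur.tail.reverse / (scl * (64 * (k + 1) * (k + 2)))) fun a =>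
    forceInt (-cr.tail.headD 0 / (64 * (k + 1) * (k + 2))) fun c =>
    gen n (k + 1) (a :: ur) (c :: cr) (g :: gr) K

structure St where
  u0 : ℤ
  u1 : ℤ
  c0 : ℤ
  c1 : ℤ
  e : ℤ
  g : ℤ

/-- One step of length `1/8` of the certified integration, in continuation-passing style: Taylor
polynomials for the solution and the cosine are computed, their residuals are bounded, and the
error bounds `e` and `g` are propagated. -/
def step (i : ℕ) (st : St) (K : St → Bool) : Bool :=
  gen 7 0 [st.u1, st.u0] [st.c1, st.c0] [] fun U C =>
  forceList (pmul C C) fun cc =>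
  forceList (pmul U U) fun uu =>
  forceInt (pnorm (padd (psmul (-64 * (scl * scl)) (pder (pder U)))
    (pmul (padd uu (padd (psmul 2 cc) [-2 * (scl * scl)])) U))) fun n₁ =>
  forceInt (pnorm (padd (psmul 64 (pder (pder C))) C)) fun n₂ =>
  forceInt (pnorm (padd (psmul 3 uu) (padd (psmul 2 cc) [-(scl * scl)]))) fun n₃ =>
  forceInt (pnorm U) fun B =>
  forceInt (n₁ / (scl * scl) + 1) fun eps =>
  forceInt (st.g + n₂ / 8 + 1) fun g =>
  forceInt (eps + 5 * g * B / scl + 1) fun d =>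
  forceInt (2 * st.e + d) fun R =>
  forceInt ((n₃ + 3 * B * R + R * R) / scl + 5 * g + 1) fun rho =>
  forceInt (rho * st.e / (16 * scl) + d / 8 + 2) fun s₁ =>
  forceInt (rho * s₁ / (32 * scl - rho) + 1) fun s₂ =>
  forceInt (psum U) fun u0 => forceInt (psum (pder U)) fun u1 =>
  forceInt (psum C) fun c0 => forceInt (psum (pder C)) fun c1 =>
  forceInt (st.e + s₁ + s₂) fun e =>
  decide (n₁ ≤ eps * (scl * scl) ∧ n₂ < 8 * (g - st.g) ∧ 5 * g * B + eps * scl ≤ d * scl ∧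
    n₃ + 3 * B * R + R * R + 5 * g * scl ≤ rho * scl ∧ rho * st.e + 2 * scl * d < 16 * scl * s₁ ∧
    rho * (s₁ + s₂) ≤ 32 * scl * s₂ ∧ 0 ≤ s₂ ∧ e ≤ R ∧ 2 * g ≤ scl ∧
    40 * ((B + R) * (B + R)) ≤ (scl * scl) * (4 + 5 * ((71 - i : ℕ) : ℤ))) &&
    K ⟨u0, u1, c0, c1, e, g⟩

def run : ℕ → ℕ → St → (St → Bool) → Bool
  | 0, _, st, K => K st
  | n + 1, i, st, K => step i st fun st' => run n (i + 1) st' K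

theorem forceNat_eq (n : ℕ) (k : ℕ → Bool) : forceNat n k = k n := by cases n <;> rfl

theorem forceInt_eq (z : ℤ) (k : ℤ → Bool) : forceInt z k = k z := by
  cases z <;> simp only [forceInt, forceNat_eq]

theorem forceList_eq (l : List ℤ) (k : List ℤ → Bool) : forceList l k = k l := by
  induction l generalizing k with
  | nil => rfl
  | cons a l ih => simp only [forceList, forceInt_eq, ih]

/-- Evaluation of a coefficient list at a real number. -/
def ev : List ℤ → ℝ → ℝ
  | [], _ => 0
  | a :: l, t => a + t * ev l t

theorem ev_padd (l m : List ℤ) (t : ℝ) : ev (padd l m) t = ev l t + ev m t := by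
  induction l generalizing m with
  | nil => simp [padd, ev]
  | cons a l ih =>
    cases m with
    | nil => simp [padd, ev]
    | cons b m => simp only [padd, ev, ih]; push_cast; ring

theorem ev_psmul (k : ℤ) (l : List ℤ) (t : ℝ) : ev (psmul k l) t = k * ev l t := by
  induction l with
  | nil => simp [psmul, ev]
  | cons a l ih => simp only [psmul, ev, ih]; push_cast; ring

theorem ev_pmadd (k : ℤ) (l m : List ℤ) (t : ℝ) : ev (pmadd k l m) t = k * ev l t + ev m t := by
  induction l generalizing m with
  | nil => simp [pmadd, ev]
  | cons a l ih =>
    cases m with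
    | nil => simp only [pmadd, ev, ih, List.tail_nil, List.headD_nil]; push_cast; ring
    | cons b m => simp only [pmadd, ev, ih, List.tail_cons, List.headD_cons]; push_cast; ring

theorem ev_pmul (l m : List ℤ) (t : ℝ) : ev (pmul l m) t = ev l t * ev m t := by
  induction l with
  | nil => simp [pmul, ev]
  | cons a l ih => simp only [pmul, ev_pmadd, ev, ih]; push_cast; ring

theorem hasDerivAt_ev (l : List ℤ) (t : ℝ) : HasDerivAt (ev l) (ev (pder l) t) t := by
  induction l with
  | nil => exact hasDerivAt_const t (0 : ℝ)
  | cons a l ih =>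
    refine (((hasDerivAt_id t).mul ih).const_add (a : ℝ)).congr_deriv ?_
    simp only [pder, ev_padd, ev, id]
    push_cast
    ring

theorem abs_ev_le (l : List ℤ) {t : ℝ} (h0 : 0 ≤ t) (h1 : t ≤ 1) : |ev l t| ≤ pnorm l := by
  induction l with
  | nil => simp [ev, pnorm]
  | cons a l ih =>
    simp only [ev, pnorm]
    push_cast
    refine (abs_add_le _ _).trans (add_le_add (by simp) ?_)
    rw [abs_mul, abs_of_nonneg h0]
    exact (mul_le_of_le_one_left (abs_nonneg _) h1).trans ih

theorem ev_one (l : List ℤ) : ev l 1 = psum l := by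
  induction l with
  | nil => simp [ev, psum]
  | cons a l ih => simp [ev, psum, ih]

theorem gen_eq_true {n : ℕ} {k : ℤ} {ur cr gr : List ℤ} {K : List ℤ → List ℤ → Bool}
    (h : gen n k ur cr gr K = true) : ∃ a b, K (ur.reverse ++ a) (cr.reverse ++ b) = true := by
  induction n generalizing k ur cr gr with
  | zero => exact ⟨[], [], by simpa [gen] using h⟩
  | succ n ih =>
    simp only [gen, forceInt_eq] at h
    obtain ⟨a, b, hab⟩ := ih h
    simp only [List.reverse_cons, List.append_assoc] at hab
    exact ⟨_, _, hab⟩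

/-- A comparison principle for the energy norm of a second order equation. -/
theorem energy_le {w p q β β' : ℝ → ℝ} {a b ρ ε : ℝ} (hρ : 0 ≤ ρ) (hε : 0 ≤ ε)
    (hw : ∀ x, HasDerivAt w (p x) x) (hp : ∀ x, HasDerivAt p (q x) x)
    (hβ : ∀ x, HasDerivAt β (β' x) x) (hpos : ∀ x ∈ Set.Ico a b, 0 < β x)
    (h0 : w a ^ 2 + p a ^ 2 ≤ β a ^ 2)
    (hq : ∀ x ∈ Set.Ico a b, w x ^ 2 + p x ^ 2 = β x ^ 2 → |q x + w x| ≤ ρ * |w x| + ε)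
    (hlt : ∀ x ∈ Set.Ico a b, ρ / 2 * β x + ε < β' x) :
    ∀ x ∈ Set.Icc a b, w x ^ 2 + p x ^ 2 ≤ β x ^ 2 := by
  have hd : ∀ x, HasDerivAt (fun x => w x ^ 2 + p x ^ 2) _ x :=
    fun x => ((hw x).pow 2).add ((hp x).pow 2)
  have hB : ∀ x, HasDerivAt (fun x => β x ^ 2) _ x := fun x => (hβ x).pow 2
  intro x hx
  refine image_le_of_deriv_right_lt_deriv_boundary'
    (fun x _ => (hd x).continuousAt.continuousWithinAt) (fun x _ => (hd x).hasDerivWithinAt)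
    h0 (fun x _ => (hB x).continuousAt.continuousWithinAt)
    (fun x _ => (hB x).hasDerivWithinAt) ?_ hx
  intro x hx he
  have hb := hpos x hx
  have h1 := hq x hx he
  have h2 := hlt x hx
  have hpb : |p x| ≤ β x := abs_le_of_sq_le_sq (by nlinarith [sq_nonneg (w x)]) hb.le
  have h3 : p x * (q x + w x) ≤ |p x| * (ρ * |w x| + ε) :=
    (le_abs_self _).trans (by rw [abs_mul]; exact mul_le_mul_of_nonneg_left h1 (abs_nonneg _))
  have hw2 := sq_abs (w x)
  have hp2 := sq_abs (p x)
  have h4 : 2 * (|p x| * |w x|) ≤ β x ^ 2 := by nlinarith [sq_nonneg (|p x| - |w x|)]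
  have h5 := mul_le_mul_of_nonneg_left h4 hρ
  have h6 := mul_le_mul_of_nonneg_right hpb hε
  have h7 := mul_lt_mul_of_pos_left h2 hb
  push_cast
  nlinarith

theorem pnorm_nonneg (l : List ℤ) : 0 ≤ pnorm l := by
  induction l with
  | nil => simp [pnorm]
  | cons a l ih => simp only [pnorm]; positivity

theorem scl_pos : (0 : ℝ) < scl := by norm_num [scl]

theorem hasDerivAt_ev_scaled (l : List ℤ) (x₀ x : ℝ) :
    HasDerivAt (fun x => ev l (8 * (x - x₀)) / scl) (8 * ev (pder l) (8 * (x - x₀)) / scl) x := by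
  have h := (hasDerivAt_ev l (8 * (x - x₀))).comp x
    (((hasDerivAt_id x).sub_const x₀).const_mul (8 : ℝ))
  refine (h.div_const (scl : ℝ)).congr_deriv ?_
  ring

theorem hasDerivAt_ev_scaled' (l : List ℤ) (x₀ x : ℝ) :
    HasDerivAt (fun x => 8 * ev l (8 * (x - x₀)) / scl)
      (64 * ev (pder l) (8 * (x - x₀)) / scl) x := by
  refine ((hasDerivAt_ev_scaled l x₀ x).const_mul 8).congr_deriv ?_ |>.congr_of_eventuallyEq ?_
  · ring
  · exact Eventually.of_forall fun y => by ring

theorem cos_step {C : List ℤ} {x₀ : ℝ} {g g' : ℤ} (hg : 0 < g)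
    (h0 : (cos x₀ - ev C 0 / scl) ^ 2 + (-sin x₀ - 8 * ev (pder C) 0 / scl) ^ 2 ≤ (g / scl) ^ 2)
    (hn : pnorm (padd (psmul 64 (pder (pder C))) C) < 8 * (g' - g)) :
    ∀ x ∈ Set.Icc x₀ (x₀ + 1 / 8),
      (cos x - ev C (8 * (x - x₀)) / scl) ^ 2
        + (-sin x - 8 * ev (pder C) (8 * (x - x₀)) / scl) ^ 2
        ≤ ((g + (g' - g) * (8 * (x - x₀))) / scl) ^ 2 := by
  have hS := scl_pos
  have hn' : (pnorm (padd (psmul 64 (pder (pder C))) C) : ℝ) < 8 * (g' - g) := by exact_mod_cast hn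
  have hn0 : (0 : ℝ) ≤ pnorm (padd (psmul 64 (pder (pder C))) C) := by
    exact_mod_cast pnorm_nonneg _
  have hg' : (0 : ℝ) < g := by exact_mod_cast hg
  have hβ : ∀ x, HasDerivAt (fun x => (g + (g' - g) * (8 * (x - x₀))) / (scl : ℝ))
      (8 * (g' - g) / scl) x := by
    intro x
    refine (((((hasDerivAt_id x).sub_const x₀).const_mul (8 : ℝ)).const_mul
      ((g' : ℝ) - g)).const_add (g : ℝ)).div_const (scl : ℝ) |>.congr_deriv ?_
    ring
  refine energy_le (ρ := 0) (ε := pnorm (padd (psmul 64 (pder (pder C))) C) / scl) le_rfl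
    (by positivity)
    (fun x => (hasDerivAt_cos x).sub (hasDerivAt_ev_scaled C x₀ x))
    (fun x => (hasDerivAt_sin x).neg.sub (hasDerivAt_ev_scaled' (pder C) x₀ x)) hβ ?_ ?_ ?_ ?_
  · intro x hx
    have : 0 ≤ ((g' : ℝ) - g) * (8 * (x - x₀)) := mul_nonneg (by linarith) (by linarith [hx.1])
    positivity
  · simpa using h0
  · intro x hx _
    have h := abs_ev_le (padd (psmul 64 (pder (pder C))) C) (t := 8 * (x - x₀))
      (by linarith [hx.1]) (by linarith [hx.2])
    rw [ev_padd, ev_psmul] at h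
    push_cast at h
    rw [zero_mul, zero_add, show -cos x - 64 * ev (pder (pder C)) (8 * (x - x₀)) / scl
      + (cos x - ev C (8 * (x - x₀)) / scl)
      = -((64 * ev (pder (pder C)) (8 * (x - x₀)) + ev C (8 * (x - x₀))) / scl) by ring,
      abs_neg, abs_div, abs_of_pos hS]
    gcongr
  · intro x _
    rw [zero_div, zero_mul, zero_add]
    gcongr

theorem abs_defect_le {a γ κ z u N B r D E ρ ε : ℝ} (hN : |3 * a ^ 2 + 2 * γ ^ 2 - 1| ≤ N)
    (hB : |a| ≤ B) (hr : |u - a| ≤ r) (hD : |2 * (κ ^ 2 - γ ^ 2)| ≤ D)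
    (hE : |a ^ 3 + (2 * γ ^ 2 - 2) * a - z| ≤ E) (hρ : N + 3 * B * r + r ^ 2 + D ≤ ρ)
    (hε : D * B + E ≤ ε) :
    |(u ^ 2 - (2 - 2 * κ ^ 2)) * u - z + (u - a)| ≤ ρ * |u - a| + ε := by
  set w := u - a with hw
  have hr0 : 0 ≤ r := (abs_nonneg _).trans hr
  have hD0 : 0 ≤ D := (abs_nonneg _).trans hD
  have hB0 : 0 ≤ B := (abs_nonneg _).trans hB
  have e : (u ^ 2 - (2 - 2 * κ ^ 2)) * u - z + w
      = (3 * a ^ 2 + 2 * γ ^ 2 - 1 + 3 * a * w + w ^ 2 + 2 * (κ ^ 2 - γ ^ 2)) * w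
        + 2 * (κ ^ 2 - γ ^ 2) * a + (a ^ 3 + (2 * γ ^ 2 - 2) * a - z) := by
    rw [show u = a + w by rw [hw]; ring]
    ring
  have h1 : |3 * a * w| ≤ 3 * B * r := by
    rw [abs_mul, abs_mul, abs_of_pos (three_pos : (0 : ℝ) < 3)]
    gcongr
  have h2 : |w ^ 2| ≤ r ^ 2 := by
    rw [abs_pow]
    gcongr
  have h3 : |3 * a ^ 2 + 2 * γ ^ 2 - 1 + 3 * a * w + w ^ 2 + 2 * (κ ^ 2 - γ ^ 2)| ≤ ρ := by
    refine le_trans ?_ hρ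
    refine (abs_add_le _ _).trans (add_le_add ?_ hD)
    refine (abs_add_le _ _).trans (add_le_add ?_ h2)
    exact (abs_add_le _ _).trans (add_le_add hN h1)
  rw [e]
  calc _ ≤ |(3 * a ^ 2 + 2 * γ ^ 2 - 1 + 3 * a * w + w ^ 2 + 2 * (κ ^ 2 - γ ^ 2)) * w|
        + |2 * (κ ^ 2 - γ ^ 2) * a| + |a ^ 3 + (2 * γ ^ 2 - 2) * a - z| := abs_add_three _ _ _
    _ ≤ ρ * |w| + D * B + E := by
        rw [abs_mul, abs_mul]
        gcongr
    _ ≤ ρ * |w| + ε := by linarith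

theorem abs_two_mul_sq_sub_sq_le {κ γ η : ℝ} (hκ : |κ| ≤ 1) (h : |κ - γ| ≤ η) (hη : 2 * η ≤ 1) :
    |2 * (κ ^ 2 - γ ^ 2)| ≤ 5 * η := by
  have h1 : |κ + γ| ≤ 5 / 2 := by
    rw [abs_le] at *
    constructor <;> linarith
  rw [show 2 * (κ ^ 2 - γ ^ 2) = 2 * ((κ - γ) * (κ + γ)) by ring, abs_mul, abs_mul, abs_two]
  have := mul_le_mul h h1 (abs_nonneg _) ((abs_nonneg _).trans h)
  linarith

/-- The cut-off level of the nonlinearity. -/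
noncomputable def capR (x : ℝ) : ℝ := 1 / 10 + max 0 (9 - |x|)

/-- `u` solves the equation `u'' = (min (u²) (capR x) - 2 sin² x) u`. -/
structure IsSol_s3 (u v : ℝ → ℝ) : Prop where
  hasDerivAt : ∀ x, HasDerivAt u (v x) x
  hasDerivAt' : ∀ x, HasDerivAt v ((min (u x ^ 2) (capR x) - 2 * sin x ^ 2) * u x) x

/-- The state `st` encloses the solution and the cosine at `x`. -/
def Encl (u v : ℝ → ℝ) (x : ℝ) (st : St) : Prop :=
  0 < st.e ∧ 0 < st.g ∧
    (u x - st.u0 / scl) ^ 2 + (v x - 8 * st.u1 / scl) ^ 2 ≤ (st.e / scl) ^ 2 ∧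
    (cos x - st.c0 / scl) ^ 2 + (-sin x - 8 * st.c1 / scl) ^ 2 ≤ (st.g / scl) ^ 2

theorem sol_step {u v : ℝ → ℝ} (hs : IsSol_s3 u v) {U C : List ℤ} {x₀ : ℝ}
    {e g n₁ n₃ B eps d R rho s₁ s₂ : ℤ} (he : 0 < e) (hg : 0 < g)
    (hn₁ : pnorm (padd (psmul (-64 * (scl * scl)) (pder (pder U)))
      (pmul (padd (pmul U U) (padd (psmul 2 (pmul C C)) [-2 * (scl * scl)])) U)) = n₁)
    (hn₃ : pnorm (padd (psmul 3 (pmul U U)) (padd (psmul 2 (pmul C C)) [-(scl * scl)])) = n₃)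
    (hB : pnorm U = B)
    (h0 : (u x₀ - ev U 0 / scl) ^ 2 + (v x₀ - 8 * ev (pder U) 0 / scl) ^ 2 ≤ (e / scl) ^ 2)
    (hcos : ∀ x ∈ Set.Icc x₀ (x₀ + 1 / 8), |cos x - ev C (8 * (x - x₀)) / scl| ≤ g / scl)
    (h₁ : n₁ ≤ eps * (scl * scl)) (h₂ : 5 * g * B + eps * scl ≤ d * scl)
    (h₃ : n₃ + 3 * B * R + R * R + 5 * g * scl ≤ rho * scl)
    (h₄ : rho * e + 2 * scl * d < 16 * scl * s₁) (h₅ : rho * (s₁ + s₂) ≤ 32 * scl * s₂)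
    (h₆ : 0 ≤ s₂) (h₇ : e + s₁ + s₂ ≤ R) (h₈ : 2 * g ≤ scl) (hR : 0 ≤ R)
    (hcap : ∀ x ∈ Set.Icc x₀ (x₀ + 1 / 8), (((B : ℝ) + R) / scl) ^ 2 ≤ capR x) :
    (∀ x ∈ Set.Icc x₀ (x₀ + 1 / 8), u x ^ 2 ≤ capR x) ∧
      (u (x₀ + 1 / 8) - ev U 1 / scl) ^ 2 + (v (x₀ + 1 / 8) - 8 * ev (pder U) 1 / scl) ^ 2
        ≤ (((e + s₁ + s₂ : ℤ) : ℝ) / scl) ^ 2 := by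
  have hS := scl_pos
  have hS' : 0 < scl := by norm_num [scl]
  have hn₁0 : 0 ≤ n₁ := hn₁ ▸ pnorm_nonneg _
  have hn₃0 : 0 ≤ n₃ := hn₃ ▸ pnorm_nonneg _
  have hB0 : 0 ≤ B := hB ▸ pnorm_nonneg _
  have heps : 0 ≤ eps := by
    by_contra! h
    nlinarith [mul_pos hS' hS']
  have hd : 0 ≤ d := by
    have : 0 ≤ d * scl := le_trans (by positivity) h₂
    by_contra! h
    nlinarith
  have hrho : 0 ≤ rho := by
    have : 0 ≤ rho * scl := le_trans (by positivity) h₃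
    by_contra! h
    nlinarith
  have hs₁ : 0 < s₁ := by
    have : 0 < 16 * scl * s₁ := lt_of_le_of_lt (by positivity) h₄
    by_contra! h
    nlinarith
  have hβ : ∀ x, HasDerivAt
      (fun x => (e + s₁ * (8 * (x - x₀)) + s₂ * (8 * (x - x₀)) ^ 2) / (scl : ℝ))
      (8 * (s₁ + 2 * s₂ * (8 * (x - x₀))) / scl) x := by
    intro x
    have ht : HasDerivAt (fun x => 8 * (x - x₀)) (8 * 1) x :=
      ((hasDerivAt_id x).sub_const x₀).const_mul (8 : ℝ)
    refine ((((ht.const_mul (s₁ : ℝ)).const_add (e : ℝ)).add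
      ((ht.pow 2).const_mul (s₂ : ℝ))).div_const (scl : ℝ)).congr_deriv ?_
    push_cast
    ring
  have hβR : ∀ x ∈ Set.Icc x₀ (x₀ + 1 / 8),
      0 < (e + s₁ * (8 * (x - x₀)) + s₂ * (8 * (x - x₀)) ^ 2) / (scl : ℝ) ∧
      (e + s₁ * (8 * (x - x₀)) + s₂ * (8 * (x - x₀)) ^ 2) / (scl : ℝ) ≤ R / scl := by
    intro x hx
    have ht0 : 0 ≤ 8 * (x - x₀) := by linarith [hx.1]
    have ht1 : 8 * (x - x₀) ≤ 1 := by linarith [hx.2]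
    have he' : (0 : ℝ) < e := by exact_mod_cast he
    have hs₁' : (0 : ℝ) < s₁ := by exact_mod_cast hs₁
    have hs₂' : (0 : ℝ) ≤ s₂ := by exact_mod_cast h₆
    have h₇' : (e : ℝ) + s₁ + s₂ ≤ R := by exact_mod_cast h₇
    refine ⟨by positivity, ?_⟩
    have := mul_le_of_le_one_right hs₁'.le ht1
    have := mul_le_of_le_one_right hs₂' (pow_le_one₀ (n := 2) ht0 ht1)
    gcongr
    linarith
  have hw : ∀ x, x ∈ Set.Icc x₀ (x₀ + 1 / 8) →
      (u x - ev U (8 * (x - x₀)) / scl) ^ 2 + (v x - 8 * ev (pder U) (8 * (x - x₀)) / scl) ^ 2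
        ≤ ((e + s₁ * (8 * (x - x₀)) + s₂ * (8 * (x - x₀)) ^ 2) / (scl : ℝ)) ^ 2 →
      |u x - ev U (8 * (x - x₀)) / scl| ≤ R / scl := by
    intro x hx h
    obtain ⟨hp, hl⟩ := hβR x hx
    refine (abs_le_of_sq_le_sq ?_ hp.le).trans hl
    nlinarith [sq_nonneg (v x - 8 * ev (pder U) (8 * (x - x₀)) / scl)]
  have hA : ∀ x ∈ Set.Icc x₀ (x₀ + 1 / 8), |ev U (8 * (x - x₀)) / scl| ≤ B / scl := by
    intro x hx
    rw [abs_div, abs_of_pos hS, ← hB]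
    have := abs_ev_le U (t := 8 * (x - x₀)) (by linarith [hx.1]) (by linarith [hx.2])
    gcongr
  have hclamp : ∀ x ∈ Set.Icc x₀ (x₀ + 1 / 8),
      |u x - ev U (8 * (x - x₀)) / scl| ≤ R / scl → u x ^ 2 ≤ capR x := by
    intro x hx h
    refine le_trans ?_ (hcap x hx)
    rw [← sq_abs (u x), add_div]
    have := abs_add_le (u x - ev U (8 * (x - x₀)) / scl) (ev U (8 * (x - x₀)) / scl)
    rw [sub_add_cancel] at this
    have := hA x hx
    gcongr
    linarith
  have key : ∀ x ∈ Set.Icc x₀ (x₀ + 1 / 8),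
      (u x - ev U (8 * (x - x₀)) / scl) ^ 2 + (v x - 8 * ev (pder U) (8 * (x - x₀)) / scl) ^ 2
        ≤ ((e + s₁ * (8 * (x - x₀)) + s₂ * (8 * (x - x₀)) ^ 2) / (scl : ℝ)) ^ 2 := by
    refine energy_le (ρ := rho / scl) (ε := d / scl)
      (div_nonneg (by exact_mod_cast hrho) hS.le) (div_nonneg (by exact_mod_cast hd) hS.le)
      (fun x => (hs.hasDerivAt x).sub (hasDerivAt_ev_scaled U x₀ x))
      (fun x => (hs.hasDerivAt' x).sub (hasDerivAt_ev_scaled' (pder U) x₀ x)) hβ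
      (fun x hx => (hβR x ⟨hx.1, hx.2.le⟩).1) ?_ ?_ ?_
    · simpa using h0
    · intro x hx heq
      have hx' : x ∈ Set.Icc x₀ (x₀ + 1 / 8) := ⟨hx.1, hx.2.le⟩
      have ht0 : 0 ≤ 8 * (x - x₀) := by linarith [hx.1]
      have ht1 : 8 * (x - x₀) ≤ 1 := by linarith [hx.2]
      have hwx := hw x hx' heq.le
      rw [min_eq_left (hclamp x hx' hwx), show 2 * sin x ^ 2 = 2 - 2 * cos x ^ 2 by
        rw [sin_sq]; ring]
      refine abs_defect_le (γ := ev C (8 * (x - x₀)) / scl) (N := n₃ / (scl * scl))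
        (E := n₁ / (scl * scl * scl)) ?_ (hA x hx') hwx
        (abs_two_mul_sq_sub_sq_le (abs_cos_le_one x) (hcos x hx') ?_) ?_ ?_ ?_
      · have h := abs_ev_le (padd (psmul 3 (pmul U U)) (padd (psmul 2 (pmul C C)) [-(scl * scl)]))
          ht0 ht1
        rw [hn₃] at h
        simp only [ev_padd, ev_psmul, ev_pmul, ev] at h
        push_cast at h
        rw [le_div_iff₀ (by positivity), ← abs_of_pos (mul_pos hS hS), ← abs_mul]
        refine le_of_eq_of_le ?_ h
        congr 1
        field_simp
        ring
      · rw [← mul_div_assoc, div_le_one hS]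
        exact_mod_cast h₈
      · have h := abs_ev_le (padd (psmul (-64 * (scl * scl)) (pder (pder U)))
          (pmul (padd (pmul U U) (padd (psmul 2 (pmul C C)) [-2 * (scl * scl)])) U)) ht0 ht1
        rw [hn₁] at h
        simp only [ev_padd, ev_psmul, ev_pmul, ev] at h
        push_cast at h
        rw [le_div_iff₀ (by positivity), ← abs_of_pos (mul_pos (mul_pos hS hS) hS), ← abs_mul]
        refine le_of_eq_of_le ?_ h
        congr 1
        field_simp
        ring
      · have h₃' : (n₃ : ℝ) + 3 * B * R + R * R + 5 * g * scl ≤ rho * scl := by exact_mod_cast h₃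
        rw [show (n₃ : ℝ) / (scl * scl) + 3 * (B / scl) * (R / scl) + (R / scl) ^ 2
          + 5 * (g / scl) = (n₃ + 3 * B * R + R * R + 5 * g * scl) / (scl * scl) by
            field_simp, div_le_div_iff₀ (by positivity) hS]
        nlinarith
      · have h₁' : (n₁ : ℝ) ≤ eps * (scl * scl) := by exact_mod_cast h₁
        have h₂' : (5 : ℝ) * g * B + eps * scl ≤ d * scl := by exact_mod_cast h₂
        have h1 : (n₁ : ℝ) / (scl * scl * scl) ≤ eps / scl := by
          rw [div_le_div_iff₀ (by positivity) hS]
          nlinarith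
        have h2 : 5 * ((g : ℝ) / scl) * (B / scl) + eps / scl ≤ d / scl := by
          rw [show 5 * ((g : ℝ) / scl) * (B / scl) + eps / scl
            = (5 * g * B + eps * scl) / (scl * scl) by field_simp,
            div_le_div_iff₀ (by positivity) hS]
          nlinarith
        linarith
    · intro x hx
      have ht0 : 0 ≤ 8 * (x - x₀) := by linarith [hx.1]
      have ht1 : 8 * (x - x₀) ≤ 1 := by linarith [hx.2]
      generalize 8 * (x - x₀) = t at ht0 ht1 ⊢
      have h₄' : (rho : ℝ) * e + 2 * scl * d < 16 * scl * s₁ := by exact_mod_cast h₄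
      have h₅' : (rho : ℝ) * (s₁ + s₂) ≤ 32 * scl * s₂ := by exact_mod_cast h₅
      have hs₂' : (0 : ℝ) ≤ s₂ := by exact_mod_cast h₆
      have hrho' : (0 : ℝ) ≤ rho := by exact_mod_cast hrho
      have h1 : (rho : ℝ) * (s₁ * t + s₂ * t ^ 2) ≤ 32 * scl * s₂ * t := by
        have h2 : t ^ 2 ≤ t := by nlinarith
        have h3 := mul_le_mul_of_nonneg_left h2 (mul_nonneg hrho' hs₂')
        have h4 := mul_le_mul_of_nonneg_right h₅' ht0
        linarith
      rw [show (rho : ℝ) / scl / 2 * ((e + s₁ * t + s₂ * t ^ 2) / scl) + d / scl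
        = (rho * e + rho * (s₁ * t + s₂ * t ^ 2) + 2 * scl * d) / (2 * scl) / scl by
          field_simp; ring]
      gcongr
      rw [div_lt_iff₀ (by positivity)]
      linarith
  refine ⟨fun x hx => hclamp x hx (hw x hx (key x hx)), ?_⟩
  have := key (x₀ + 1 / 8) ⟨by linarith, le_rfl⟩
  rw [show 8 * (x₀ + 1 / 8 - x₀) = 1 by ring] at this
  push_cast
  simpa using this

set_option maxHeartbeats 1000000 in
theorem step_sound {u v : ℝ → ℝ} (hs : IsSol_s3 u v) {i : ℕ} {st : St} {K : St → Bool}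
    (h : step i st K = true) (hE : Encl u v (i / 8) st) :
    ∃ st', K st' = true ∧ Encl u v ((i + 1 : ℕ) / 8) st' ∧
      ∀ x ∈ Set.Icc ((i : ℝ) / 8) ((i + 1 : ℕ) / 8), u x ^ 2 ≤ capR x := by
  have hS := scl_pos
  obtain ⟨he, hg, hu, hc⟩ := hE
  obtain ⟨a, b, h⟩ := gen_eq_true h
  simp only [List.reverse_cons, List.reverse_nil, List.nil_append, List.cons_append, forceInt_eq, forceList_eq, Bool.and_eq_true, decide_eq_true_eq] at h
  obtain ⟨⟨h₁, hn₂, h₂, h₃, h₄, h₅, h₆, h₇, h₈, h₉⟩, hK⟩ := h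
  generalize hU : st.u0 :: st.u1 :: a = U at *
  generalize hC : st.c0 :: st.c1 :: b = C at *
  have hU0 : ev U 0 = st.u0 := by simp [← hU, ev]
  have hU1 : ev (pder U) 0 = st.u1 := by simp [← hU, ev, pder, ev_padd]
  have hC0 : ev C 0 = st.c0 := by simp [← hC, ev]
  have hC1 : ev (pder C) 0 = st.c1 := by simp [← hC, ev, pder, ev_padd]
  generalize hn₂' : pnorm (padd (psmul 64 (pder (pder C))) C) = n₂ at *
  generalize hgg : st.g + n₂ / 8 + 1 = g at *
  have hn₂0 : 0 ≤ n₂ := hn₂' ▸ pnorm_nonneg _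
  have hgpos : 0 < g := by linarith
  have hx₀ : ((i + 1 : ℕ) : ℝ) / 8 = i / 8 + 1 / 8 := by push_cast; ring
  rw [hx₀]
  have hcos := cos_step (C := C) (x₀ := i / 8) (g' := g) hg (by rwa [hC0, hC1]) (hn₂' ▸ hn₂)
  have hcos' : ∀ x ∈ Set.Icc ((i : ℝ) / 8) (i / 8 + 1 / 8),
      |cos x - ev C (8 * (x - i / 8)) / scl| ≤ g / scl := by
    intro x hx
    have hgr : (0 : ℝ) < st.g := by exact_mod_cast hg
    have hgg' : (0 : ℝ) ≤ g - st.g := by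
      have : (0 : ℤ) ≤ g - st.g := by linarith
      exact_mod_cast this
    have ht0 : 0 ≤ 8 * (x - i / 8) := by linarith [hx.1]
    have ht1 : 8 * (x - i / 8) ≤ 1 := by linarith [hx.2]
    have h := hcos x hx
    have h1 : |cos x - ev C (8 * (x - i / 8)) / scl|
        ≤ (st.g + (g - st.g) * (8 * (x - i / 8))) / scl := by
      refine abs_le_of_sq_le_sq ?_ (by positivity)
      nlinarith [sq_nonneg (-sin x - 8 * ev (pder C) (8 * (x - i / 8)) / scl)]
    refine h1.trans ?_
    have := mul_le_of_le_one_right hgg' ht1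
    gcongr
    linarith
  generalize hB : pnorm U = B at *
  generalize hn₁ : pnorm (padd (psmul (-64 * (scl * scl)) (pder (pder U)))
    (pmul (padd (pmul U U) (padd (psmul 2 (pmul C C)) [-2 * (scl * scl)])) U)) = n₁ at *
  generalize hn₃ : pnorm (padd (psmul 3 (pmul U U)) (padd (psmul 2 (pmul C C)) [-(scl * scl)]))
    = n₃ at *
  generalize n₁ / (scl * scl) + 1 = eps at *
  generalize hd : eps + 5 * g * B / scl + 1 = d at *
  generalize hRR : 2 * st.e + d = R at *
  generalize (n₃ + 3 * B * R + R * R) / scl + 5 * g + 1 = rho at *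
  generalize rho * st.e / (16 * scl) + d / 8 + 2 = s₁ at *
  generalize rho * s₁ / (32 * scl - rho) + 1 = s₂ at *
  have hn₁0 : 0 ≤ n₁ := hn₁ ▸ pnorm_nonneg _
  have hB0 : 0 ≤ B := hB ▸ pnorm_nonneg _
  have hS' : 0 < scl := by norm_num [scl]
  have heps : 0 ≤ eps := by
    by_contra! h
    nlinarith [mul_pos hS' hS']
  have hd0 : 0 ≤ d := by
    have : 0 ≤ d * scl := le_trans (by positivity) h₂
    by_contra! h
    nlinarith
  have hcap : ∀ x ∈ Set.Icc ((i : ℝ) / 8) (i / 8 + 1 / 8),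
      (((B : ℝ) + R) / scl) ^ 2 ≤ capR x := by
    intro x hx
    have h₉' : (40 : ℝ) * ((B + R) * (B + R)) ≤ scl * scl * (4 + 5 * ((71 - i : ℕ) : ℝ)) := by
      exact_mod_cast h₉
    have h1 : (((B : ℝ) + R) / scl) ^ 2 ≤ 1 / 10 + ((71 - i : ℕ) : ℝ) / 8 := by
      rw [div_pow, div_le_iff₀ (by positivity)]
      linarith
    refine h1.trans (add_le_add le_rfl ?_)
    rcases le_total i 71 with hi | hi
    · refine le_max_of_le_right ?_
      have hi0 : (0 : ℝ) ≤ i := i.cast_nonneg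
      rw [Nat.cast_sub hi, abs_of_nonneg (by linarith [hx.1])]
      push_cast
      linarith [hx.2]
    · rw [Nat.sub_eq_zero_of_le hi]
      simp
  obtain ⟨hcl, hend⟩ := sol_step hs he hgpos hn₁ hn₃ hB (by rwa [hU0, hU1]) hcos' h₁ h₂ h₃ h₄ h₅ h₆
    h₇ h₈ (by linarith) hcap
  refine ⟨_, hK, ⟨?_, hgpos, ?_, ?_⟩, hcl⟩
  · have hrho : 0 ≤ rho := by
      have hn₃0 : 0 ≤ n₃ := hn₃ ▸ pnorm_nonneg _
      have hR0 : 0 ≤ R := by linarith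
      have : 0 ≤ rho * scl := le_trans (by positivity) h₃
      by_contra! h
      nlinarith
    have : 0 < 16 * scl * s₁ := lt_of_le_of_lt (by positivity) h₄
    show 0 < st.e + s₁ + s₂
    have : 0 < s₁ := by
      by_contra! h
      nlinarith
    linarith
  · simpa only [ev_one] using hend
  · have h := hcos (i / 8 + 1 / 8) ⟨by linarith, le_rfl⟩
    rw [show 8 * ((i : ℝ) / 8 + 1 / 8 - i / 8) = 1 by ring, ev_one, ev_one, mul_one,
      add_sub_cancel] at h
    exact h

theorem run_sound {u v : ℝ → ℝ} (hs : IsSol_s3 u v) {n i : ℕ} {st : St} {K : St → Bool}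
    (h : run n i st K = true) (hE : Encl u v (i / 8) st) :
    ∃ st', K st' = true ∧ Encl u v ((i + n : ℕ) / 8) st' ∧
      ∀ x ∈ Set.Ico ((i : ℝ) / 8) ((i + n : ℕ) / 8), u x ^ 2 ≤ capR x := by
  induction n generalizing i st with
  | zero =>
    refine ⟨st, h, hE, fun x hx => absurd (hx.1.trans_lt hx.2) ?_⟩
    simp
  | succ n ih =>
    obtain ⟨st₁, h₁, hE₁, hx₁⟩ := step_sound hs h hE
    obtain ⟨st₂, h₂, hE₂, hx₂⟩ := ih h₁ hE₁
    rw [show i + 1 + n = i + (n + 1) by ring] at hE₂ hx₂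
    refine ⟨st₂, h₂, hE₂, fun x hx => ?_⟩
    rcases le_total x ((i + 1 : ℕ) / 8) with h | h
    · exact hx₁ x ⟨hx.1, h⟩
    · exact hx₂ x ⟨h, hx.2⟩

/-- The final states of the certified integrations are compared with `s` by this test. -/
def isState (s t : St) : Bool :=
  decide (t.u0 = s.u0 ∧ t.u1 = s.u1 ∧ t.c0 = s.c0 ∧ t.c1 = s.c1 ∧ t.e = s.e ∧ t.g = s.g)

theorem isState_eq_true {s t : St} (h : isState s t = true) : t = s := by
  obtain ⟨h1, h2, h3, h4, h5, h6⟩ := of_decide_eq_true h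
  cases s
  cases t
  simp_all

set_option maxRecDepth 100000 in
theorem run_center : run 72 0 ⟨929793761691, 0, 1099511627776, 0, 41231688, 1⟩
    (isState ⟨158142033877, -13390265926, -1001798319566, -56641133413, 35870028981, 51236⟩)
    = true := by
  decide +kernel

set_option maxRecDepth 100000 in
theorem run_left : run 128 0 ⟨929752530005, 0, 1099511627776, 0, 1, 1⟩
    (isState ⟨-20375845759, -6699630143, -1052957736333, 39569130560, 727516156, 88873⟩)
    = true := by
  decide +kernel

set_option maxRecDepth 100000 in
theorem run_right : run 128 0 ⟨929834993377, 0, 1099511627776, 0, 1, 1⟩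
    (isState ⟨51966237797, 300605277, -1052957736333, 39569130560, 755798475, 88873⟩)
    = true := by
  decide +kernel

section GlobalODE

variable {F : Type*} [NormedAddCommGroup F] [NormedSpace ℝ F]

theorem norm_integral_le_exp {g : ℝ → F} {c l : ℝ} (hl : 0 < l)
    (h : ∀ s, ‖g s‖ ≤ c * exp (l * |s|)) (t : ℝ) :
    ‖∫ s in (0 : ℝ)..t, g s‖ ≤ c / l * exp (l * |t|) := by
  have hc : 0 ≤ c := by
    have := (norm_nonneg _).trans (h 0)
    simpa using this
  have key : ∀ g : ℝ → F, (∀ s, ‖g s‖ ≤ c * exp (l * |s|)) → ∀ t, 0 ≤ t →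
      ‖∫ s in (0 : ℝ)..t, g s‖ ≤ c / l * exp (l * |t|) := by
    intro g h t ht
    have hd : ∀ s ∈ Set.uIcc 0 t, HasDerivAt (fun s => c / l * exp (l * s)) (c * exp (l * s)) s := by
      intro s _
      refine ((((hasDerivAt_id s).const_mul l).exp).const_mul (c / l)).congr_deriv ?_
      simp only [id]
      field_simp
    have hi : Continuous fun s => c * exp (l * s) := by fun_prop
    have h1 : ‖∫ s in (0 : ℝ)..t, g s‖ ≤ ∫ s in (0 : ℝ)..t, c * exp (l * s) := by
      refine intervalIntegral.norm_integral_le_of_norm_le ht (Eventually.of_forall fun s hs => ?_)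
        (hi.intervalIntegrable _ _)
      have := h s
      rwa [abs_of_pos hs.1] at this
    rw [intervalIntegral.integral_eq_sub_of_hasDerivAt hd (hi.intervalIntegrable _ _)] at h1
    rw [abs_of_nonneg ht]
    have : 0 ≤ c / l * exp (l * 0) := by positivity
    linarith
  rcases le_total 0 t with ht | ht
  · exact key g h t ht
  · have h1 := key (fun s => g (-s)) (fun s => by simpa using h (-s)) (-t) (by linarith)
    rw [intervalIntegral.integral_comp_neg, neg_neg, neg_zero, intervalIntegral.integral_symm,
      norm_neg, abs_neg] at h1
    exact h1

open BoundedContinuousFunction in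
/-- A globally Lipschitz differential equation fixing zero has global solutions. -/
theorem exists_global_solution [CompleteSpace F] {f : ℝ → F → F}
    (hf : Continuous (Function.uncurry f)) {K : ℝ} (hK : 0 < K)
    (hL : ∀ t x y, ‖f t x - f t y‖ ≤ K * ‖x - y‖) (h0 : ∀ t, f t 0 = 0) (y₀ : F) :
    ∃ y : ℝ → F, y 0 = y₀ ∧ ∀ t, HasDerivAt y (f t (y t)) t := by
  have hl : 0 < 2 * K := by positivity
  have hcont : ∀ z : ℝ →ᵇ F, Continuous fun s => f s (exp (2 * K * |s|) • z s) := fun z =>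
    hf.comp (continuous_id.prodMk (by fun_prop))
  have hcancel : ∀ t : ℝ, exp (-(2 * K * |t|)) * exp (2 * K * |t|) = 1 := fun t => by
    rw [← exp_add]; simp
  have hz_deriv : ∀ z : ℝ →ᵇ F, ∀ t, HasDerivAt
      (fun t => y₀ + ∫ s in (0 : ℝ)..t, f s (exp (2 * K * |s|) • z s))
      (f t (exp (2 * K * |t|) • z t)) t := fun z t =>
    (intervalIntegral.integral_hasDerivAt_right ((hcont z).intervalIntegrable _ _)
      ((hcont z).stronglyMeasurableAtFilter _ _) (hcont z).continuousAt).const_add y₀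
  have hbound : ∀ z w : ℝ →ᵇ F, ∀ t,
      ‖∫ s in (0 : ℝ)..t, (f s (exp (2 * K * |s|) • z s) - f s (exp (2 * K * |s|) • w s))‖
        ≤ K * dist z w / (2 * K) * exp (2 * K * |t|) := by
    intro z w
    refine norm_integral_le_exp hl fun s => (hL _ _ _).trans ?_
    rw [← smul_sub, norm_smul, norm_of_nonneg (exp_pos _).le, ← dist_eq_norm]
    have := z.dist_coe_le_dist (g := w) s
    have he := exp_pos (2 * K * |s|)
    calc K * (exp (2 * K * |s|) * dist (z s) (w s))
        ≤ K * (exp (2 * K * |s|) * dist z w) := by gcongr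
      _ = _ := by ring
  have hnorm : ∀ z : ℝ →ᵇ F, ∀ t,
      ‖exp (-(2 * K * |t|)) • (y₀ + ∫ s in (0 : ℝ)..t, f s (exp (2 * K * |s|) • z s))‖
        ≤ ‖y₀‖ + K * dist z 0 / (2 * K) := by
    intro z t
    have h1 := hbound z 0 t
    simp only [BoundedContinuousFunction.coe_zero, Pi.zero_apply, smul_zero, h0, sub_zero] at h1
    rw [norm_smul, norm_of_nonneg (exp_pos _).le]
    have he : exp (-(2 * K * |t|)) ≤ 1 := exp_le_one_iff.2 (by have := abs_nonneg t; nlinarith)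
    have he0 := (exp_pos (-(2 * K * |t|))).le
    calc _ ≤ exp (-(2 * K * |t|)) * (‖y₀‖ + K * dist z 0 / (2 * K) * exp (2 * K * |t|)) := by
          gcongr
          exact (norm_add_le _ _).trans (by gcongr)
      _ = exp (-(2 * K * |t|)) * ‖y₀‖
          + K * dist z 0 / (2 * K) * (exp (-(2 * K * |t|)) * exp (2 * K * |t|)) := by ring
      _ ≤ _ := by
          rw [hcancel, mul_one]
          gcongr
          exact mul_le_of_le_one_left (norm_nonneg _) he
  let Φ : (ℝ →ᵇ F) → (ℝ →ᵇ F) := fun z => BoundedContinuousFunction.ofNormedAddCommGroup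
    (fun t => exp (-(2 * K * |t|)) • (y₀ + ∫ s in (0 : ℝ)..t, f s (exp (2 * K * |s|) • z s)))
    ((by fun_prop : Continuous fun t : ℝ => exp (-(2 * K * |t|))).smul
      (continuous_iff_continuousAt.2 fun t => (hz_deriv z t).continuousAt)) _ (hnorm z)
  have hΦ : ContractingWith (1 / 2) Φ := by
    refine ⟨by norm_num, LipschitzWith.of_dist_le_mul fun z w => ?_⟩
    refine (BoundedContinuousFunction.dist_le (by positivity)).2 fun t => ?_
    simp only [Φ, BoundedContinuousFunction.coe_ofNormedAddCommGroup]
    rw [dist_eq_norm, ← smul_sub, add_sub_add_left_eq_sub, ← intervalIntegral.integral_sub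
      ((hcont z).intervalIntegrable _ _) ((hcont w).intervalIntegrable _ _), norm_smul,
      norm_of_nonneg (exp_pos _).le]
    calc _ ≤ exp (-(2 * K * |t|)) * (K * dist z w / (2 * K) * exp (2 * K * |t|)) := by
          gcongr
          exact hbound z w t
      _ = K * dist z w / (2 * K) * (exp (-(2 * K * |t|)) * exp (2 * K * |t|)) := by ring
      _ = _ := by
          rw [hcancel]
          push_cast
          field_simp
  obtain ⟨z, hz⟩ : ∃ z, Φ z = z := ⟨_, hΦ.fixedPoint_isFixedPt⟩
  have hzt : ∀ t, exp (2 * K * |t|) • z t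
      = y₀ + ∫ s in (0 : ℝ)..t, f s (exp (2 * K * |s|) • z s) := by
    intro t
    conv_lhs => rw [← hz]
    simp only [Φ, BoundedContinuousFunction.coe_ofNormedAddCommGroup]
    rw [smul_smul, mul_comm, hcancel, one_smul]
  refine ⟨fun t => y₀ + ∫ s in (0 : ℝ)..t, f s (exp (2 * K * |s|) • z s), by simp, fun t => ?_⟩
  have := hz_deriv z t
  rwa [hzt t] at this

end GlobalODE

theorem floquet_sq_le {z : ℝ} (h0 : 0 ≤ z) (h1 : z ≤ 1) :
    z * (13006 / 10000 - 3022 / 10000 * z) ^ 2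
      + (1 - z) * (7682 / 10000 + 1703 / 10000 * (1 - z)) ^ 2 ≤ 106 / 100 := by
  have hy : 0 ≤ 1 - z := by linarith
  nlinarith [mul_nonneg h0 hy, mul_nonneg (mul_nonneg h0 h0) hy, mul_nonneg h0 (mul_nonneg hy hy),
    mul_nonneg h0 (sq_nonneg (z - 7 / 10)), mul_nonneg hy (sq_nonneg (z - 7 / 10))]

theorem wronskian_lower {z : ℝ} (h0 : 0 ≤ z) (h1 : z ≤ 1) :
    2 ≤ 2 * (z * (13006 / 10000 - 3022 / 10000 * z) *
        (2431 / 10000 * (13006 / 10000 - 3022 / 10000 * z)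
          + (7682 / 10000 + 3 * (1703 / 10000) * (1 - z)))
      + (1 - z) * (7682 / 10000 + 1703 / 10000 * (1 - z)) *
        ((13006 / 10000 - 3 * (3022 / 10000) * z)
          - 2431 / 10000 * (7682 / 10000 + 1703 / 10000 * (1 - z)))) := by
  have hy : 0 ≤ 1 - z := by linarith
  nlinarith [mul_nonneg h0 hy, mul_nonneg (mul_nonneg h0 h0) hy, mul_nonneg h0 (mul_nonneg hy hy),
    pow_nonneg h0 3, pow_nonneg hy 3]

theorem residual_sq_le {z : ℝ} (h0 : 0 ≤ z) (h1 : z ≤ 1) :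
    z * (186160771566 / 1000000000000 - 752058877742 / 1000000000000 * z + 6044 / 10000 * z ^ 2) ^ 2 + 
    (1 - z) * (-21011386985 / 1000000000000 + 254175402983 / 1000000000000 * z - 3406 / 10000 * z ^ 2) ^ 2
     ≤ 25 / 10000 := by
  have hy : 0 ≤ 1 - z := by linarith
  nlinarith [mul_nonneg hy (sq_nonneg (16*z^2-12*z+1)), mul_nonneg h0 (sq_nonneg (16*(1-z)^2-12*(1-z)+1)), mul_nonneg h0 (sq_nonneg (16*z^2-20*z+5)), mul_nonneg hy (sq_nonneg (16*(1-z)^2-20*(1-z)+5)), mul_nonneg h0 hy, mul_nonneg h0 (sq_nonneg (z - 1/2)),mul_nonneg hy (sq_nonneg (z - 1/2))]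

/-- The even part of an approximate decaying Floquet solution of `u'' + 2 sin² x u = 0`, stripped of
its exponential factor. -/
noncomputable def flE (x : ℝ) : ℝ := cos x * (13006 / 10000 - 3022 / 10000 * cos x ^ 2)

/-- The odd part of the same function. -/
noncomputable def flO (x : ℝ) : ℝ := -(sin x * (7682 / 10000 + 1703 / 10000 * sin x ^ 2))

/-- The derivative of `flE`. -/
noncomputable def flE' (x : ℝ) : ℝ := -(sin x * (13006 / 10000 - 3 * (3022 / 10000) * cos x ^ 2))

/-- The derivative of `flO`. -/
noncomputable def flO' (x : ℝ) : ℝ := -(cos x * (7682 / 10000 + 3 * (1703 / 10000) * sin x ^ 2))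

/-- The even part of the residual of the approximate Floquet solution. -/
noncomputable def resE (x : ℝ) : ℝ :=
  cos x * (186160771566 / 1000000000000 - 752058877742 / 1000000000000 * cos x ^ 2
    + 6044 / 10000 * cos x ^ 4)

/-- The odd part of the residual of the approximate Floquet solution. -/
noncomputable def resO (x : ℝ) : ℝ :=
  sin x * (-21011386985 / 1000000000000 + 254175402983 / 1000000000000 * cos x ^ 2
    - 3406 / 10000 * cos x ^ 4)

theorem hasDerivAt_flE (x : ℝ) : HasDerivAt flE (flE' x) x := by
  have h := (hasDerivAt_cos x).mul (((hasDerivAt_cos x).pow 2).const_mul (3022 / 10000)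
    |>.const_sub (13006 / 10000))
  refine h.congr_deriv ?_
  simp only [flE', Pi.pow_apply]
  push_cast
  ring

theorem hasDerivAt_flO (x : ℝ) : HasDerivAt flO (flO' x) x := by
  have h := ((hasDerivAt_sin x).mul (((hasDerivAt_sin x).pow 2).const_mul (1703 / 10000)
    |>.const_add (7682 / 10000))).neg
  refine h.congr_deriv ?_
  simp only [flO', Pi.pow_apply]
  push_cast
  ring

theorem hasDerivAt_flE' (x : ℝ) :
    HasDerivAt flE' (resE x + 2 * (2431 / 10000) * flO' x
      - ((2431 / 10000) ^ 2 + 2 * sin x ^ 2) * flE x) x := by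
  have h := ((hasDerivAt_sin x).mul (((hasDerivAt_cos x).pow 2).const_mul (3 * (3022 / 10000))
    |>.const_sub (13006 / 10000))).neg
  refine h.congr_deriv ?_
  have hs : sin x ^ 2 = 1 - cos x ^ 2 := sin_sq x
  simp only [resE, flO', flE, Pi.pow_apply]
  push_cast
  linear_combination (cos x * (-6 * (3022 / 10000) + 2 * (13006 / 10000) - 2 * (3022 / 10000) * cos x ^ 2 + 6 * (2431 / 10000) * (1703 / 10000))) * hs

theorem hasDerivAt_flO' (x : ℝ) :
    HasDerivAt flO' (resO x + 2 * (2431 / 10000) * flE' x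
      - ((2431 / 10000) ^ 2 + 2 * sin x ^ 2) * flO x) x := by
  have h := ((hasDerivAt_cos x).mul (((hasDerivAt_sin x).pow 2).const_mul (3 * (1703 / 10000))
    |>.const_add (7682 / 10000))).neg
  refine h.congr_deriv ?_
  have hs : cos x ^ 2 = 1 - sin x ^ 2 := cos_sq' x
  simp only [resO, flE', flO, Pi.pow_apply]
  push_cast
  rw [show cos x ^ 4 = (cos x ^ 2) ^ 2 by ring]
  rw [show -(-sin x * (7682 / 10000 + 3 * (1703 / 10000) * sin x ^ 2) + cos x * (3 * (1703 / 10000) * (2 * sin x ^ (2 - 1) * cos x))) = -(-sin x * (7682 / 10000 + 3 * (1703 / 10000) * sin x ^ 2) + cos x ^ 2 * (3 * (1703 / 10000) * (2 * sin x ))) by ring]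
  rw [hs]
  ring

theorem fl_sq_le (x : ℝ) : flE x ^ 2 + flO x ^ 2 ≤ 106 / 100 := by
  have h := floquet_sq_le (sq_nonneg (cos x)) (cos_sq_le_one x)
  have hs : 1 - cos x ^ 2 = sin x ^ 2 := (sin_sq x).symm
  rw [hs] at h
  simp only [flE, flO]
  linarith

theorem res_sq_le (x : ℝ) : resE x ^ 2 + resO x ^ 2 ≤ 25 / 10000 := by
  have h := residual_sq_le (sq_nonneg (cos x)) (cos_sq_le_one x)
  have hs : 1 - cos x ^ 2 = sin x ^ 2 := (sin_sq x).symm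
  rw [hs] at h
  simp only [resE, resO]
  linarith

/-- Half the Wronskian-type determinant of the two approximate Floquet solutions. -/
noncomputable def flD (x : ℝ) : ℝ :=
  2 * (flE x * (2431 / 10000 * flE x - flO' x) + flO x * (flE' x - 2431 / 10000 * flO x))

theorem two_le_flD (x : ℝ) : 2 ≤ flD x := by
  have h := wronskian_lower (sq_nonneg (cos x)) (cos_sq_le_one x)
  have hs : 1 - cos x ^ 2 = sin x ^ 2 := (sin_sq x).symm
  rw [hs] at h
  simp only [flD, flE, flO, flE', flO']
  linarith

/-- The coordinate of `(u, v)` along the approximate growing direction. -/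
noncomputable def ca (x u v : ℝ) : ℝ :=
  u * (flE' x + flO' x - 2431 / 10000 * (flE x + flO x)) - v * (flE x + flO x)

/-- The coordinate of `(u, v)` along the approximate decaying direction. -/
noncomputable def cb (x u v : ℝ) : ℝ :=
  u * (flE' x - flO' x + 2431 / 10000 * (flE x - flO x)) - v * (flE x - flO x)

theorem hasDerivAt_ca {u v : ℝ → ℝ} {r x : ℝ} (hu : HasDerivAt u (v x) x)
    (hv : HasDerivAt v ((r - 2 * sin x ^ 2) * u x) x) :
    HasDerivAt (fun x => ca x (u x) (v x)) (2431 / 10000 * ca x (u x) (v x)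
      + u x * (resE x + resO x - r * (flE x + flO x))) x := by
  have h1 := (hasDerivAt_flE x).add (hasDerivAt_flO x)
  have h2 := (hasDerivAt_flE' x).add (hasDerivAt_flO' x)
  refine ((hu.mul (h2.sub (h1.const_mul (2431 / 10000)))).sub (hv.mul h1)).congr_deriv ?_
  simp only [ca, Pi.add_apply, Pi.sub_apply]
  ring

theorem hasDerivAt_cb {u v : ℝ → ℝ} {r x : ℝ} (hu : HasDerivAt u (v x) x)
    (hv : HasDerivAt v ((r - 2 * sin x ^ 2) * u x) x) :
    HasDerivAt (fun x => cb x (u x) (v x)) (-(2431 / 10000) * cb x (u x) (v x)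
      + u x * (resE x - resO x - r * (flE x - flO x))) x := by
  have h1 := (hasDerivAt_flE x).sub (hasDerivAt_flO x)
  have h2 := (hasDerivAt_flE' x).sub (hasDerivAt_flO' x)
  refine ((hu.mul (h2.add (h1.const_mul (2431 / 10000)))).sub (hv.mul h1)).congr_deriv ?_
  simp only [cb, Pi.add_apply, Pi.sub_apply]
  ring

theorem flD_mul_left (x u v : ℝ) :
    flD x * u = (flE x + flO x) * cb x u v - (flE x - flO x) * ca x u v := by
  simp only [flD, ca, cb]
  ring

theorem flD_mul_right (x u v : ℝ) :
    flD x * v = (flE' x + flO' x - 2431 / 10000 * (flE x + flO x)) * cb x u v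
      - (flE' x - flO' x + 2431 / 10000 * (flE x - flO x)) * ca x u v := by
  simp only [flD, ca, cb]
  ring

theorem sq_le_of_coords (x u v : ℝ) :
    u ^ 2 ≤ 53 / 100 * (ca x u v ^ 2 + cb x u v ^ 2) := by
  have h := flD_mul_left x u v
  have hD := two_le_flD x
  have hf := fl_sq_le x
  set a := ca x u v
  set b := cb x u v
  have h1 : (flD x * u) ^ 2 ≤ 2 * (flE x ^ 2 + flO x ^ 2) * (a ^ 2 + b ^ 2) := by
    rw [h]
    nlinarith [sq_nonneg ((flE x + flO x) * a + (flE x - flO x) * b)]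
  have h2 : 4 * u ^ 2 ≤ (flD x * u) ^ 2 := by
    rw [mul_pow]
    exact mul_le_mul_of_nonneg_right (by nlinarith) (sq_nonneg u)
  have h3 : 0 ≤ a ^ 2 + b ^ 2 := by positivity
  nlinarith [mul_le_mul_of_nonneg_right hf h3]

theorem perturbation_sq_le (x : ℝ) {r : ℝ} (h0 : 0 ≤ r) (h1 : r ≤ 1 / 10) :
    (resE x + resO x - r * (flE x + flO x)) ^ 2 + (resE x - resO x - r * (flE x - flO x)) ^ 2
      ≤ 47 / 1000 := by
  have hf := fl_sq_le x
  have hr := res_sq_le x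
  have h2 : r ^ 2 * (flE x ^ 2 + flO x ^ 2) ≤ 1 / 100 * (106 / 100) :=
    mul_le_mul (by nlinarith) hf (by positivity) (by norm_num)
  nlinarith [sq_nonneg (2 * resE x + r * flE x), sq_nonneg (2 * resO x + r * flO x)]

theorem abs_mul_perturbation_le (x u v : ℝ) {r : ℝ} (h0 : 0 ≤ r) (h1 : r ≤ 1 / 10) :
    |u * ((resE x + resO x - r * (flE x + flO x)) * ca x u v
      - (resE x - resO x - r * (flE x - flO x)) * cb x u v)|
      ≤ 16 / 100 * (ca x u v ^ 2 + cb x u v ^ 2) := by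
  have hu := sq_le_of_coords x u v
  have hp := perturbation_sq_le x h0 h1
  set a := ca x u v
  set b := cb x u v
  set X := resE x + resO x - r * (flE x + flO x)
  set Y := resE x - resO x - r * (flE x - flO x)
  have hN : 0 ≤ a ^ 2 + b ^ 2 := by positivity
  refine abs_le_of_sq_le_sq ?_ (by positivity)
  have h2 : (X * a - Y * b) ^ 2 ≤ 47 / 1000 * (a ^ 2 + b ^ 2) := by
    nlinarith [sq_nonneg (X * b + Y * a), mul_le_mul_of_nonneg_right hp hN]
  calc (u * (X * a - Y * b)) ^ 2 = u ^ 2 * (X * a - Y * b) ^ 2 := mul_pow _ _ _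
    _ ≤ (53 / 100 * (a ^ 2 + b ^ 2)) * (47 / 1000 * (a ^ 2 + b ^ 2)) :=
      mul_le_mul hu h2 (sq_nonneg _) (by positivity)
    _ ≤ (16 / 100 * (a ^ 2 + b ^ 2)) ^ 2 := by nlinarith [mul_nonneg hN hN]

theorem abs_mul_perturbation_le_of_cone (x u v : ℝ) {r : ℝ} (h0 : 0 ≤ r) (h1 : r ≤ 1 / 10)
    (hc : ca x u v ^ 2 ≤ cb x u v ^ 2) :
    |u * (resE x - resO x - r * (flE x - flO x)) * cb x u v| ≤ 23 / 100 * cb x u v ^ 2 := by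
  have hu := sq_le_of_coords x u v
  have hp := perturbation_sq_le x h0 h1
  set b := cb x u v
  set Y := resE x - resO x - r * (flE x - flO x)
  have hu' : u ^ 2 ≤ 106 / 100 * b ^ 2 := by linarith
  have hY : Y ^ 2 ≤ 47 / 1000 := by nlinarith [sq_nonneg (resE x + resO x - r * (flE x + flO x))]
  refine abs_le_of_sq_le_sq ?_ (by positivity)
  calc (u * Y * b) ^ 2 = u ^ 2 * Y ^ 2 * b ^ 2 := by ring
    _ ≤ (106 / 100 * b ^ 2) * (47 / 1000) * b ^ 2 := by gcongr
    _ ≤ (23 / 100 * b ^ 2) ^ 2 := by nlinarith [mul_nonneg (sq_nonneg b) (sq_nonneg b)]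

section Tail

variable {u v r : ℝ → ℝ} {x₀ : ℝ}

theorem monotoneOn_cone (hu : ∀ x, HasDerivAt u (v x) x)
    (hv : ∀ x, HasDerivAt v ((r x - 2 * sin x ^ 2) * u x) x)
    (hr : ∀ x, x₀ ≤ x → 0 ≤ r x ∧ r x ≤ 1 / 10) :
    MonotoneOn (fun x => ca x (u x) (v x) ^ 2 - cb x (u x) (v x) ^ 2) (Set.Ici x₀) := by
  have hd : ∀ x, HasDerivAt (fun x => ca x (u x) (v x) ^ 2 - cb x (u x) (v x) ^ 2) _ x :=
    fun x => ((hasDerivAt_ca (hu x) (hv x)).pow 2).sub ((hasDerivAt_cb (hu x) (hv x)).pow 2)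
  refine monotoneOn_of_deriv_nonneg (convex_Ici x₀)
    (fun x _ => (hd x).continuousAt.continuousWithinAt)
    (fun x _ => (hd x).differentiableAt.differentiableWithinAt) fun x hx => ?_
  rw [interior_Ici] at hx
  obtain ⟨h0, h1⟩ := hr x hx.le
  have h := neg_le_of_abs_le (abs_mul_perturbation_le x (u x) (v x) h0 h1)
  have hN : 0 ≤ ca x (u x) (v x) ^ 2 + cb x (u x) (v x) ^ 2 := by positivity
  rw [(hd x).deriv]
  push_cast
  nlinarith

theorem cb_sq_le (hu : ∀ x, HasDerivAt u (v x) x)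
    (hv : ∀ x, HasDerivAt v ((r x - 2 * sin x ^ 2) * u x) x)
    (hr : ∀ x, x₀ ≤ x → 0 ≤ r x ∧ r x ≤ 1 / 10)
    (hc : ∀ x, x₀ ≤ x → ca x (u x) (v x) ^ 2 ≤ cb x (u x) (v x) ^ 2) {x : ℝ} (hx : x₀ ≤ x) :
    cb x (u x) (v x) ^ 2 ≤ cb x₀ (u x₀) (v x₀) ^ 2 * exp (-(1 / 50 * (x - x₀))) := by
  have hd : ∀ x, HasDerivAt (fun x => cb x (u x) (v x) ^ 2 * exp (1 / 50 * (x - x₀))) _ x :=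
    fun x => ((hasDerivAt_cb (hu x) (hv x)).pow 2).mul
      ((((hasDerivAt_id x).sub_const x₀).const_mul (1 / 50)).exp)
  have hm : AntitoneOn (fun x => cb x (u x) (v x) ^ 2 * exp (1 / 50 * (x - x₀))) (Set.Ici x₀) := by
    refine antitoneOn_of_deriv_nonpos (convex_Ici x₀)
      (fun x _ => (hd x).continuousAt.continuousWithinAt)
      (fun x _ => (hd x).differentiableAt.differentiableWithinAt) fun x hx => ?_
    rw [interior_Ici] at hx
    obtain ⟨h0, h1⟩ := hr x hx.le
    have h := le_of_abs_le (abs_mul_perturbation_le_of_cone x (u x) (v x) h0 h1 (hc x hx.le))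
    rw [(hd x).deriv]
    have he := exp_pos (1 / 50 * (x - x₀))
    have hb := sq_nonneg (cb x (u x) (v x))
    simp only [id, Pi.pow_apply]
    push_cast
    have : 2 * (-(2431 / 10000) * cb x (u x) (v x) ^ 2
        + u x * (resE x - resO x - r x * (flE x - flO x)) * cb x (u x) (v x))
        + 1 / 50 * cb x (u x) (v x) ^ 2 ≤ 0 := by linarith
    have := mul_nonpos_of_nonpos_of_nonneg this he.le
    nlinarith
  have h := hm Set.self_mem_Ici hx hx
  simp only [sub_self, mul_zero, exp_zero, mul_one] at h
  rw [exp_neg, ← div_eq_mul_inv, le_div_iff₀ (exp_pos _)]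
  exact h

theorem abs_fl_le (x : ℝ) : |flE x| ≤ 3 ∧ |flO x| ≤ 3 ∧ |flE' x| ≤ 3 ∧ |flO' x| ≤ 3 := by
  have hc := abs_cos_le_one x
  have hs := abs_sin_le_one x
  have hc2 := cos_sq_le_one x
  have hs2 := sin_sq_le_one x
  have hc0 := sq_nonneg (cos x)
  have hs0 := sq_nonneg (sin x)
  simp only [flE, flO, flE', flO', abs_neg, abs_mul]
  refine ⟨?_, ?_, ?_, ?_⟩ <;>
  · rw [show (3 : ℝ) = 1 * 3 by norm_num]
    refine mul_le_mul (by assumption) (abs_le.2 ⟨by linarith, by linarith⟩) (abs_nonneg _) zero_le_one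

theorem sq_le_of_coords_right (x u v : ℝ) : v ^ 2 ≤ 100 * (ca x u v ^ 2 + cb x u v ^ 2) := by
  have h := flD_mul_right x u v
  have hD := two_le_flD x
  obtain ⟨h1, h2, h3, h4⟩ := abs_fl_le x
  rw [abs_le] at h1 h2 h3 h4
  set a := ca x u v
  set b := cb x u v
  set p := flE' x + flO' x - 2431 / 10000 * (flE x + flO x)
  set q := flE' x - flO' x + 2431 / 10000 * (flE x - flO x)
  have hp : p ^ 2 ≤ 100 := by
    have : |p| ≤ 10 := abs_le.2 ⟨by simp only [p]; linarith, by simp only [p]; linarith⟩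
    nlinarith [sq_abs p, abs_nonneg p]
  have hq : q ^ 2 ≤ 100 := by
    have : |q| ≤ 10 := abs_le.2 ⟨by simp only [q]; linarith, by simp only [q]; linarith⟩
    nlinarith [sq_abs q, abs_nonneg q]
  have h5 : (flD x * v) ^ 2 ≤ (p ^ 2 + q ^ 2) * (a ^ 2 + b ^ 2) := by
    rw [h]
    nlinarith [sq_nonneg (p * a + q * b)]
  have h6 : 4 * v ^ 2 ≤ (flD x * v) ^ 2 := by
    rw [mul_pow]
    exact mul_le_mul_of_nonneg_right (by nlinarith) (sq_nonneg v)
  nlinarith [mul_nonneg (sub_nonneg.2 hp) (add_nonneg (sq_nonneg a) (sq_nonneg b)),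
    mul_nonneg (sub_nonneg.2 hq) (add_nonneg (sq_nonneg a) (sq_nonneg b)), sq_nonneg a, sq_nonneg b]

theorem tendsto_zero_of_cone (hu : ∀ x, HasDerivAt u (v x) x)
    (hv : ∀ x, HasDerivAt v ((r x - 2 * sin x ^ 2) * u x) x)
    (hr : ∀ x, x₀ ≤ x → 0 ≤ r x ∧ r x ≤ 1 / 10)
    (hc : ∀ x, x₀ ≤ x → ca x (u x) (v x) ^ 2 ≤ cb x (u x) (v x) ^ 2) :
    Tendsto u atTop (nhds 0) ∧ Tendsto v atTop (nhds 0) := by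
  have he : Tendsto (fun x => cb x₀ (u x₀) (v x₀) ^ 2 * exp (-(1 / 50 * (x - x₀))))
      atTop (nhds 0) := by
    have : Tendsto (fun x : ℝ => 1 / 50 * (x - x₀)) atTop atTop :=
      (tendsto_atTop_add_const_right _ (-x₀) tendsto_id).const_mul_atTop (by norm_num)
    simpa using (tendsto_exp_neg_atTop_nhds_zero.comp this).const_mul (cb x₀ (u x₀) (v x₀) ^ 2)
  have key : ∀ w : ℝ → ℝ,
      (∀ x, w x ^ 2 ≤ 100 * (ca x (u x) (v x) ^ 2 + cb x (u x) (v x) ^ 2)) →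
      Tendsto w atTop (nhds 0) := by
    intro w hw
    have h2 : Tendsto (fun x => w x ^ 2) atTop (nhds 0) := by
      refine squeeze_zero' (Eventually.of_forall fun x => sq_nonneg _) ?_
        (by simpa using he.const_mul 200)
      filter_upwards [eventually_ge_atTop x₀] with x hx
      have h1 := cb_sq_le hu hv hr hc hx
      have h2 := hc x hx
      have h3 := hw x
      linarith
    have h3 := h2.sqrt
    simp only [sqrt_sq_eq_abs, sqrt_zero] at h3
    exact (tendsto_zero_iff_abs_tendsto_zero w).2 h3
  refine ⟨key u fun x => ?_, key v fun x => sq_le_of_coords_right x _ _⟩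
  have := sq_le_of_coords x (u x) (v x)
  nlinarith [sq_nonneg (ca x (u x) (v x)), sq_nonneg (cb x (u x) (v x))]

end Tail

theorem capR_bounds (x : ℝ) : 1 / 10 ≤ capR x ∧ capR x ≤ 91 / 10 := by
  have h : |x| ≥ 0 := abs_nonneg x
  refine ⟨le_add_of_nonneg_right (le_max_left _ _), ?_⟩
  have : max 0 (9 - |x|) ≤ 9 := max_le (by norm_num) (by linarith)
  rw [capR]
  linarith

theorem abs_min_sq_mul_sub_le {R : ℝ} (hR : 0 ≤ R) (u w : ℝ) :
    |min (u ^ 2) R * u - min (w ^ 2) R * w| ≤ 3 * R * |u - w| := by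
  have mixed : ∀ u w : ℝ, u ^ 2 ≤ R → R ≤ w ^ 2 → |u ^ 2 * u - R * w| ≤ 3 * R * |u - w| := by
    intro u w hu hw
    obtain ⟨s, hs, rfl⟩ : ∃ s, 0 ≤ s ∧ R = s ^ 2 := ⟨√R, sqrt_nonneg R, (sq_sqrt hR).symm⟩
    have hu' : |u| ≤ s := abs_le_of_sq_le_sq hu hs
    have hw' : s ≤ |w| := by
      rw [← abs_of_nonneg hs]
      exact sq_le_sq.1 hw
    have h1 : s - |u| ≤ |u - w| := by
      have := abs_sub_abs_le_abs_sub w u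
      rw [abs_sub_comm] at this
      linarith
    have h2 : |(s ^ 2 - u ^ 2) * u| ≤ 2 * s ^ 2 * |u - w| := by
      rw [abs_mul, abs_of_nonneg (by linarith), ← sq_abs u]
      have h3 : (s - |u|) * ((s + |u|) * |u|) ≤ |u - w| * ((s + s) * s) := by
        have := abs_nonneg u
        gcongr
      nlinarith
    calc |u ^ 2 * u - s ^ 2 * w| = |s ^ 2 * (u - w) + -((s ^ 2 - u ^ 2) * u)| := by ring_nf
      _ ≤ |s ^ 2 * (u - w)| + |-((s ^ 2 - u ^ 2) * u)| := abs_add_le _ _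
      _ ≤ s ^ 2 * |u - w| + 2 * s ^ 2 * |u - w| := by
        rw [abs_neg, abs_mul, abs_of_nonneg hR]
        gcongr
      _ = 3 * s ^ 2 * |u - w| := by ring
  rcases le_total (u ^ 2) R with hu | hu <;> rcases le_total (w ^ 2) R with hw | hw
  · rw [min_eq_left hu, min_eq_left hw, show u ^ 2 * u - w ^ 2 * w
      = (u ^ 2 + u * w + w ^ 2) * (u - w) by ring, abs_mul]
    gcongr
    rw [abs_le]
    constructor <;> nlinarith [sq_nonneg (u - w), sq_nonneg (u + w)]
  · rw [min_eq_left hu, min_eq_right hw]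
    exact mixed u w hu hw
  · rw [min_eq_right hu, min_eq_left hw, abs_sub_comm, abs_sub_comm u]
    exact mixed w u hw hu
  · rw [min_eq_right hu, min_eq_right hw, ← mul_sub, abs_mul, abs_of_nonneg hR]
    nlinarith [mul_nonneg hR (abs_nonneg (u - w))]

/-- The vector field of the truncated equation. -/
noncomputable def field (x : ℝ) (p : ℝ × ℝ) : ℝ × ℝ :=
  (p.2, (min (p.1 ^ 2) (capR x) - 2 * sin x ^ 2) * p.1)

theorem norm_field_sub_le (x : ℝ) (p q : ℝ × ℝ) : ‖field x p - field x q‖ ≤ 40 * ‖p - q‖ := by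
  have h1 : |p.1 - q.1| ≤ ‖p - q‖ := norm_fst_le (p - q)
  have h2 : |p.2 - q.2| ≤ ‖p - q‖ := norm_snd_le (p - q)
  obtain ⟨hc0, hc1⟩ := capR_bounds x
  refine norm_prod_le_iff.2 ⟨?_, ?_⟩
  · simp only [field, Prod.fst_sub, norm_eq_abs]
    linarith [norm_nonneg (p - q)]
  · simp only [field, Prod.snd_sub, norm_eq_abs]
    have h3 := abs_min_sq_mul_sub_le (R := capR x) (by linarith) p.1 q.1
    have h4 : |2 * sin x ^ 2 * (p.1 - q.1)| ≤ 2 * |p.1 - q.1| := by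
      rw [abs_mul, abs_of_nonneg (by positivity)]
      nlinarith [sin_sq_le_one x, abs_nonneg (p.1 - q.1)]
    calc _ = |(min (p.1 ^ 2) (capR x) * p.1 - min (q.1 ^ 2) (capR x) * q.1)
          - 2 * sin x ^ 2 * (p.1 - q.1)| := by ring_nf
      _ ≤ _ := (abs_sub _ _).trans (add_le_add h3 h4)
      _ ≤ _ := by nlinarith [abs_nonneg (p.1 - q.1)]

theorem continuous_field : Continuous (Function.uncurry field) := by
  unfold field capR Function.uncurry
  fun_prop

theorem exists_isSol (h : ℝ) : ∃ u v, IsSol_s3 u v ∧ u 0 = h ∧ v 0 = 0 := by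
  obtain ⟨y, hy0, hy⟩ := exists_global_solution continuous_field (by norm_num : (0 : ℝ) < 40)
    norm_field_sub_le (fun t => by simp [field]) (h, (0 : ℝ))
  exact ⟨fun x => (y x).1, fun x => (y x).2, ⟨fun x => (hy x).fst, fun x => (hy x).snd⟩,
    by simp [hy0], by simp [hy0]⟩

theorem IsSol_s3.dist_le {u v u' v' : ℝ → ℝ} (hs : IsSol_s3 u v) (hs' : IsSol_s3 u' v') {x : ℝ}
    (hx : 0 ≤ x) :
    dist (u x, v x) (u' x, v' x) ≤ dist (u 0, v 0) (u' 0, v' 0) * exp (40 * x) := by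
  have hd : ∀ {u v : ℝ → ℝ}, IsSol_s3 u v → ∀ t,
      HasDerivAt (fun x => (u x, v x)) (field t (u t, v t)) t := fun h t =>
    (h.hasDerivAt t).prodMk (h.hasDerivAt' t)
  have := dist_le_of_trajectories_ODE (K := 40) (v := field) (a := 0) (b := x)
    (fun t => LipschitzWith.of_dist_le_mul fun p q => by
      simpa [dist_eq_norm] using norm_field_sub_le t p q)
    (fun t _ => (hd hs t).continuousAt.continuousWithinAt)
    (fun t _ => (hd hs t).hasDerivWithinAt)
    (fun t _ => (hd hs' t).continuousAt.continuousWithinAt)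
    (fun t _ => (hd hs' t).hasDerivWithinAt) le_rfl x ⟨hx, le_rfl⟩
  simpa using this

theorem IsSol_s3.comp_neg {u v : ℝ → ℝ} (hs : IsSol_s3 u v) :
    IsSol_s3 (fun x => u (-x)) (fun x => -v (-x)) := by
  refine ⟨fun x => ?_, fun x => ?_⟩
  · exact ((hs.hasDerivAt (-x)).comp x (hasDerivAt_neg x)).congr_deriv (by ring)
  · refine ((hs.hasDerivAt' (-x)).comp x (hasDerivAt_neg x)).neg.congr_deriv ?_
    simp only [capR, abs_neg, sin_neg, even_two.neg_pow]
    ring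

theorem IsSol_s3.even {u v : ℝ → ℝ} (hs : IsSol_s3 u v) (h0 : v 0 = 0) (x : ℝ) :
    u (-x) = u x ∧ v (-x) = -v x := by
  have key : ∀ x, 0 ≤ x → u (-x) = u x ∧ v (-x) = -v x := by
    intro x hx
    have h := hs.comp_neg.dist_le hs hx
    simp only [neg_zero, h0, dist_self, zero_mul] at h
    have := dist_le_zero.1 h
    rw [Prod.mk.injEq] at this
    exact ⟨this.1, by linarith [this.2]⟩
  rcases le_total 0 x with hx | hx
  · exact key x hx
  · obtain ⟨h1, h2⟩ := key (-x) (by linarith)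
    rw [neg_neg] at h1 h2
    exact ⟨h1.symm, by linarith⟩

theorem IsSol_s3.tail {u v : ℝ → ℝ} (hs : IsSol_s3 u v) : ∀ x, 9 ≤ x →
    0 ≤ min (u x ^ 2) (capR x) ∧ min (u x ^ 2) (capR x) ≤ 1 / 10 := by
  intro x hx
  refine ⟨le_min (sq_nonneg _) (by linarith [(capR_bounds x).1]), (min_le_right _ _).trans ?_⟩
  rw [capR, abs_of_nonneg (by linarith), max_eq_left (by linarith), add_zero]

theorem IsSol_s3.ca_pos {u v : ℝ → ℝ} (hs : IsSol_s3 u v) {x₁ : ℝ} (hx₁ : 9 ≤ x₁)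
    (hq : cb x₁ (u x₁) (v x₁) ^ 2 < ca x₁ (u x₁) (v x₁) ^ 2) (ha : 0 < ca x₁ (u x₁) (v x₁)) :
    ∀ x, x₁ ≤ x → 0 < ca x (u x) (v x) := by
  intro x hx
  by_contra! hneg
  have hc : ContinuousOn (fun x => ca x (u x) (v x)) (Set.Icc x₁ x) := fun y _ =>
    (hasDerivAt_ca (hs.hasDerivAt y) (hs.hasDerivAt' y)).continuousAt.continuousWithinAt
  obtain ⟨y, hy, hy0⟩ := intermediate_value_Icc' hx hc ⟨hneg, ha.le⟩
  have := monotoneOn_cone hs.hasDerivAt hs.hasDerivAt' hs.tail hx₁ (hx₁.trans hy.1) hy.1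
  simp only [hy0] at this
  nlinarith [sq_nonneg (cb y (u y) (v y))]

theorem IsSol_s3.neg {u v : ℝ → ℝ} (hs : IsSol_s3 u v) : IsSol_s3 (fun x => -u x) (fun x => -v x) := by
  refine ⟨fun x => (hs.hasDerivAt x).neg, fun x => (hs.hasDerivAt' x).neg.congr_deriv ?_⟩
  rw [neg_sq]
  ring

theorem ca_neg (x u v : ℝ) : ca x (-u) (-v) = -ca x u v := by
  simp only [ca]
  ring

theorem cb_neg (x u v : ℝ) : cb x (-u) (-v) = -cb x u v := by
  simp only [cb]
  ring

theorem IsSol_s3.ca_neg {u v : ℝ → ℝ} (hs : IsSol_s3 u v) {x₁ : ℝ} (hx₁ : 9 ≤ x₁)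
    (hq : cb x₁ (u x₁) (v x₁) ^ 2 < ca x₁ (u x₁) (v x₁) ^ 2) (ha : ca x₁ (u x₁) (v x₁) < 0) :
    ∀ x, x₁ ≤ x → ca x (u x) (v x) < 0 := by
  intro x hx
  have := hs.neg.ca_pos hx₁ (by simpa [_root_.ca_neg, cb_neg] using hq)
    (by simpa [_root_.ca_neg] using ha) x hx
  simpa [_root_.ca_neg] using this

/-- Shooting: between a trajectory which leaves along the negative growing direction and one which
leaves along the positive growing direction there is one which stays in the decaying cone. -/
theorem exists_cone {h₁ h₂ : ℝ} (hle : h₁ ≤ h₂) {X : ℝ} (hX : 9 ≤ X)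
    (hl : ∀ u v, IsSol_s3 u v → u 0 = h₁ → v 0 = 0 →
      cb X (u X) (v X) ^ 2 < ca X (u X) (v X) ^ 2 ∧ ca X (u X) (v X) < 0)
    (hr : ∀ u v, IsSol_s3 u v → u 0 = h₂ → v 0 = 0 →
      cb X (u X) (v X) ^ 2 < ca X (u X) (v X) ^ 2 ∧ 0 < ca X (u X) (v X)) :
    ∃ u v, IsSol_s3 u v ∧ u 0 ∈ Set.Icc h₁ h₂ ∧ v 0 = 0 ∧
      ∀ x, 9 ≤ x → ca x (u x) (v x) ^ 2 ≤ cb x (u x) (v x) ^ 2 := by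
  choose U V hs hU hV using exists_isSol
  by_contra! hcon
  have hcont : ∀ x, 0 ≤ x → Continuous fun h => (U h x, V h x) := fun x hx =>
    LipschitzWith.continuous (K := ⟨exp (40 * x), (exp_pos _).le⟩)
      (LipschitzWith.of_dist_le_mul fun h h' => by
        have := (hs h).dist_le (hs h') hx
        rw [hU, hU, hV, hV, dist_prod_same_right] at this
        rwa [mul_comm] at this)
  have hca : ∀ x, Continuous fun p : ℝ × ℝ => ca x p.1 p.2 := fun x => by
    unfold ca
    fun_prop
  have hcb : ∀ x, Continuous fun p : ℝ × ℝ => cb x p.1 p.2 := fun x => by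
    unfold cb
    fun_prop
  have hca' : ∀ x, 9 ≤ x → Continuous fun h => ca x (U h x) (V h x) := fun x hx =>
    (hca x).comp (hcont x (by linarith))
  have hcb' : ∀ x, 9 ≤ x → Continuous fun h => cb x (U h x) (V h x) := fun x hx =>
    (hcb x).comp (hcont x (by linarith))
  let N : Set ℝ := ⋃ x, ⋃ (_ : 9 ≤ x), {h | cb x (U h x) (V h x) ^ 2 < ca x (U h x) (V h x) ^ 2} ∩
    {h | ca x (U h x) (V h x) < 0}
  let P : Set ℝ := ⋃ x, ⋃ (_ : 9 ≤ x), {h | cb x (U h x) (V h x) ^ 2 < ca x (U h x) (V h x) ^ 2} ∩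
    {h | 0 < ca x (U h x) (V h x)}
  have hN : IsOpen N := isOpen_iUnion fun x => isOpen_iUnion fun hx =>
    (isOpen_lt ((hcb' x hx).pow 2) ((hca' x hx).pow 2)).inter
      (isOpen_lt (hca' x hx) continuous_const)
  have hP : IsOpen P := isOpen_iUnion fun x => isOpen_iUnion fun hx =>
    (isOpen_lt ((hcb' x hx).pow 2) ((hca' x hx).pow 2)).inter
      (isOpen_lt continuous_const (hca' x hx))
  have hcover : Set.Icc h₁ h₂ ⊆ N ∪ P := by
    intro h hh
    obtain ⟨x, hx, hlt⟩ := hcon (U h) (V h) (hs h) (by rwa [hU]) (hV h)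
    have hne : ca x (U h x) (V h x) ≠ 0 := by
      intro h0
      rw [h0] at hlt
      nlinarith [sq_nonneg (cb x (U h x) (V h x))]
    rcases hne.lt_or_gt with h' | h'
    · exact Or.inl (Set.mem_iUnion₂.2 ⟨x, hx, hlt, h'⟩)
    · exact Or.inr (Set.mem_iUnion₂.2 ⟨x, hx, hlt, h'⟩)
  obtain ⟨h, _, hhN, hhP⟩ := isPreconnected_Icc N P hN hP hcover
    ⟨h₁, ⟨le_rfl, hle⟩, Set.mem_iUnion₂.2 ⟨X, hX, hl _ _ (hs h₁) (hU h₁) (hV h₁)⟩⟩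
    ⟨h₂, ⟨hle, le_rfl⟩, Set.mem_iUnion₂.2 ⟨X, hX, hr _ _ (hs h₂) (hU h₂) (hV h₂)⟩⟩
  obtain ⟨x, hx, hqx, hax⟩ := Set.mem_iUnion₂.1 hhN
  obtain ⟨y, hy, hqy, hay⟩ := Set.mem_iUnion₂.1 hhP
  have h1 := (hs h).ca_neg hx hqx hax (max x y) (le_max_left _ _)
  have h2 := (hs h).ca_pos hy hqy hay (max x y) (le_max_right _ _)
  exact lt_asymm h1 h2

theorem abs_mul_sub_mul_le {x y x₀ y₀ ε δ : ℝ} (hx : |x - x₀| ≤ ε) (hy : |y - y₀| ≤ δ) :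
    |x * y - x₀ * y₀| ≤ |x₀| * δ + ε * |y₀| + ε * δ := by
  have hε := (abs_nonneg _).trans hx
  calc |x * y - x₀ * y₀| = |x₀ * (y - y₀) + (x - x₀) * y₀ + (x - x₀) * (y - y₀)| := by ring_nf
    _ ≤ _ := abs_add_three _ _ _
    _ ≤ _ := by
      rw [abs_mul, abs_mul, abs_mul]
      gcongr

theorem abs_cubic_sub_le {C c α β η : ℝ} (hC : |C| ≤ 1) (hc : |c| ≤ 1) (h : |C - c| ≤ η)
    (hα : |α| ≤ 2) (hβ : |β| ≤ 1) :
    |C * (α + β * C ^ 2) - c * (α + β * c ^ 2)| ≤ 5 * η := by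
  have h1 : |C ^ 2 + C * c + c ^ 2| ≤ 3 := by
    refine (abs_add_three _ _ _).trans ?_
    rw [abs_mul, abs_pow, abs_pow]
    nlinarith [abs_nonneg C, abs_nonneg c]
  have h2 : |α + β * (C ^ 2 + C * c + c ^ 2)| ≤ 5 := by
    refine (abs_add_le _ _).trans ?_
    rw [abs_mul]
    nlinarith [abs_nonneg β, abs_nonneg (C ^ 2 + C * c + c ^ 2)]
  rw [show C * (α + β * C ^ 2) - c * (α + β * c ^ 2)
    = (α + β * (C ^ 2 + C * c + c ^ 2)) * (C - c) by ring, abs_mul]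
  gcongr

/-- Enclosures of the approximate Floquet solution in terms of enclosures of `cos` and `sin`. -/
theorem abs_fl_sub_le {x c s η : ℝ} (hc : |cos x - c| ≤ η) (hs : |sin x - s| ≤ η)
    (hc1 : |c| ≤ 1) (hs1 : |s| ≤ 1) :
    |flE x - c * (13006 / 10000 + -(3022 / 10000) * c ^ 2)| ≤ 5 * η ∧
    |flO x - s * (-(7682 / 10000) + -(1703 / 10000) * s ^ 2)| ≤ 5 * η ∧
    |flE' x - s * (-(3940 / 10000) + -(9066 / 10000) * s ^ 2)| ≤ 5 * η ∧
    |flO' x - c * (-(12791 / 10000) + 5109 / 10000 * c ^ 2)| ≤ 5 * η := by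
  have hcs := sin_sq_add_cos_sq x
  refine ⟨?_, ?_, ?_, ?_⟩
  · rw [show flE x = cos x * (13006 / 10000 + -(3022 / 10000) * cos x ^ 2) by
      simp only [flE]; ring]
    exact abs_cubic_sub_le (abs_cos_le_one x) hc1 hc (by norm_num [abs_le]) (by norm_num [abs_le])
  · rw [show flO x = sin x * (-(7682 / 10000) + -(1703 / 10000) * sin x ^ 2) by
      simp only [flO]; ring]
    exact abs_cubic_sub_le (abs_sin_le_one x) hs1 hs (by norm_num [abs_le]) (by norm_num [abs_le])
  · rw [show flE' x = sin x * (-(3940 / 10000) + -(9066 / 10000) * sin x ^ 2) by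
      simp only [flE', cos_sq']; ring]
    exact abs_cubic_sub_le (abs_sin_le_one x) hs1 hs (by norm_num [abs_le]) (by norm_num [abs_le])
  · rw [show flO' x = cos x * (-(12791 / 10000) + 5109 / 10000 * cos x ^ 2) by
      simp only [flO', sin_sq]; ring]
    exact abs_cubic_sub_le (abs_cos_le_one x) hc1 hc (by norm_num [abs_le]) (by norm_num [abs_le])

/-- Enclosures of the coordinates `ca` and `cb` of a point. -/
theorem abs_coords_sub_le {x u v u₀ v₀ E O E' O' ε δ : ℝ} (hE : |flE x - E| ≤ δ)
    (hO : |flO x - O| ≤ δ) (hE' : |flE' x - E'| ≤ δ) (hO' : |flO' x - O'| ≤ δ)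
    (hu : |u - u₀| ≤ ε) (hv : |v - v₀| ≤ ε) :
    |ca x u v - (u₀ * (E' + O' - 2431 / 10000 * (E + O)) - v₀ * (E + O))|
      ≤ |u₀| * (3 * δ) + ε * |E' + O' - 2431 / 10000 * (E + O)| + ε * (3 * δ)
        + (|v₀| * (2 * δ) + ε * |E + O| + ε * (2 * δ)) ∧
    |cb x u v - (u₀ * (E' - O' + 2431 / 10000 * (E - O)) - v₀ * (E - O))|
      ≤ |u₀| * (3 * δ) + ε * |E' - O' + 2431 / 10000 * (E - O)| + ε * (3 * δ)
        + (|v₀| * (2 * δ) + ε * |E - O| + ε * (2 * δ)) := by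
  rw [abs_le] at hE hO hE' hO'
  constructor
  · have h1 := abs_mul_sub_mul_le hu (y := flE' x + flO' x - 2431 / 10000 * (flE x + flO x))
      (y₀ := E' + O' - 2431 / 10000 * (E + O)) (δ := 3 * δ)
      (abs_le.2 ⟨by linarith, by linarith⟩)
    have h2 := abs_mul_sub_mul_le hv (y := flE x + flO x) (y₀ := E + O) (δ := 2 * δ)
      (abs_le.2 ⟨by linarith, by linarith⟩)
    refine le_trans ?_ (add_le_add h1 h2)
    rw [ca, sub_sub_sub_comm]
    exact abs_sub _ _
  · have h1 := abs_mul_sub_mul_le hu (y := flE' x - flO' x + 2431 / 10000 * (flE x - flO x))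
      (y₀ := E' - O' + 2431 / 10000 * (E - O)) (δ := 3 * δ)
      (abs_le.2 ⟨by linarith, by linarith⟩)
    have h2 := abs_mul_sub_mul_le hv (y := flE x - flO x) (y₀ := E - O) (δ := 2 * δ)
      (abs_le.2 ⟨by linarith, by linarith⟩)
    refine le_trans ?_ (add_le_add h1 h2)
    rw [cb, sub_sub_sub_comm]
    exact abs_sub _ _

theorem Encl.bounds {u v : ℝ → ℝ} {x : ℝ} {st : St} (h : Encl u v x st) :
    |u x - st.u0 / scl| ≤ st.e / scl ∧ |v x - 8 * st.u1 / scl| ≤ st.e / scl ∧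
      |cos x - st.c0 / scl| ≤ st.g / scl ∧ |sin x - -(8 * st.c1 / scl)| ≤ st.g / scl := by
  obtain ⟨he, hg, hu, hc⟩ := h
  have hS := scl_pos
  have he' : (0 : ℝ) < st.e := by exact_mod_cast he
  have hg' : (0 : ℝ) < st.g := by exact_mod_cast hg
  refine ⟨abs_le_of_sq_le_sq ?_ (by positivity), abs_le_of_sq_le_sq ?_ (by positivity),
    abs_le_of_sq_le_sq ?_ (by positivity), abs_le_of_sq_le_sq ?_ (by positivity)⟩
  · linarith [sq_nonneg (v x - 8 * st.u1 / scl)]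
  · linarith [sq_nonneg (u x - st.u0 / scl)]
  · linarith [sq_nonneg (-sin x - 8 * st.c1 / scl)]
  · linarith [sq_nonneg (cos x - st.c0 / scl)]

theorem Encl.coords {u v : ℝ → ℝ} {x : ℝ} {st : St} (h : Encl u v x st) {u₀ v₀ c s ε η : ℝ}
    (hu : |st.u0 / scl - u₀| + st.e / scl ≤ ε) (hv : |8 * st.u1 / scl - v₀| + st.e / scl ≤ ε)
    (hc : |st.c0 / scl - c| + st.g / scl ≤ η) (hs : |-(8 * st.c1 / scl) - s| + st.g / scl ≤ η) :
    |u x - u₀| ≤ ε ∧ |v x - v₀| ≤ ε ∧ |cos x - c| ≤ η ∧ |sin x - s| ≤ η := by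
  obtain ⟨h1, h2, h3, h4⟩ := h.bounds
  refine ⟨?_, ?_, ?_, ?_⟩
  · linarith [abs_sub_le (u x) (st.u0 / scl) u₀]
  · linarith [abs_sub_le (v x) (8 * st.u1 / scl) v₀]
  · linarith [abs_sub_le (cos x) (st.c0 / scl) c]
  · linarith [abs_sub_le (sin x) (-(8 * st.c1 / scl)) s]

theorem left_endpoint {u v : ℝ → ℝ} (hs : IsSol_s3 u v) (hu : u 0 = 929752530005 / scl)
    (hv : v 0 = 0) :
    cb 16 (u 16) (v 16) ^ 2 < ca 16 (u 16) (v 16) ^ 2 ∧ ca 16 (u 16) (v 16) < 0 := by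
  obtain ⟨st, hst, hE, -⟩ := run_sound hs run_left
    ⟨by norm_num, by norm_num, by simp [hu, hv, scl], by simp [scl]⟩
  rw [isState_eq_true hst, show (((0 + 128 : ℕ) : ℝ) / 8) = 16 by norm_num] at hE
  obtain ⟨h1, h2, h3, h4⟩ := hE.coords (u₀ := -0.0185) (v₀ := -0.0487) (c := -0.9577)
    (s := -0.2879) (ε := 0.0008) (η := 0.0001) (by norm_num [scl, abs_le]) (by norm_num [scl])
    (by norm_num [scl]) (by norm_num [scl])
  obtain ⟨f1, f2, f3, f4⟩ := abs_fl_sub_le h3 h4 (by norm_num [abs_le]) (by norm_num [abs_le])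
  obtain ⟨ha, hb⟩ := abs_coords_sub_le f1 f2 f3 f4 h1 h2
  norm_num [abs_le] at ha hb
  exact ⟨by nlinarith, by linarith⟩

theorem right_endpoint {u v : ℝ → ℝ} (hs : IsSol_s3 u v) (hu : u 0 = 929834993377 / scl)
    (hv : v 0 = 0) :
    cb 16 (u 16) (v 16) ^ 2 < ca 16 (u 16) (v 16) ^ 2 ∧ 0 < ca 16 (u 16) (v 16) := by
  obtain ⟨st, hst, hE, -⟩ := run_sound hs run_right
    ⟨by norm_num, by norm_num, by simp [hu, hv, scl], by simp [scl]⟩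
  rw [isState_eq_true hst, show (((0 + 128 : ℕ) : ℝ) / 8) = 16 by norm_num] at hE
  obtain ⟨h1, h2, h3, h4⟩ := hE.coords (u₀ := 0.0473) (v₀ := 0.0022) (c := -0.9577)
    (s := -0.2879) (ε := 0.0008) (η := 0.0001) (by norm_num [scl]) (by norm_num [scl])
    (by norm_num [scl]) (by norm_num [scl])
  obtain ⟨f1, f2, f3, f4⟩ := abs_fl_sub_le h3 h4 (by norm_num [abs_le]) (by norm_num [abs_le])
  obtain ⟨ha, hb⟩ := abs_coords_sub_le f1 f2 f3 f4 h1 h2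
  norm_num [abs_le] at ha hb
  exact ⟨by nlinarith, by linarith⟩

theorem center_tube {u v : ℝ → ℝ} (hs : IsSol_s3 u v)
    (hu : u 0 ∈ Set.Icc (929752530005 / scl : ℝ) (929834993377 / scl)) (hv : v 0 = 0) :
    (∀ x ∈ Set.Ico (0 : ℝ) 9, u x ^ 2 ≤ capR x) ∧ cb 9 (u 9) (v 9) ^ 2 ≤ 0.09 := by
  obtain ⟨st, hst, hE, ht⟩ := run_sound hs run_center
    ⟨by norm_num, by norm_num, by
      norm_num [scl] at hu
      norm_num [hv, scl]
      nlinarith [mul_nonneg (sub_nonneg.2 hu.1) (sub_nonneg.2 hu.2)], by simp [scl]⟩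
  rw [isState_eq_true hst, show (((0 + 72 : ℕ) : ℝ) / 8) = 9 by norm_num] at hE
  refine ⟨fun x hx => ht x (by norm_num; exact hx), ?_⟩
  obtain ⟨h1, h2, h3, h4⟩ := hE.coords (u₀ := 0.1438) (v₀ := -0.0974) (c := -0.9111)
    (s := 0.4121) (ε := 0.0327) (η := 0.0001) (by norm_num [scl]) (by norm_num [scl])
    (by norm_num [scl]) (by norm_num [scl])
  obtain ⟨f1, f2, f3, f4⟩ := abs_fl_sub_le h3 h4 (by norm_num [abs_le]) (by norm_num [abs_le])
  obtain ⟨-, hb⟩ := abs_coords_sub_le f1 f2 f3 f4 h1 h2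
  norm_num [abs_le] at hb
  nlinarith

/-- **Theorem 4.3 of the paper.**  The time-independent Gross–Pitaevskii equation
`u'' + (a − b cos(2x)) u − c u³ = 0` with parameters `a = 1`, `b = 1`,
`c = 1` has a soliton solution `u : ℝ → ℝ` (a `C²` solution on all of `ℝ` with
`(u(x), u'(x)) → (0,0)` as `x → ±∞`) that is even and not identically zero. -/
theorem gross_pitaevskii_soliton_a1_b1_c1 :
    ∃ u : ℝ → ℝ,
      ContDiff ℝ 2 u ∧
      (∀ x : ℝ,
        deriv (deriv u) x + ((1 : ℝ) - (1 : ℝ) * Real.cos (2 * x)) * u x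
          - (1 : ℝ) * (u x) ^ 3 = 0) ∧
      Tendsto (fun x : ℝ => (u x, deriv u x)) atTop (nhds (0, 0)) ∧
      Tendsto (fun x : ℝ => (u x, deriv u x)) atBot (nhds (0, 0)) ∧
      (∀ x : ℝ, u (-x) = u x) ∧
      u ≠ 0 := by
  obtain ⟨u, v, hs, hu, hv, hc⟩ := exists_cone
    (h₁ := 929752530005 / scl) (h₂ := 929834993377 / scl) (by norm_num [scl])
    (by norm_num : (9 : ℝ) ≤ 16) (fun _ _ => left_endpoint) (fun _ _ => right_endpoint)
  obtain ⟨htube, hb⟩ := center_tube hs hu hv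
  have heven := hs.even hv
  have hcap : ∀ x, 0 ≤ x → u x ^ 2 ≤ capR x := by
    intro x hx
    rcases lt_or_ge x 9 with h | h
    · exact htube x ⟨hx, h⟩
    · have h1 := cb_sq_le hs.hasDerivAt hs.hasDerivAt' hs.tail hc h
      have h2 := hc x h
      have h3 := sq_le_of_coords x (u x) (v x)
      have h4 : exp (-(1 / 50 * (x - 9))) ≤ 1 := exp_le_one_iff.2 (by linarith)
      have h5 := mul_le_mul hb h4 (exp_pos _).le (by norm_num)
      linarith [(capR_bounds x).1]
  have hsol : ∀ x, HasDerivAt v ((u x ^ 2 - 2 * sin x ^ 2) * u x) x := by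
    intro x
    have h : u x ^ 2 ≤ capR x := by
      rcases le_total 0 x with hx | hx
      · exact hcap x hx
      · have := hcap (-x) (by linarith)
        rwa [(heven x).1, capR, abs_neg] at this
    simpa only [min_eq_left h] using hs.hasDerivAt' x
  have hdu : deriv u = v := funext fun x => (hs.hasDerivAt x).deriv
  have hdv : deriv v = fun x => (u x ^ 2 - 2 * sin x ^ 2) * u x := funext fun x => (hsol x).deriv
  have htop := tendsto_zero_of_cone hs.hasDerivAt hs.hasDerivAt' hs.tail hc
  have hcu : Continuous u := continuous_iff_continuousAt.2 fun x => (hs.hasDerivAt x).continuousAt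
  refine ⟨u, ?_, ?_, ?_, ?_, fun x => (heven x).1, ?_⟩
  · rw [show (2 : WithTop ℕ∞) = 1 + 1 by norm_num, contDiff_succ_iff_deriv, hdu,
      contDiff_one_iff_deriv, hdv]
    exact ⟨fun x => (hs.hasDerivAt x).differentiableAt, by simp,
      fun x => (hsol x).differentiableAt, by fun_prop⟩
  · intro x
    rw [hdu, hdv, cos_two_mul, cos_sq']
    ring
  · rw [hdu]
    exact htop.1.prodMk_nhds htop.2
  · rw [hdu]
    have h1 := htop.1.comp tendsto_neg_atBot_atTop
    have h2 := (htop.2.comp tendsto_neg_atBot_atTop).neg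
    rw [neg_zero] at h2
    refine (h1.prodMk_nhds h2).congr fun x => ?_
    simp [heven]
  · rintro rfl
    norm_num [scl] at hu
end
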